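/- Let m ≥ 1 and let μ be the restriction to the unit sphere S^{2m−1} := {y ∈ ℝ^{2m} : |y| = 1} of the (2m−1)-dimensional Hausdorff measure on ℝ^{2m}. Then for every p with 1 < p ≤ ∞ there exists a constant C_p > 0 such that for every continuous compactly supported f : ℝ^{2m+1} → ℝ, ‖ (x,u) ↦ sup_{k ∈ ℤ} | ∫_{S^{2m−1}} f(x − 2^k y, u − 2^k x^⊤Jy) dμ(y) | ‖_{L^p(ℝ^{2m+1})} ≤ C_p ‖f‖_{L^p(ℝ^{2m+1})}. (The lacunary horizontal (Nevo–Thangavelu type) spherical maximal theorem on the Heisenberg group.) -/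

import Mathlib

open MeasureTheory ENNReal Real Filter

noncomputable section

/-- The horizontal layer `ℝ^{2m}` with the Euclidean norm. -/
abbrev Vm (m : ℕ) := EuclideanSpace ℝ (Fin (2 * m))

/-- The Heisenberg group `ℍ^m = ℝ^{2m} × ℝ` (product coordinates `(x, u)`). -/
abbrev HP (m : ℕ) := Vm m × ℝ

/-- The symplectic form `x^⊤Jy = (1/2) ∑_{j=1}^m (x_j y_{m+j} - x_{m+j} y_j)`. -/
def sympV (m : ℕ) (x y : Vm m) : ℝ :=
  (1 / 2) * ∑ j : Fin m,
    (x ⟨(j : ℕ), by omega⟩ * y ⟨m + (j : ℕ), by omega⟩ -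
      x ⟨m + (j : ℕ), by omega⟩ * y ⟨(j : ℕ), by omega⟩)

/-- The Heisenberg group product `(x,u)·(y,v) = (x + y, u + v + x^⊤Jy)`. -/
def pmul (m : ℕ) (z w : HP m) : HP m :=
  (z.1 + w.1, z.2 + w.2 + sympV m z.1 w.1)

/-- The Heisenberg group inverse `(x,u)⁻¹ = (-x,-u)`. -/
def pinv (m : ℕ) (z : HP m) : HP m := (-z.1, -z.2)

/-- The surface measure on the Euclidean unit sphere `S^{2m-1} ⊆ ℝ^{2m}`: the
restriction to it of the `(2m-1)`-dimensional Hausdorff measure. -/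
def sphMeas (m : ℕ) : Measure (Vm m) :=
  (Measure.hausdorffMeasure (2 * (m : ℝ) - 1) : Measure (Vm m)).restrict
    (Metric.sphere (0 : Vm m) 1)

open Topology

/-- The underlying space of the first Heisenberg group, in coordinates `((x₁, x₂), u)`. -/
abbrev G1 := (ℝ × ℝ) × ℝ

/-- The group law of the first Heisenberg group. -/
def gmul (z w : G1) : G1 :=
  ((z.1.1 + w.1.1, z.1.2 + w.1.2), z.2 + w.2 + (z.1.1 * w.1.2 - z.1.2 * w.1.1) / 2)

/-- The automorphic dilations of the first Heisenberg group. -/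
def gdil (r : ℝ) (z : G1) : G1 := ((r * z.1.1, r * z.1.2), r ^ 2 * z.2)

/-- The horizontal unit circle. -/
def gcirc (θ : ℝ) : G1 := ((Real.cos θ, Real.sin θ), 0)

/-- The homogeneous box of radius `r` around the identity. -/
def gbox (r : ℝ) : Set G1 := {z | |z.1.1| ≤ r ∧ |z.1.2| ≤ r ∧ |z.2| ≤ r ^ 2}

lemma gmul_assoc (a b c : G1) : gmul (gmul a b) c = gmul a (gmul b c) := by
  simp only [gmul, Prod.mk.injEq]; refine ⟨⟨by ring, by ring⟩, by ring⟩

lemma gmul_neg (a : G1) : gmul a (-a) = 0 := by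
  simp only [gmul, Prod.ext_iff, Prod.fst_neg, Prod.snd_neg, Prod.fst_zero, Prod.snd_zero]
  refine ⟨⟨by ring, by ring⟩, by ring⟩

lemma neg_gmul (a : G1) : gmul (-a) a = 0 := by
  simpa using gmul_neg (-a)

lemma gmul_zero (a : G1) : gmul a 0 = a := by
  simp [gmul]

lemma zero_gmul (a : G1) : gmul 0 a = a := by
  simp [gmul]

lemma gdil_gmul (r : ℝ) (a b : G1) : gdil r (gmul a b) = gmul (gdil r a) (gdil r b) := by
  simp only [gmul, gdil, Prod.mk.injEq]; refine ⟨⟨by ring, by ring⟩, by ring⟩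

lemma gdil_gdil (r s : ℝ) (a : G1) : gdil r (gdil s a) = gdil (r * s) a := by
  simp only [gdil, Prod.mk.injEq]; refine ⟨⟨by ring, by ring⟩, by ring⟩

lemma gdil_zero (r : ℝ) : gdil r 0 = 0 := by
  simp [gdil]

lemma continuous_gmul : Continuous fun p : G1 × G1 => gmul p.1 p.2 := by
  unfold gmul; fun_prop

lemma continuous_gdil (r : ℝ) : Continuous (gdil r) := by
  unfold gdil; fun_prop

lemma continuous_gcirc : Continuous gcirc := by
  unfold gcirc; fun_prop

/-- The normalized Lebesgue measure on a period. -/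
def cm : Measure ℝ := (ENNReal.ofReal (2 * π))⁻¹ • volume.restrict (Set.Ioc 0 (2 * π))

instance : IsProbabilityMeasure cm := ⟨by
  have h : ENNReal.ofReal (2 * π) ≠ 0 := by
    simp only [ne_eq, ENNReal.ofReal_eq_zero, not_le]; positivity
  rw [cm, Measure.smul_apply, Measure.restrict_apply_univ, Real.volume_Ioc, sub_zero, smul_eq_mul,
    ENNReal.inv_mul_cancel h ENNReal.ofReal_ne_top]⟩

lemma integral_cm (h : ℝ → ℝ) : ∫ x, h x ∂cm = (2 * π)⁻¹ * ∫ x in (0 : ℝ)..2 * π, h x := by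
  rw [cm, integral_smul_measure, intervalIntegral.integral_of_le (by positivity),
    ENNReal.toReal_inv, ENNReal.toReal_ofReal (by positivity), smul_eq_mul]

lemma cm_compl : cm (Set.Icc 0 (2 * π))ᶜ = 0 := by
  rw [cm, Measure.smul_apply, Measure.restrict_apply measurableSet_Icc.compl]
  have : (Set.Icc 0 (2 * π))ᶜ ∩ Set.Ioc 0 (2 * π) = ∅ := by
    ext x; simp only [Set.mem_inter_iff, Set.mem_compl_iff, Set.mem_Icc, Set.mem_Ioc,
      Set.mem_empty_iff_false, iff_false]
    rintro ⟨h1, h2, h3⟩; exact h1 ⟨h2.le, h3⟩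
  simp [this]

lemma integral_cm_deriv {h h' : ℝ → ℝ} (hd : ∀ x, HasDerivAt h (h' x) x) (hc : Continuous h')
    (hp : h (2 * π) = h 0) : ∫ x, h' x ∂cm = 0 := by
  rw [integral_cm, intervalIntegral.integral_eq_sub_of_hasDerivAt (fun x _ => hd x)
    (hc.intervalIntegrable _ _), hp]
  simp

lemma integral_cm_shift {h : ℝ → ℝ} (hp : Function.Periodic h (2 * π)) (c : ℝ) :
    ∫ x, h (x + c) ∂cm = ∫ x, h x ∂cm := by
  rw [integral_cm, integral_cm, intervalIntegral.integral_comp_add_right, zero_add, add_comm _ c]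
  congr 1
  simpa using hp.intervalIntegral_add_eq c 0

lemma integrable_of_compact_support {X : Type*} [TopologicalSpace X] [T2Space X]
    [MeasurableSpace X]
    [OpensMeasurableSpace X] [SecondCountableTopology X] {μ : Measure X} [IsFiniteMeasure μ]
    {K : Set X} (hK : IsCompact K) (h : μ Kᶜ = 0) {F : X → ℝ} (hF : Continuous F) :
    Integrable F μ := by
  obtain ⟨C, hC⟩ := hK.exists_bound_of_continuousOn hF.continuousOn
  refine Integrable.of_bound hF.aestronglyMeasurable C ?_
  have : ∀ᵐ x ∂μ, x ∈ K := h
  filter_upwards [this] with x hx using hC x hx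

lemma prod_compl_null {X Y : Type*} [MeasurableSpace X] [MeasurableSpace Y] {μ : Measure X}
    {ν : Measure Y} [SFinite μ] [SFinite ν] {K : Set X} {L : Set Y} (hK : μ Kᶜ = 0)
    (hL : ν Lᶜ = 0) : (μ.prod ν) (K ×ˢ L)ᶜ = 0 := by
  rw [Set.compl_prod_eq_union]
  refine measure_union_null ?_ ?_ <;> simp [Measure.prod_prod, hK, hL]

lemma integral_kernel_le (η : ℝ) (hη : 0 < η) (c : ℝ) :
    ∫ x, η ^ 2 / (Real.sin ((x + c) / 2) ^ 2 + η ^ 2) ∂cm ≤ π * η := by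
  have hper : Function.Periodic (fun x => η ^ 2 / (Real.sin (x / 2) ^ 2 + η ^ 2)) (2 * π) := by
    intro x
    have : Real.sin ((x + 2 * π) / 2) = - Real.sin (x / 2) := by
      rw [show (x + 2 * π) / 2 = x / 2 + π by ring, Real.sin_add_pi]
    simp [this]
  rw [integral_cm_shift hper c, integral_cm]
  have h1 := hper.intervalIntegral_add_eq 0 (-π)
  rw [zero_add, show -π + 2 * π = π by ring] at h1
  rw [h1]
  have hb : ∀ x ∈ Set.Icc (-π) π, η ^ 2 / (Real.sin (x / 2) ^ 2 + η ^ 2)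
      ≤ (1 + (x * (π * η)⁻¹) ^ 2)⁻¹ := by
    intro x hx
    have h2 : |x / π| ≤ |Real.sin (x / 2)| := by
      rw [abs_div, abs_of_pos Real.pi_pos]
      have hx' : |x| ≤ π := abs_le.2 hx
      have := Real.mul_abs_le_abs_sin (x := x / 2) (by rw [abs_div, abs_two]; linarith)
      rw [abs_div, abs_two] at this
      calc |x| / π = 2 / π * (|x| / 2) := by ring
        _ ≤ _ := this
    have h3 : (x / π) ^ 2 ≤ Real.sin (x / 2) ^ 2 := sq_le_sq.2 h2
    have h4 : (1 + (x * (π * η)⁻¹) ^ 2)⁻¹ = η ^ 2 / ((x / π) ^ 2 + η ^ 2) := by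
      have := Real.pi_pos
      field_simp
      ring
    rw [h4]
    gcongr
  have hcont : Continuous fun x : ℝ => η ^ 2 / (Real.sin (x / 2) ^ 2 + η ^ 2) := by
    refine Continuous.div (by fun_prop) (by fun_prop) fun x => by positivity
  have hcont2 : Continuous fun x : ℝ => (1 + (x * (π * η)⁻¹) ^ 2)⁻¹ := by
    refine Continuous.inv₀ (by fun_prop) fun x => by positivity
  have h5 := intervalIntegral.integral_mono_on (μ := volume) (a := -π) (b := π)
    (by linarith [Real.pi_pos])
    (hcont.intervalIntegrable _ _) (hcont2.intervalIntegrable _ _) hb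
  have h6 : ∫ x in (-π)..π, (1 + (x * (π * η)⁻¹) ^ 2)⁻¹ ≤ (π * η) * π := by
    have hne : (π * η)⁻¹ ≠ 0 := by have := Real.pi_pos; positivity
    rw [intervalIntegral.integral_comp_mul_right (fun x => (1 + x ^ 2)⁻¹) hne, inv_inv,
      integral_inv_one_add_sq, smul_eq_mul]
    have := Real.arctan_lt_pi_div_two (π * (π * η)⁻¹)
    have := Real.neg_pi_div_two_lt_arctan (-π * (π * η)⁻¹)
    have := Real.pi_pos
    gcongr
    linarith
  calc (2 * π)⁻¹ * _ ≤ (2 * π)⁻¹ * ((π * η) * π) := by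
        gcongr
        exact h5.trans h6
    _ = π * η / 2 := by have := Real.pi_pos; field_simp
    _ ≤ π * η := by have := Real.pi_pos; have : 0 < π * η := by positivity
                    linarith

/-- A continuous function is bounded on the unit cube. -/
lemma exists_bound_unit_cube {n : ℕ} (f : (Fin n → ℝ) → ℝ) (hf : Continuous f) :
    ∃ C, 0 ≤ C ∧ ∀ x, (∀ i, |x i| ≤ 1) → |f x| ≤ C := by
  obtain ⟨C, hC⟩ := (isCompact_univ_pi fun _ : Fin n =>
    isCompact_Icc (a := (-1 : ℝ)) (b := 1)).exists_bound_of_continuousOn hf.continuousOn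
  refine ⟨max C 0, le_max_right _ _, fun x hx => ?_⟩
  exact (hC x fun i _ => abs_le.1 (hx i)).trans (le_max_left _ _)

/-- The product of three normalized Lebesgue measures on a period. -/
def cm3 : Measure (ℝ × ℝ × ℝ) := cm.prod (cm.prod cm)

instance : IsProbabilityMeasure cm3 := by unfold cm3; infer_instance

/-- The cube that carries `cm3`. -/
def cube3 : Set (ℝ × ℝ × ℝ) :=
  Set.Icc 0 (2 * π) ×ˢ (Set.Icc 0 (2 * π) ×ˢ Set.Icc 0 (2 * π))

lemma isCompact_cube3 : IsCompact cube3 :=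
  isCompact_Icc.prod (isCompact_Icc.prod isCompact_Icc)

lemma cm3_compl : cm3 cube3ᶜ = 0 :=
  prod_compl_null cm_compl (prod_compl_null cm_compl cm_compl)

lemma integrable_cm3 {F : ℝ × ℝ × ℝ → ℝ} (hF : Continuous F) : Integrable F cm3 :=
  integrable_of_compact_support isCompact_cube3 cm3_compl hF

lemma integral_cm3 {F : ℝ × ℝ × ℝ → ℝ} (hF : Continuous F) :
    ∫ x, F x ∂cm3 = ∫ a, ∫ b, ∫ c, F (a, b, c) ∂cm ∂cm ∂cm := by
  have h := integrable_cm3 hF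
  unfold cm3 at h ⊢
  rw [integral_prod _ h]
  congr 1; ext a
  rw [integral_prod]
  exact integrable_of_compact_support (isCompact_Icc.prod isCompact_Icc)
    (prod_compl_null cm_compl cm_compl) (by fun_prop)

lemma integral_cm3_eq_zero_fst {F : ℝ × ℝ × ℝ → ℝ} (hF : Continuous F)
    (h0 : ∀ b c, ∫ a, F (a, b, c) ∂cm = 0) : ∫ x, F x ∂cm3 = 0 := by
  have h := integrable_cm3 hF
  unfold cm3 at h ⊢
  rw [integral_prod_symm _ h]
  simp [h0]

lemma integral_cm3_eq_zero_snd {F : ℝ × ℝ × ℝ → ℝ} (hF : Continuous F)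
    (h0 : ∀ a c, ∫ b, F (a, b, c) ∂cm = 0) : ∫ x, F x ∂cm3 = 0 := by
  have h := integrable_cm3 hF
  unfold cm3 at h ⊢
  rw [integral_prod _ h]
  have : ∀ a, ∫ y, F (a, y) ∂(cm.prod cm) = 0 := by
    intro a
    rw [integral_prod_symm]
    · simp [h0]
    · exact integrable_of_compact_support (isCompact_Icc.prod isCompact_Icc)
        (prod_compl_null cm_compl cm_compl) (by fun_prop)
  simp [this]

lemma integral_cm3_eq_zero_thd {F : ℝ × ℝ × ℝ → ℝ} (hF : Continuous F)
    (h0 : ∀ a b, ∫ c, F (a, b, c) ∂cm = 0) : ∫ x, F x ∂cm3 = 0 := by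
  rw [integral_cm3 hF]
  simp [h0]

/-- Coordinates of three angles together with a tangent direction. -/
def hX (p : ℝ × ℝ × ℝ) (w : G1) : Fin 9 → ℝ :=
  ![Real.cos p.1, Real.sin p.1, Real.cos p.2.1, Real.sin p.2.1, Real.cos p.2.2, Real.sin p.2.2,
    w.1.1, w.1.2, w.2]

/-- The velocity of `hX` in the first angle. -/
def hE1 (p : ℝ × ℝ × ℝ) : Fin 9 → ℝ := ![-Real.sin p.1, Real.cos p.1, 0, 0, 0, 0, 0, 0, 0]
/-- The velocity of `hX` in the second angle. -/
def hE2 (p : ℝ × ℝ × ℝ) : Fin 9 → ℝ := ![0, 0, -Real.sin p.2.1, Real.cos p.2.1, 0, 0, 0, 0, 0]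
/-- The velocity of `hX` in the third angle. -/
def hE3 (p : ℝ × ℝ × ℝ) : Fin 9 → ℝ := ![0, 0, 0, 0, -Real.sin p.2.2, Real.cos p.2.2, 0, 0, 0]

/-- A `3 × 3` determinant given by its rows. -/
def det3 (x₁ y₁ p₁ x₂ y₂ p₂ x₃ y₃ p₃ : ℝ) : ℝ :=
  x₁ * (y₂ * p₃ - p₂ * y₃) - y₁ * (x₂ * p₃ - p₂ * x₃) + p₁ * (x₂ * y₃ - y₂ * x₃)

/-- Central component, in the left-invariant frame, of the first partial derivative of the product
of three circles. -/
def hp1 (x : Fin 9 → ℝ) : ℝ :=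
  -(x 0 ^ 2 + x 1 ^ 2) / 2 - (x 0 * x 2 + x 1 * x 3) - (x 0 * x 4 + x 1 * x 5)
/-- Central component of the second partial derivative. -/
def hp2 (x : Fin 9 → ℝ) : ℝ := -(x 2 ^ 2 + x 3 ^ 2) / 2 - (x 2 * x 4 + x 3 * x 5)
/-- Central component of the third partial derivative. -/
def hp3 (x : Fin 9 → ℝ) : ℝ := -(x 4 ^ 2 + x 5 ^ 2) / 2

/-- The Jacobian of the product of three circles. -/
def hD (x : Fin 9 → ℝ) : ℝ :=
  det3 (-x 1) (x 0) (hp1 x) (-x 3) (x 2) (hp2 x) (-x 5) (x 4) (hp3 x)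
/-- First Cramer numerator. -/
def hb1 (x : Fin 9 → ℝ) : ℝ :=
  det3 (x 6) (x 7) (x 8) (-x 3) (x 2) (hp2 x) (-x 5) (x 4) (hp3 x)
/-- Second Cramer numerator. -/
def hb2 (x : Fin 9 → ℝ) : ℝ :=
  det3 (-x 1) (x 0) (hp1 x) (x 6) (x 7) (x 8) (-x 5) (x 4) (hp3 x)
/-- Third Cramer numerator. -/
def hb3 (x : Fin 9 → ℝ) : ℝ :=
  det3 (-x 1) (x 0) (hp1 x) (-x 3) (x 2) (hp2 x) (x 6) (x 7) (x 8)

lemma contDiff_hD : ContDiff ℝ 1 hD := by unfold hD det3 hp1 hp2 hp3; fun_prop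
lemma contDiff_hb1 : ContDiff ℝ 1 hb1 := by unfold hb1 det3 hp2 hp3; fun_prop
lemma contDiff_hb2 : ContDiff ℝ 1 hb2 := by unfold hb2 det3 hp1 hp3; fun_prop
lemma contDiff_hb3 : ContDiff ℝ 1 hb3 := by unfold hb3 det3 hp1 hp2; fun_prop

/-- The product of three points of the unit circle. -/
def tri (p : ℝ × ℝ × ℝ) : G1 := gmul (gmul (gcirc p.1) (gcirc p.2.1)) (gcirc p.2.2)

lemma continuous_hX (w : G1) : Continuous fun p => hX p w := by
  refine continuous_pi fun i => ?_
  fin_cases i <;> simp [hX] <;> fun_prop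
lemma continuous_hE1 : Continuous hE1 := by
  refine continuous_pi fun i => ?_
  fin_cases i <;> simp [hE1] <;> fun_prop
lemma continuous_hE2 : Continuous hE2 := by
  refine continuous_pi fun i => ?_
  fin_cases i <;> simp [hE2] <;> fun_prop
lemma continuous_hE3 : Continuous hE3 := by
  refine continuous_pi fun i => ?_
  fin_cases i <;> simp [hE3] <;> fun_prop

lemma hasDerivAt_hX1 (a b c : ℝ) (w : G1) :
    HasDerivAt (fun a => hX (a, b, c) w) (hE1 (a, b, c)) a := by
  rw [hasDerivAt_pi]
  intro i
  fin_cases i <;> simp [hX, hE1, Real.hasDerivAt_sin, Real.hasDerivAt_cos, hasDerivAt_const]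
lemma hasDerivAt_hX2 (a b c : ℝ) (w : G1) :
    HasDerivAt (fun b => hX (a, b, c) w) (hE2 (a, b, c)) b := by
  rw [hasDerivAt_pi]
  intro i
  fin_cases i <;> simp [hX, hE2, Real.hasDerivAt_sin, Real.hasDerivAt_cos, hasDerivAt_const]
lemma hasDerivAt_hX3 (a b c : ℝ) (w : G1) :
    HasDerivAt (fun c => hX (a, b, c) w) (hE3 (a, b, c)) c := by
  rw [hasDerivAt_pi]
  intro i
  fin_cases i <;> simp [hX, hE3, Real.hasDerivAt_sin, Real.hasDerivAt_cos, hasDerivAt_const]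

/-- Partial derivatives of `gmul (tri (a, b, c)) (t • w)`. -/
def dtri1 (p : ℝ × ℝ × ℝ) (t : ℝ) (w : G1) : G1 :=
  ((-sin p.1, cos p.1), ((-sin p.1 * sin p.2.1 - cos p.1 * cos p.2.1)
    + (-sin p.1 * sin p.2.2 - cos p.1 * cos p.2.2) + t * (-sin p.1 * w.1.2 - cos p.1 * w.1.1)) / 2)
/-- The partial derivative in the second angle. -/
def dtri2 (p : ℝ × ℝ × ℝ) (t : ℝ) (w : G1) : G1 :=
  ((-sin p.2.1, cos p.2.1), ((cos p.1 * cos p.2.1 + sin p.1 * sin p.2.1)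
    + (-sin p.2.1 * sin p.2.2 - cos p.2.1 * cos p.2.2)
    + t * (-sin p.2.1 * w.1.2 - cos p.2.1 * w.1.1)) / 2)
/-- The partial derivative in the third angle. -/
def dtri3 (p : ℝ × ℝ × ℝ) (t : ℝ) (w : G1) : G1 :=
  ((-sin p.2.2, cos p.2.2), ((cos p.1 + cos p.2.1) * cos p.2.2 + (sin p.1 + sin p.2.1) * sin p.2.2
    + t * (-sin p.2.2 * w.1.2 - cos p.2.2 * w.1.1)) / 2)
/-- The derivative along the one-parameter group. -/
def dtri4 (p : ℝ × ℝ × ℝ) (w : G1) : G1 :=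
  ((w.1.1, w.1.2), w.2 + ((cos p.1 + cos p.2.1 + cos p.2.2) * w.1.2
    - (sin p.1 + sin p.2.1 + sin p.2.2) * w.1.1) / 2)

lemma tri_cramer (p : ℝ × ℝ × ℝ) (t : ℝ) (w : G1) :
    hD (hX p w) • dtri4 p w = hb1 (hX p w) • dtri1 p t w + hb2 (hX p w) • dtri2 p t w
      + hb3 (hX p w) • dtri3 p t w := by
  simp only [hD, hb1, hb2, hb3, hp1, hp2, hp3, det3, dtri1, dtri2, dtri3, dtri4, hX, Prod.ext_iff,
    Prod.smul_mk, Prod.mk_add_mk, smul_eq_mul, Matrix.cons_val]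
  refine ⟨⟨by ring, by ring⟩, by ring⟩

lemma hasDerivAt_mk {x y u : ℝ → ℝ} {x' y' u' t : ℝ} (hx : HasDerivAt x x' t)
    (hy : HasDerivAt y y' t) (hu : HasDerivAt u u' t) :
    HasDerivAt (fun s => (((x s, y s), u s) : G1)) ((x', y'), u') t :=
  (hx.prodMk hy).prodMk hu

lemma hasDerivAt_tri1 (a b c t : ℝ) (w : G1) :
    HasDerivAt (fun a => gmul (tri (a, b, c)) (t • w)) (dtri1 (a, b, c) t w) a := by
  have hs := Real.hasDerivAt_sin a
  have hc := Real.hasDerivAt_cos a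
  simp only [tri, gmul, gcirc, dtri1, Prod.smul_fst, Prod.smul_snd, smul_eq_mul]
  refine hasDerivAt_mk ?_ ?_ ?_
  · simpa using hc
  · simpa using hs
  · have h := ((((hc.mul_const (sin b)).sub (hs.mul_const (cos b))).add
      ((hc.mul_const (sin c)).sub (hs.mul_const (cos c)))).add
      ((hc.mul_const (t * w.1.2)).sub (hs.mul_const (t * w.1.1)))).div_const 2
    refine (HasDerivAt.congr_of_eventuallyEq (h.add_const
      ((cos b * sin c - sin b * cos c) / 2 + t * w.2 +
      (cos b + cos c) * (t * w.1.2) / 2 - (sin b + sin c) * (t * w.1.1) / 2))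
      (Eventually.of_forall fun x => ?_)).congr_deriv ?_
    · simp only [Pi.add_apply, Pi.sub_apply]; ring
    · ring

lemma hasDerivAt_tri2 (a b c t : ℝ) (w : G1) :
    HasDerivAt (fun b => gmul (tri (a, b, c)) (t • w)) (dtri2 (a, b, c) t w) b := by
  have hs := Real.hasDerivAt_sin b
  have hc := Real.hasDerivAt_cos b
  simp only [tri, gmul, gcirc, dtri2, Prod.smul_fst, Prod.smul_snd, smul_eq_mul]
  refine hasDerivAt_mk ?_ ?_ ?_
  · simpa using hc
  · simpa using hs
  · have h := ((((hs.const_mul (cos a)).sub (hc.const_mul (sin a))).add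
      ((hc.mul_const (sin c)).sub (hs.mul_const (cos c)))).add
      ((hc.mul_const (t * w.1.2)).sub (hs.mul_const (t * w.1.1)))).div_const 2
    refine (HasDerivAt.congr_of_eventuallyEq (h.add_const
      ((cos a * sin c - sin a * cos c) / 2 + t * w.2 +
      (cos a + cos c) * (t * w.1.2) / 2 - (sin a + sin c) * (t * w.1.1) / 2))
      (Eventually.of_forall fun x => ?_)).congr_deriv ?_
    · simp only [Pi.add_apply, Pi.sub_apply]; ring
    · ring

lemma hasDerivAt_tri3 (a b c t : ℝ) (w : G1) :
    HasDerivAt (fun c => gmul (tri (a, b, c)) (t • w)) (dtri3 (a, b, c) t w) c := by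
  have hs := Real.hasDerivAt_sin c
  have hc := Real.hasDerivAt_cos c
  simp only [tri, gmul, gcirc, dtri3, Prod.smul_fst, Prod.smul_snd, smul_eq_mul]
  refine hasDerivAt_mk ?_ ?_ ?_
  · simpa using hc
  · simpa using hs
  · have h := (((hs.const_mul (cos a + cos b)).sub (hc.const_mul (sin a + sin b))).add
      ((hc.mul_const (t * w.1.2)).sub (hs.mul_const (t * w.1.1)))).div_const 2
    refine (HasDerivAt.congr_of_eventuallyEq (h.add_const
      ((cos a * sin b - sin a * cos b) / 2 + t * w.2 +
      (cos a + cos b) * (t * w.1.2) / 2 - (sin a + sin b) * (t * w.1.1) / 2))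
      (Eventually.of_forall fun x => ?_)).congr_deriv ?_
    · simp only [Pi.add_apply, Pi.sub_apply]; ring
    · ring

lemma hasDerivAt_tri4 (p : ℝ × ℝ × ℝ) (t : ℝ) (w : G1) :
    HasDerivAt (fun t : ℝ => gmul (tri p) (t • w)) (dtri4 p w) t := by
  have hi := hasDerivAt_id t
  simp only [tri, gmul, gcirc, dtri4, Prod.smul_fst, Prod.smul_snd, smul_eq_mul]
  refine hasDerivAt_mk ?_ ?_ ?_
  · simpa using hi.mul_const w.1.1
  · simpa using hi.mul_const w.1.2
  · have h := hi.mul_const (w.2 + ((cos p.1 + cos p.2.1 + cos p.2.2) * w.1.2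
      - (sin p.1 + sin p.2.1 + sin p.2.2) * w.1.1) / 2)
    refine (HasDerivAt.congr_of_eventuallyEq (h.add_const
      ((cos p.1 * sin p.2.1 - sin p.1 * cos p.2.1) / 2
      + ((cos p.1 + cos p.2.1) * sin p.2.2 - (sin p.1 + sin p.2.1) * cos p.2.2) / 2))
      (Eventually.of_forall fun x => ?_)).congr_deriv ?_
    · simp only [id]; ring
    · ring

lemma continuous_tri : Continuous tri := by
  unfold tri gmul gcirc; fun_prop

lemma hD_hX (a b c : ℝ) (w : G1) :
    hD (hX (a, b, c) w) =
      2 * sin ((2 * b - a - c) / 2) * cos ((b - a) / 2) * cos ((c - b) / 2) := by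
  have e1 : hD (hX (a, b, c) w)
      = (sin ((b - a) - (c - b)) + sin (b - a) - sin (c - b)) / 2 := by
    simp only [hD, hp1, hp2, hp3, det3, hX, Matrix.cons_val, sin_sub, cos_sub]
    have h1 := sin_sq_add_cos_sq a
    have h2 := sin_sq_add_cos_sq b
    have h3 := sin_sq_add_cos_sq c
    generalize sin a = s1 at *
    generalize sin b = s2 at *
    generalize sin c = s3 at *
    generalize cos a = c1 at *
    generalize cos b = c2 at *
    generalize cos c = c3 at *
    grind
  have e2 : ∀ B C : ℝ, (sin (2 * B - 2 * C) + sin (2 * B) - sin (2 * C)) / 2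
      = 2 * sin (B - C) * cos B * cos C := by
    intro B C
    have h2 := sin_sq_add_cos_sq B
    have h3 := sin_sq_add_cos_sq C
    rw [show 2 * B - 2 * C = 2 * (B - C) by ring]
    simp only [sin_two_mul, sin_sub, cos_sub]
    generalize sin B = s2 at *
    generalize sin C = s3 at *
    generalize cos B = c2 at *
    generalize cos C = c3 at *
    grind
  rw [e1, show (2 * b - a - c) / 2 = (b - a) / 2 - (c - b) / 2 by ring, ← e2]
  congr 3 <;> ring_nf

lemma continuous_tri_mul (w : G1) :
    Continuous fun q : (ℝ × ℝ × ℝ) × ℝ => gmul (tri q.1) (q.2 • w) := by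
  unfold tri gmul gcirc; fun_prop

lemma hX_le (p : ℝ × ℝ × ℝ) {w : G1} (hw : ‖w‖ ≤ 1) (i : Fin 9) : |hX p w i| ≤ 1 := by
  have h1 : |w.1.1| ≤ 1 := (norm_fst_le w.1).trans ((norm_fst_le w).trans hw)
  have h2 : |w.1.2| ≤ 1 := (norm_snd_le w.1).trans ((norm_fst_le w).trans hw)
  have h3 : |w.2| ≤ 1 := (norm_snd_le w).trans hw
  fin_cases i <;> simp [hX, abs_sin_le_one, abs_cos_le_one, h1, h2, h3]

lemma norm_hE1 (p : ℝ × ℝ × ℝ) : ‖hE1 p‖ ≤ 1 := by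
  refine (pi_norm_le_iff_of_nonneg zero_le_one).2 fun i => ?_
  fin_cases i <;> simp [hE1, abs_sin_le_one, abs_cos_le_one]
lemma norm_hE2 (p : ℝ × ℝ × ℝ) : ‖hE2 p‖ ≤ 1 := by
  refine (pi_norm_le_iff_of_nonneg zero_le_one).2 fun i => ?_
  fin_cases i <;> simp [hE2, abs_sin_le_one, abs_cos_le_one]
lemma norm_hE3 (p : ℝ × ℝ × ℝ) : ‖hE3 p‖ ≤ 1 := by
  refine (pi_norm_le_iff_of_nonneg zero_le_one).2 fun i => ?_
  fin_cases i <;> simp [hE3, abs_sin_le_one, abs_cos_le_one]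

/-- The regularized quotient `f D / (D² + e)`. -/
def rq (f : (Fin 9 → ℝ) → ℝ) (e : ℝ) (x : Fin 9 → ℝ) : ℝ := f x * (hD x / (hD x ^ 2 + e))

/-- The derivative of `rq`. -/
def rq' (f : (Fin 9 → ℝ) → ℝ) (e : ℝ) (x E : Fin 9 → ℝ) : ℝ :=
  fderiv ℝ f x E * (hD x / (hD x ^ 2 + e))
    + f x * (fderiv ℝ hD x E * ((e - hD x ^ 2) / (hD x ^ 2 + e) ^ 2))

lemma hasDerivAt_rq {f : (Fin 9 → ℝ) → ℝ} (hf : ContDiff ℝ 1 f) {e : ℝ} (he : 0 < e)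
    {X : ℝ → Fin 9 → ℝ} {E : Fin 9 → ℝ} {a : ℝ} (hX : HasDerivAt X E a) :
    HasDerivAt (fun a => rq f e (X a)) (rq' f e (X a) E) a := by
  have h1 : HasDerivAt (fun a => f (X a)) (fderiv ℝ f (X a) E) a :=
    ((hf.differentiable one_ne_zero) _).hasFDerivAt.comp_hasDerivAt a hX
  have h2 : HasDerivAt (fun a => hD (X a)) (fderiv ℝ hD (X a) E) a :=
    ((contDiff_hD.differentiable one_ne_zero) _).hasFDerivAt.comp_hasDerivAt a hX
  have hne : hD (X a) ^ 2 + e ≠ 0 := by positivity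
  refine (h1.mul (h2.div ((h2.pow 2).add_const e) hne)).congr_deriv ?_
  simp only [rq', Nat.cast_ofNat, Pi.pow_apply, Pi.div_apply]
  field_simp
  ring

lemma rq_bound {f : (Fin 9 → ℝ) → ℝ} (hf : ContDiff ℝ 1 f) :
    ∃ C, 0 ≤ C ∧ ∀ x E e, (∀ i, |x i| ≤ 1) → ‖E‖ ≤ 1 → 0 < e → e ≤ 1 →
      |rq' f e x E| ≤ C / e := by
  obtain ⟨A, hA, hA'⟩ := exists_bound_unit_cube f hf.continuous
  obtain ⟨B, hB, hB'⟩ := exists_bound_unit_cube (fun x => ‖fderiv ℝ f x‖)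
    (hf.continuous_fderiv one_ne_zero).norm
  obtain ⟨D, hD0, hD'⟩ := exists_bound_unit_cube (fun x => ‖fderiv ℝ hD x‖)
    (contDiff_hD.continuous_fderiv one_ne_zero).norm
  refine ⟨B + A * D, by positivity, fun x E e hx hE he he1 => ?_⟩
  have h1 : |fderiv ℝ f x E| ≤ B := by
    refine ((fderiv ℝ f x).le_opNorm E).trans ?_
    have := hB' x hx
    rw [abs_of_nonneg (norm_nonneg _)] at this
    calc _ ≤ B * 1 := by gcongr
      _ = B := mul_one _
  have h2 : |fderiv ℝ hD x E| ≤ D := by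
    refine ((fderiv ℝ hD x).le_opNorm E).trans ?_
    have := hD' x hx
    rw [abs_of_nonneg (norm_nonneg _)] at this
    calc _ ≤ D * 1 := by gcongr
      _ = D := mul_one _
  have h3 : |hD x / (hD x ^ 2 + e)| ≤ 1 / e := by
    rw [abs_div, abs_of_pos (by positivity : 0 < hD x ^ 2 + e), div_le_div_iff₀ (by positivity) he,
      ← sq_abs (hD x)]
    nlinarith [sq_nonneg (|hD x| - e), sq_nonneg (|hD x| - 1), abs_nonneg (hD x),
      mul_nonneg (abs_nonneg (hD x)) (sub_nonneg.2 he1), sq_nonneg (hD x)]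
  have h4 : |(e - hD x ^ 2) / (hD x ^ 2 + e) ^ 2| ≤ 1 / e := by
    rw [abs_div, abs_of_pos (by positivity : 0 < (hD x ^ 2 + e) ^ 2),
      div_le_div_iff₀ (by positivity) he]
    have : |e - hD x ^ 2| ≤ hD x ^ 2 + e := abs_le.2 ⟨by nlinarith [sq_nonneg (hD x)],
      by nlinarith [sq_nonneg (hD x)]⟩
    calc _ ≤ (hD x ^ 2 + e) * (hD x ^ 2 + e) := by
            gcongr; nlinarith [sq_nonneg (hD x)]
      _ = _ := by ring
  calc |rq' f e x E| ≤ B * (1 / e) + A * (D * (1 / e)) := by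
        unfold rq'
        refine (abs_add_le _ _).trans ?_
        rw [abs_mul, abs_mul, abs_mul]
        have := hA' x hx
        gcongr
    _ = _ := by ring

lemma continuous_rq {f : (Fin 9 → ℝ) → ℝ} (hf : Continuous f) {e : ℝ} (he : 0 < e) :
    Continuous (rq f e) := by
  have := contDiff_hD.continuous
  refine hf.mul (this.div (by fun_prop) fun x => by positivity)

lemma continuous_rq' {f : (Fin 9 → ℝ) → ℝ} (hf : ContDiff ℝ 1 f) {e : ℝ} (he : 0 < e) :
    Continuous fun q : (Fin 9 → ℝ) × (Fin 9 → ℝ) => rq' f e q.1 q.2 := by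
  have h1 := contDiff_hD.continuous
  have h2 : Continuous fun q : (Fin 9 → ℝ) × (Fin 9 → ℝ) => fderiv ℝ hD q.1 q.2 :=
    ((contDiff_hD.continuous_fderiv one_ne_zero).comp continuous_fst).clm_apply continuous_snd
  have h3 : Continuous fun q : (Fin 9 → ℝ) × (Fin 9 → ℝ) => fderiv ℝ f q.1 q.2 :=
    ((hf.continuous_fderiv one_ne_zero).comp continuous_fst).clm_apply continuous_snd
  have h4 := hf.continuous
  unfold rq'
  refine (h3.mul (Continuous.div (by fun_prop) (by fun_prop) fun x => by positivity)).add
    (Continuous.mul (by fun_prop) (h2.mul (Continuous.div (by fun_prop) (by fun_prop)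
      fun x => by positivity)))

lemma rational_split {x y z e : ℝ} (hx : 0 ≤ x) (hy : 0 ≤ y) (hz : 0 ≤ z) (he : 0 < e) :
    e ^ 3 / (4 * x * y * z + e ^ 3) ≤ e / (x + e) + e / (y + e) + e / (z + e) := by
  have key : ∀ {x y z : ℝ}, 0 ≤ x → 0 ≤ y → 0 ≤ z → e ^ 2 ≤ 4 * (y * z) →
      e ^ 3 / (4 * x * y * z + e ^ 3) ≤ e / (x + e) := by
    intro x y z hx hy hz h
    rw [div_le_div_iff₀ (by positivity) (by positivity)]
    nlinarith [mul_nonneg (mul_nonneg he.le hx) (sub_nonneg.2 h)]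
  have px : 0 ≤ e / (x + e) := by positivity
  have py : 0 ≤ e / (y + e) := by positivity
  have pz : 0 ≤ e / (z + e) := by positivity
  have small : ∀ {x : ℝ}, 0 ≤ x → x < e / 2 → 2 / 3 ≤ e / (x + e) := by
    intro x hx h
    rw [div_le_div_iff₀ (by positivity) (by positivity)]; linarith
  have one : e ^ 3 / (4 * x * y * z + e ^ 3) ≤ 1 := by
    rw [div_le_one (by positivity)]
    have : 0 ≤ 4 * x * y * z := by positivity
    linarith
  by_cases h1 : e ^ 2 ≤ 4 * (y * z)
  · linarith [key hx hy hz h1]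
  by_cases h2 : e ^ 2 ≤ 4 * (x * z)
  · have := key hy hx hz h2
    rw [show 4 * y * x * z = 4 * x * y * z by ring] at this
    linarith
  by_cases h3 : e ^ 2 ≤ 4 * (x * y)
  · have := key hz hx hy h3
    rw [show 4 * z * x * y = 4 * x * y * z by ring] at this
    linarith
  have pair : ∀ {x y : ℝ}, 0 ≤ x → 0 ≤ y → ¬ e ^ 2 ≤ 4 * (x * y) → x < e / 2 ∨ y < e / 2 := by
    intro x y hx hy h
    by_contra! hc
    exact h (by nlinarith [mul_le_mul hc.1 hc.2 (by positivity) hx])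
  rcases pair hy hz h1 with h | h
  · have a := small hy h
    rcases pair hx hz h2 with h | h
    · have := small hx h; linarith
    · have := small hz h; linarith
  · have a := small hz h
    rcases pair hx hy h3 with h | h
    · have := small hx h; linarith
    · have := small hy h; linarith

/-- The kernel `η² / (s² + η²)`. -/
def pker (η s : ℝ) : ℝ := η ^ 2 / (s ^ 2 + η ^ 2)

lemma continuous_pker {η : ℝ} (hη : 0 < η) : Continuous (pker η) := by
  unfold pker
  exact Continuous.div (by fun_prop) (by fun_prop) fun x => by positivity

lemma integral_cutoff_le {η : ℝ} (hη : 0 < η) (w : G1) :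
    ∫ p, η ^ 6 / (hD (hX p w) ^ 2 + η ^ 6) ∂cm3 ≤ 3 * (π * η) := by
  have hk := continuous_pker hη
  let k1 : ℝ × ℝ × ℝ → ℝ := fun p => pker η (sin ((p.2.2 + (p.1 - 2 * p.2.1)) / 2))
  let k2 : ℝ × ℝ × ℝ → ℝ := fun p => pker η (sin ((p.2.1 + (π - p.1)) / 2))
  let k3 : ℝ × ℝ × ℝ → ℝ := fun p => pker η (sin ((p.2.2 + (π - p.2.1)) / 2))
  have c1 : Continuous k1 := by fun_prop
  have c2 : Continuous k2 := by fun_prop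
  have c3 : Continuous k3 := by fun_prop
  have b : ∀ c, ∫ x, pker η (sin ((x + c) / 2)) ∂cm ≤ π * η := integral_kernel_le η hη
  have icm : ∀ {F : ℝ → ℝ}, Continuous F → Integrable F cm := fun hF =>
    integrable_of_compact_support isCompact_Icc cm_compl hF
  have mono : ∀ {F : ℝ → ℝ} {C : ℝ}, 0 ≤ C → (∀ x, F x ≤ C) → ∫ x, F x ∂cm ≤ C := by
    intro F C hC h
    by_cases hF : Integrable F cm
    · refine (integral_mono hF (integrable_const C) h).trans ?_
      simp
    · rw [integral_undef hF]; exact hC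
  have p0 : 0 ≤ π * η := by positivity
  have i1 : ∫ p, k1 p ∂cm3 ≤ π * η := by
    rw [integral_cm3 c1]
    exact mono p0 fun x => mono p0 fun y => b (x - 2 * y)
  have i2 : ∫ p, k2 p ∂cm3 ≤ π * η := by
    rw [integral_cm3 c2]
    refine mono p0 fun x => ?_
    simpa only [k2, integral_const, probReal_univ, one_smul] using b (π - x)
  have i3 : ∫ p, k3 p ∂cm3 ≤ π * η := by
    rw [integral_cm3 c3]
    exact mono p0 fun x => mono p0 fun y => b (π - y)
  have hDc : Continuous fun p => hD (hX p w) := contDiff_hD.continuous.comp (continuous_hX w)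
  calc ∫ p, η ^ 6 / (hD (hX p w) ^ 2 + η ^ 6) ∂cm3 ≤ ∫ p, k1 p + k2 p + k3 p ∂cm3 := by
        refine integral_mono (integrable_cm3 ?_) (integrable_cm3 (by fun_prop)) ?_
        · exact Continuous.div (by fun_prop) (by fun_prop) fun x => by positivity
        · rintro ⟨a, b, c⟩
          simp only [k1, k2, k3, pker]
          rw [hD_hX]
          have h := rational_split (sq_nonneg (sin ((c + (a - 2 * b)) / 2)))
            (sq_nonneg (sin ((b + (π - a)) / 2))) (sq_nonneg (sin ((c + (π - b)) / 2)))
            (by positivity : 0 < η ^ 2)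
          refine le_trans (le_of_eq ?_) h
          have e1 : sin ((2 * b - a - c) / 2) = - sin ((c + (a - 2 * b)) / 2) := by
            rw [← sin_neg]; congr 1; ring
          have e2 : sin ((b + (π - a)) / 2) = cos ((b - a) / 2) := by
            rw [← sin_add_pi_div_two]; congr 1; ring
          have e3 : sin ((c + (π - b)) / 2) = cos ((c - b) / 2) := by
            rw [← sin_add_pi_div_two]; congr 1; ring
          rw [e1, e2, e3]
          congr 1
          · ring
          · ring
    _ = ∫ p, k1 p ∂cm3 + ∫ p, k2 p ∂cm3 + ∫ p, k3 p ∂cm3 := by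
        rw [integral_add (integrable_cm3 (by fun_prop)) (integrable_cm3 c3),
          integral_add (integrable_cm3 c1) (integrable_cm3 c2)]
    _ ≤ _ := by linarith

instance : (volume : Measure (ℝ × ℝ)).IsAddHaarMeasure :=
  Measure.prod.instIsAddHaarMeasure (volume : Measure ℝ) (volume : Measure ℝ)

instance : (volume : Measure G1).IsAddHaarMeasure :=
  Measure.prod.instIsAddHaarMeasure (volume : Measure (ℝ × ℝ)) (volume : Measure ℝ)

lemma integral_Ioc_of_hasDerivAt {h h' : ℝ → ℝ} (hd : ∀ x, HasDerivAt h (h' x) x)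
    (hc : Continuous h') {r : ℝ} (hr : 0 ≤ r) :
    ∫ x in Set.Ioc 0 r, h' x = h r - h 0 := by
  rw [← intervalIntegral.integral_of_le hr, intervalIntegral.integral_eq_sub_of_hasDerivAt
    (fun x _ => hd x) (hc.intervalIntegrable _ _)]

lemma integral_cm3_add3 {F1 F2 F3 : ℝ × ℝ × ℝ → ℝ} (h1 : Continuous F1) (h2 : Continuous F2)
    (h3 : Continuous F3) (z1 : ∫ p, F1 p ∂cm3 = 0) (z2 : ∫ p, F2 p ∂cm3 = 0)
    (z3 : ∫ p, F3 p ∂cm3 = 0) : ∫ p, (F1 p + F2 p + F3 p) ∂cm3 = 0 := by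
  rw [integral_add (integrable_cm3 (by fun_prop)) (integrable_cm3 h3),
    integral_add (integrable_cm3 h1) (integrable_cm3 h2), z1, z2, z3]
  simp

lemma integral_by_parts {G : G1 → ℝ} (hG : ContDiff ℝ 1 G) {f1 f2 f3 : (Fin 9 → ℝ) → ℝ}
    (h1 : ContDiff ℝ 1 f1) (h2 : ContDiff ℝ 1 f2) (h3 : ContDiff ℝ 1 f3) {e : ℝ} (he : 0 < e)
    (w : G1) (t : ℝ) :
    ∫ p, (rq f1 e (hX p w) * fderiv ℝ G (gmul (tri p) (t • w)) (dtri1 p t w)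
      + rq f2 e (hX p w) * fderiv ℝ G (gmul (tri p) (t • w)) (dtri2 p t w)
      + rq f3 e (hX p w) * fderiv ℝ G (gmul (tri p) (t • w)) (dtri3 p t w)) ∂cm3 =
    - ∫ p, (rq' f1 e (hX p w) (hE1 p) + rq' f2 e (hX p w) (hE2 p) + rq' f3 e (hX p w) (hE3 p))
      * G (gmul (tri p) (t • w)) ∂cm3 := by
  have hX := continuous_hX w
  have ct : Continuous fun p => gmul (tri p) (t • w) := by unfold tri gmul gcirc; fun_prop
  have cG : Continuous fun p => G (gmul (tri p) (t • w)) := hG.continuous.comp ct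
  have cdG : Continuous fun p => fderiv ℝ G (gmul (tri p) (t • w)) :=
    (hG.continuous_fderiv one_ne_zero).comp ct
  have d1 : Continuous fun p => dtri1 p t w := by unfold dtri1; fun_prop
  have d2 : Continuous fun p => dtri2 p t w := by unfold dtri2; fun_prop
  have d3 : Continuous fun p => dtri3 p t w := by unfold dtri3; fun_prop
  have c1 := (continuous_rq h1.continuous he).comp hX
  have c2 := (continuous_rq h2.continuous he).comp hX
  have c3 := (continuous_rq h3.continuous he).comp hX
  have c1' := (continuous_rq' h1 he).comp (hX.prodMk continuous_hE1)
  have c2' := (continuous_rq' h2 he).comp (hX.prodMk continuous_hE2)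
  have c3' := (continuous_rq' h3 he).comp (hX.prodMk continuous_hE3)
  have der : ∀ {f : (Fin 9 → ℝ) → ℝ} (_ : ContDiff ℝ 1 f) {X : ℝ → Fin 9 → ℝ} {E : Fin 9 → ℝ}
      {T : ℝ → G1} {T' : G1} {a : ℝ}, HasDerivAt X E a → HasDerivAt T T' a →
      HasDerivAt (fun a => rq f e (X a) * G (T a))
        (rq' f e (X a) E * G (T a) + rq f e (X a) * fderiv ℝ G (T a) T') a := by
    intro f hf X E T T' a hX hT
    exact (hasDerivAt_rq hf he hX).mul
      (((hG.differentiable one_ne_zero) _).hasFDerivAt.comp_hasDerivAt a hT)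
  have e1 : Continuous fun p => rq' f1 e (_root_.hX p w) (hE1 p) * G (gmul (tri p) (t • w)) +
    rq f1 e (_root_.hX p w) * fderiv ℝ G (gmul (tri p) (t • w)) (dtri1 p t w) :=
      (c1'.mul cG).add (c1.mul (cdG.clm_apply d1))
  have e2 : Continuous fun p => rq' f2 e (_root_.hX p w) (hE2 p) * G (gmul (tri p) (t • w)) +
    rq f2 e (_root_.hX p w) * fderiv ℝ G (gmul (tri p) (t • w)) (dtri2 p t w) :=
      (c2'.mul cG).add (c2.mul (cdG.clm_apply d2))
  have e3 : Continuous fun p => rq' f3 e (_root_.hX p w) (hE3 p) * G (gmul (tri p) (t • w)) +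
    rq f3 e (_root_.hX p w) * fderiv ℝ G (gmul (tri p) (t • w)) (dtri3 p t w) :=
      (c3'.mul cG).add (c3.mul (cdG.clm_apply d3))
  have z1 := integral_cm3_eq_zero_fst e1 fun b c => by
    refine integral_cm_deriv (fun a => der h1 (hasDerivAt_hX1 a b c w)
      (hasDerivAt_tri1 a b c t w)) (e1.comp (by fun_prop : Continuous fun a => (a, b, c))) ?_
    simp [_root_.hX, tri, gcirc]
  have z2 := integral_cm3_eq_zero_snd e2 fun a c => by
    refine integral_cm_deriv (fun b => der h2 (hasDerivAt_hX2 a b c w)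
      (hasDerivAt_tri2 a b c t w)) (e2.comp (by fun_prop : Continuous fun b => (a, b, c))) ?_
    simp [_root_.hX, tri, gcirc]
  have z3 := integral_cm3_eq_zero_thd e3 fun a b => by
    refine integral_cm_deriv (fun c => der h3 (hasDerivAt_hX3 a b c w)
      (hasDerivAt_tri3 a b c t w)) (e3.comp (by fun_prop : Continuous fun c => (a, b, c))) ?_
    simp [_root_.hX, tri, gcirc]
  rw [eq_neg_iff_add_eq_zero, ← integral_add, ← integral_cm3_add3 e1 e2 e3 z1 z2 z3]
  · congr 1; ext p; ring
  · exact integrable_cm3 (((c1.mul (cdG.clm_apply d1)).add (c2.mul (cdG.clm_apply d2))).add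
      (c3.mul (cdG.clm_apply d3)))
  · exact integrable_cm3 (((c1'.add c2').add c3').mul cG)

lemma integral_cm3_abs_le {F : ℝ × ℝ × ℝ → ℝ} {C : ℝ} (h : ∀ p, |F p| ≤ C) :
    |∫ p, F p ∂cm3| ≤ C := by
  have := norm_integral_le_of_norm_le_const (μ := cm3) (f := F) (Eventually.of_forall h)
  simpa using this

lemma smoothing_step : ∃ C, 0 ≤ C ∧ ∀ (G : G1 → ℝ) (M : ℝ), ContDiff ℝ 1 G → (∀ g, |G g| ≤ M) →
    ∀ w : G1, ‖w‖ ≤ 1 → ∀ r η : ℝ, 0 ≤ r → 0 < η → η ≤ 1 →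
    |∫ p, G (gmul (tri p) (r • w)) - G (tri p) ∂cm3| ≤ C * M * (r / η ^ 6 + η) := by
  obtain ⟨C1, hC1, B1⟩ := rq_bound contDiff_hb1
  obtain ⟨C2, hC2, B2⟩ := rq_bound contDiff_hb2
  obtain ⟨C3, hC3, B3⟩ := rq_bound contDiff_hb3
  refine ⟨C1 + C2 + C3 + 6 * π, by positivity, fun G M hG hM w hw r η hr hη hη1 => ?_⟩
  have hM0 : 0 ≤ M := (abs_nonneg _).trans (hM 0)
  set e := η ^ 6 with he
  have he0 : 0 < e := by positivity
  have he1 : e ≤ 1 := pow_le_one₀ hη.le hη1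
  have hDc : Continuous fun p => hD (hX p w) := contDiff_hD.continuous.comp (continuous_hX w)
  set ω : ℝ × ℝ × ℝ → ℝ := fun p => hD (hX p w) ^ 2 / (hD (hX p w) ^ 2 + e) with hω
  have cω : Continuous ω := Continuous.div (by fun_prop) (by fun_prop) fun x => by positivity
  have cG := hG.continuous
  have cT := continuous_tri_mul w
  have cdK : Continuous fun q : (ℝ × ℝ × ℝ) × ℝ =>
      ω q.1 * fderiv ℝ G (gmul (tri q.1) (q.2 • w)) (dtri4 q.1 w) := by
    refine (cω.comp continuous_fst).mul ?_
    have d4 : Continuous fun q : (ℝ × ℝ × ℝ) × ℝ => dtri4 q.1 w := by unfold dtri4; fun_prop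
    exact ((hG.continuous_fderiv one_ne_zero).comp cT).clm_apply d4
  have slice : ∀ t : ℝ, |∫ p, ω p * fderiv ℝ G (gmul (tri p) (t • w)) (dtri4 p w) ∂cm3|
      ≤ (C1 + C2 + C3) / e * M := by
    intro t
    have : ∀ p, ω p * fderiv ℝ G (gmul (tri p) (t • w)) (dtri4 p w) =
        rq hb1 e (hX p w) * fderiv ℝ G (gmul (tri p) (t • w)) (dtri1 p t w)
      + rq hb2 e (hX p w) * fderiv ℝ G (gmul (tri p) (t • w)) (dtri2 p t w)
      + rq hb3 e (hX p w) * fderiv ℝ G (gmul (tri p) (t • w)) (dtri3 p t w) := by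
      intro p
      have h := congrArg (fderiv ℝ G (gmul (tri p) (t • w))) (tri_cramer p t w)
      simp only [map_add, map_smul, smul_eq_mul] at h
      simp only [hω, rq]
      have : 0 < hD (hX p w) ^ 2 + e := by positivity
      field_simp
      linear_combination (hD (hX p w)) * h
    simp_rw [this]
    rw [integral_by_parts hG contDiff_hb1 contDiff_hb2 contDiff_hb3 he0, abs_neg]
    refine integral_cm3_abs_le fun p => ?_
    rw [abs_mul]
    refine mul_le_mul ?_ (hM _) (abs_nonneg _) (by positivity)
    have b1 := B1 _ _ e (hX_le p hw) (norm_hE1 p) he0 he1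
    have b2 := B2 _ _ e (hX_le p hw) (norm_hE2 p) he0 he1
    have b3 := B3 _ _ e (hX_le p hw) (norm_hE3 p) he0 he1
    rw [add_div, add_div]
    exact (abs_add_three _ _ _).trans (by gcongr)
  have ftc : ∀ p, ω p * (G (gmul (tri p) (r • w)) - G (tri p)) =
      ∫ t in Set.Ioc 0 r, ω p * fderiv ℝ G (gmul (tri p) (t • w)) (dtri4 p w) := by
    intro p
    have hcont : Continuous fun t : ℝ => ω p * fderiv ℝ G (gmul (tri p) (t • w)) (dtri4 p w) :=
      continuous_const.mul (((hG.continuous_fderiv one_ne_zero).comp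
        (by unfold gmul; fun_prop : Continuous fun t : ℝ => gmul (tri p) (t • w))).clm_apply
          continuous_const)
    have hder : ∀ t, HasDerivAt (fun t : ℝ => ω p * G (gmul (tri p) (t • w)))
        (ω p * fderiv ℝ G (gmul (tri p) (t • w)) (dtri4 p w)) t := fun t =>
      (((hG.differentiable one_ne_zero) _).hasFDerivAt.comp_hasDerivAt t
        (hasDerivAt_tri4 p t w)).const_mul _
    rw [integral_Ioc_of_hasDerivAt hder hcont hr, zero_smul, gmul_zero, mul_sub]
  have main : |∫ p, ω p * (G (gmul (tri p) (r • w)) - G (tri p)) ∂cm3|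
      ≤ (C1 + C2 + C3) / e * M * r := by
    simp_rw [ftc]
    rw [integral_integral_swap (μ := cm3) (ν := volume.restrict (Set.Ioc 0 r))
      (f := fun p t => ω p * fderiv ℝ G (gmul (tri p) (t • w)) (dtri4 p w))]
    · have := norm_integral_le_of_norm_le_const (μ := volume.restrict (Set.Ioc 0 r))
        (f := fun t => ∫ p, ω p * fderiv ℝ G (gmul (tri p) (t • w)) (dtri4 p w) ∂cm3)
        (Eventually.of_forall slice)
      simpa [hr] using this
    · refine integrable_of_compact_support (isCompact_cube3.prod (isCompact_Icc (a := 0) (b := r)))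
        (prod_compl_null cm3_compl ?_) cdK
      rw [Measure.restrict_apply measurableSet_Icc.compl]
      have : (Set.Icc 0 r)ᶜ ∩ Set.Ioc 0 r = ∅ := by
        ext x; simp only [Set.mem_inter_iff, Set.mem_compl_iff, Set.mem_Icc, Set.mem_Ioc,
          Set.mem_empty_iff_false, iff_false]
        rintro ⟨h1, h2, h3⟩; exact h1 ⟨h2.le, h3⟩
      simp [this]
  have cD : Continuous fun p => G (gmul (tri p) (r • w)) - G (tri p) :=
    (cG.comp (cT.comp (by fun_prop : Continuous fun p : ℝ × ℝ × ℝ => (p, r)))).sub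
      (cG.comp continuous_tri)
  have rem : |∫ p, (1 - ω p) * (G (gmul (tri p) (r • w)) - G (tri p)) ∂cm3|
      ≤ 2 * M * (3 * (π * η)) := by
    have e1 : ∀ p, 1 - ω p = η ^ 6 / (hD (hX p w) ^ 2 + η ^ 6) := by
      intro p
      simp only [hω, he]
      have : 0 < hD (hX p w) ^ 2 + η ^ 6 := by positivity
      field_simp; ring
    calc |∫ p, (1 - ω p) * (G (gmul (tri p) (r • w)) - G (tri p)) ∂cm3|
        ≤ ∫ p, |(1 - ω p) * (G (gmul (tri p) (r • w)) - G (tri p))| ∂cm3 :=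
          abs_integral_le_integral_abs
      _ ≤ ∫ p, 2 * M * (1 - ω p) ∂cm3 := by
          refine integral_mono (integrable_cm3 (by fun_prop)) (integrable_cm3 (by fun_prop)) ?_
          intro p
          have h0 : 0 ≤ 1 - ω p := by rw [e1]; positivity
          have h2 : |G (gmul (tri p) (r • w)) - G (tri p)| ≤ 2 * M := by
            refine (abs_sub _ _).trans ?_
            linarith [hM (gmul (tri p) (r • w)), hM (tri p)]
          show |_| ≤ _
          rw [abs_mul, abs_of_nonneg h0, mul_comm]
          exact mul_le_mul_of_nonneg_right h2 h0
      _ ≤ _ := by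
          rw [integral_const_mul]
          simp_rw [e1]
          have := integral_cutoff_le hη w
          gcongr
  have split : ∫ p, G (gmul (tri p) (r • w)) - G (tri p) ∂cm3 =
      ∫ p, ω p * (G (gmul (tri p) (r • w)) - G (tri p)) ∂cm3
      + ∫ p, (1 - ω p) * (G (gmul (tri p) (r • w)) - G (tri p)) ∂cm3 := by
    rw [← integral_add (integrable_cm3 (by fun_prop)) (integrable_cm3 (by fun_prop))]
    congr 1; ext p; ring
  rw [split]
  refine (abs_add_le _ _).trans ((add_le_add main rem).trans ?_)
  have q1 : 0 ≤ r / e := by positivity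
  have : (C1 + C2 + C3) / e * M * r + 2 * M * (3 * (π * η))
    = (C1 + C2 + C3) * M * (r / e) + 6 * π * M * η := by ring
  rw [this]
  have q2 : 0 ≤ (C1 + C2 + C3) * M * η := by positivity
  have q3 : 0 ≤ 6 * π * M * (r / e) := by positivity
  nlinarith

lemma smoothing_contDiff : ∃ C, 0 ≤ C ∧ ∀ (G : G1 → ℝ) (M : ℝ), ContDiff ℝ 1 G →
    (∀ g, |G g| ≤ M) → ∀ w : G1,
    |∫ p, G (gmul (tri p) w) - G (tri p) ∂cm3| ≤ C * M * ‖w‖ ^ (1 / 7 : ℝ) := by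
  obtain ⟨C, hC, H⟩ := smoothing_step
  refine ⟨2 * C + 2, by positivity, fun G M hG hM w => ?_⟩
  have hM0 : 0 ≤ M := (abs_nonneg _).trans (hM 0)
  rcases eq_or_ne w 0 with rfl | hw
  · simp [gmul_zero]
  have hn : 0 < ‖w‖ := norm_pos_iff.2 hw
  have hp : 0 ≤ ‖w‖ ^ (1 / 7 : ℝ) := by positivity
  rcases le_or_gt ‖w‖ 1 with h1 | h1
  · have h := H G M hG hM (‖w‖⁻¹ • w) (by rw [norm_smul, norm_inv, norm_norm,
      inv_mul_cancel₀ hn.ne']) ‖w‖ (‖w‖ ^ (1 / 7 : ℝ)) hn.le (by positivity)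
      (Real.rpow_le_one hn.le h1 (by norm_num))
    rw [smul_smul, mul_inv_cancel₀ hn.ne', one_smul] at h
    refine h.trans ?_
    have e : ‖w‖ / (‖w‖ ^ (1 / 7 : ℝ)) ^ 6 = ‖w‖ ^ (1 / 7 : ℝ) := by
      rw [div_eq_iff (by positivity), ← pow_succ', ← Real.rpow_natCast, ← Real.rpow_mul hn.le]
      norm_num
    rw [e]
    nlinarith [mul_nonneg hM0 hp]
  · refine (integral_cm3_abs_le (C := 2 * M) fun p => ?_).trans ?_
    · refine (abs_sub _ _).trans ?_
      linarith [hM (gmul (tri p) w), hM (tri p)]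
    · have : 1 ≤ ‖w‖ ^ (1 / 7 : ℝ) := Real.one_le_rpow h1.le (by norm_num)
      nlinarith [mul_nonneg hC hM0, mul_nonneg (mul_nonneg hC hM0) hp]

open scoped Convolution in
lemma exists_contDiff_approx {G : G1 → ℝ} (hG : Continuous G) {M : ℝ} (hM : ∀ g, |G g| ≤ M) :
    ∃ F : ℕ → G1 → ℝ, (∀ n, ContDiff ℝ 1 (F n)) ∧ (∀ n g, |F n g| ≤ M) ∧
      ∀ g, Tendsto (fun n => F n g) atTop (nhds (G g)) := by
  let φ : ℕ → ContDiffBump (0 : G1) := fun n =>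
    ⟨1 / (n + 1) / 2, 1 / (n + 1), by positivity, half_lt_self (by positivity)⟩
  refine ⟨fun n => (φ n).normed volume ⋆[ContinuousLinearMap.lsmul ℝ ℝ, volume] G, ?_, ?_, ?_⟩
  · intro n
    exact (φ n).hasCompactSupport_normed.contDiff_convolution_left _ (φ n).contDiff_normed
      hG.locallyIntegrable
  · intro n g
    have hi : Integrable ((φ n).normed (volume : Measure G1)) := (φ n).integrable_normed
    have := norm_integral_le_of_norm_le (μ := (volume : Measure G1)) (hi.const_mul M)
      (f := fun t => (φ n).normed volume t • G (g - t)) (Eventually.of_forall fun t => by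
        rw [norm_smul, Real.norm_of_nonneg ((φ n).nonneg_normed t), mul_comm]
        exact mul_le_mul_of_nonneg_right (hM _) ((φ n).nonneg_normed t))
    rw [integral_const_mul, (φ n).integral_normed, mul_one] at this
    exact this
  · intro g
    refine ContDiffBump.convolution_tendsto_right_of_continuous ?_ hG g
    exact tendsto_one_div_add_atTop_nhds_zero_nat

theorem smoothing : ∃ C, 0 ≤ C ∧ ∀ (G : G1 → ℝ) (M : ℝ), Continuous G →
    (∀ g, |G g| ≤ M) → ∀ w : G1,
    |∫ p, G (gmul (tri p) w) - G (tri p) ∂cm3| ≤ C * M * ‖w‖ ^ (1 / 7 : ℝ) := by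
  obtain ⟨C, hC, H⟩ := smoothing_contDiff
  refine ⟨C, hC, fun G M hG hM w => ?_⟩
  obtain ⟨F, hF, hFM, hFt⟩ := exists_contDiff_approx hG hM
  have ct : Continuous fun p => gmul (tri p) w := by unfold tri gmul gcirc; fun_prop
  refine le_of_tendsto (tendsto_integral_of_dominated_convergence
    (F := fun n p => F n (gmul (tri p) w) - F n (tri p)) (fun _ => 2 * M)
    (fun n => (((hF n).continuous.comp ct).sub
      ((hF n).continuous.comp continuous_tri)).aestronglyMeasurable) (integrable_const _)
    (fun n => Eventually.of_forall fun p => ?_)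
    (Eventually.of_forall fun p => (hFt _).sub (hFt _))).abs
    (Eventually.of_forall fun n => H (F n) M (hF n) (hFM n) w)
  refine (abs_sub _ _).trans ?_
  linarith [hFM n (gmul (tri p) w), hFM n (tri p)]

section

/-- A strongly continuous representation of the first Heisenberg group by linear isometries of a
real Hilbert space. -/
structure GRep (H : Type*) [NormedAddCommGroup H] [InnerProductSpace ℝ H] where
  /-- The action. -/
  V : G1 → H →ₗᵢ[ℝ] H
  map_zero : ∀ v, V 0 v = v
  map_mul : ∀ g h v, V (gmul g h) v = V g (V h v)
  cont : ∀ v, Continuous fun g => V g v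

variable {H : Type*} [NormedAddCommGroup H] [InnerProductSpace ℝ H] [CompleteSpace H]

namespace GRep

lemma inner_V (R : GRep H) (g : G1) (a b : H) : inner ℝ (R.V g a) b = inner ℝ a (R.V (-g) b) := by
  have : b = R.V g (R.V (-g) b) := by rw [← R.map_mul, gmul_neg, R.map_zero]
  conv_lhs => rw [this]
  exact (R.V g).inner_map_map _ _

lemma integrable (R : GRep H) (ν : Measure G1) [IsProbabilityMeasure ν] (v : H) :
    Integrable (fun g => R.V g v) ν :=
  Integrable.of_bound (R.cont v).aestronglyMeasurable ‖v‖
    (Eventually.of_forall fun g => ((R.V g).norm_map v).le)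

/-- The average of a representation against a probability measure. -/
def avg (R : GRep H) (ν : Measure G1) [IsProbabilityMeasure ν] : H →L[ℝ] H :=
  LinearMap.mkContinuous
    { toFun := fun v => ∫ g, R.V g v ∂ν
      map_add' := fun v w => by
        simp_rw [_root_.map_add]
        exact integral_add (R.integrable ν v) (R.integrable ν w)
      map_smul' := fun c v => by
        simp_rw [_root_.map_smul, RingHom.id_apply]
        exact integral_smul c _ } 1 fun v => by
    have := norm_integral_le_of_norm_le_const (μ := ν) (f := fun g => R.V g v) (C := ‖v‖)
      (Eventually.of_forall fun g => ((R.V g).norm_map v).le)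
    simpa using this

lemma avg_apply (R : GRep H) (ν : Measure G1) [IsProbabilityMeasure ν] (v : H) :
    R.avg ν v = ∫ g, R.V g v ∂ν := rfl

lemma norm_avg (R : GRep H) (ν : Measure G1) [IsProbabilityMeasure ν] (v : H) :
    ‖R.avg ν v‖ ≤ ‖v‖ := by
  have := norm_integral_le_of_norm_le_const (μ := ν) (f := fun g => R.V g v) (C := ‖v‖)
      (Eventually.of_forall fun g => ((R.V g).norm_map v).le)
  simpa [avg_apply] using this

lemma inner_avg (R : GRep H) (ν : Measure G1) [IsProbabilityMeasure ν] (v u : H) :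
    inner ℝ (R.avg ν v) u = ∫ g, inner ℝ (R.V g v) u ∂ν := by
  rw [real_inner_comm, avg_apply, ← integral_inner (R.integrable ν v)]
  simp_rw [real_inner_comm u]

lemma inner_avg_symm (R : GRep H) (ν : Measure G1) [IsProbabilityMeasure ν]
    (hν : ν.map (fun g => -g) = ν) (v u : H) :
    inner ℝ (R.avg ν v) u = inner ℝ v (R.avg ν u) := by
  rw [inner_avg, real_inner_comm, inner_avg]
  conv_lhs => rw [← hν]
  rw [integral_map measurable_neg.aemeasurable]
  · congr 1; ext g; rw [R.inner_V, neg_neg, real_inner_comm]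
  · exact ((R.cont v).inner continuous_const).aestronglyMeasurable

/-- The representation precomposed with a dilation. -/
def dil (R : GRep H) (r : ℝ) : GRep H where
  V g := R.V (gdil r g)
  map_zero v := by rw [gdil_zero, R.map_zero]
  map_mul g h v := by rw [gdil_gmul, R.map_mul]
  cont v := (R.cont v).comp (continuous_gdil r)

lemma comp_avg_sub (R : GRep H) (A : H →L[ℝ] H) (ν : Measure G1) [IsProbabilityMeasure ν] (v : H)
    {C : ℝ} (h : ∀ᵐ g ∂ν, ‖A (R.V g v) - A v‖ ≤ C) : ‖A (R.avg ν v) - A v‖ ≤ C := by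
  have e : A (R.avg ν v) - A v = ∫ g, (A (R.V g v) - A v) ∂ν := by
    rw [integral_sub (A.integrable_comp (R.integrable ν v)) (integrable_const _),
      A.integral_comp_comm (R.integrable ν v), avg_apply]
    simp
  rw [e]
  simpa using norm_integral_le_of_norm_le_const h

end GRep

/-- The uniform measure on the horizontal circle. -/
def circM : Measure G1 := cm.map gcirc

instance : IsProbabilityMeasure circM :=
  Measure.isProbabilityMeasure_map continuous_gcirc.measurable.aemeasurable

lemma cm_map_add_pi {F : ℝ → ℝ} (hF : Function.Periodic F (2 * π)) :
    ∫ x, F (x + π) ∂cm = ∫ x, F x ∂cm := integral_cm_shift hF π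

lemma gcirc_add_pi (θ : ℝ) : gcirc (θ + π) = -gcirc θ := by
  simp [gcirc, cos_add_pi, sin_add_pi]

lemma circM_symm : circM.map (fun g => -g) = circM := by
  refine ext_of_forall_integral_eq_of_IsFiniteMeasure fun f => ?_
  have c1 : Continuous fun g : G1 => f (-g) := by fun_prop
  rw [integral_map measurable_neg.aemeasurable f.continuous.aestronglyMeasurable, circM,
    integral_map continuous_gcirc.measurable.aemeasurable f.continuous.aestronglyMeasurable,
    integral_map continuous_gcirc.measurable.aemeasurable c1.aestronglyMeasurable,
    ← cm_map_add_pi]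
  · simp [gcirc_add_pi]
  · intro x; simp [gcirc]

/-- The uniform measure on the unit box. -/
def boxM : Measure G1 := (volume (gbox 1))⁻¹ • volume.restrict (gbox 1)

lemma gbox_eq (r : ℝ) : gbox r = (Set.Icc (-r) r ×ˢ Set.Icc (-r) r) ×ˢ Set.Icc (-r^2) (r^2) := by
  ext z
  simp only [gbox, abs_le, Set.mem_ofPred_eq, Set.mem_prod, Set.mem_Icc, and_assoc]

lemma measurableSet_gbox (r : ℝ) : MeasurableSet (gbox r) := by
  rw [gbox_eq]
  exact (measurableSet_Icc.prod measurableSet_Icc).prod measurableSet_Icc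

lemma volume_gbox {r : ℝ} (hr : 0 ≤ r) : volume (gbox r) = ENNReal.ofReal (8 * r ^ 4) := by
  rw [gbox_eq, Measure.volume_eq_prod, Measure.prod_prod, Measure.volume_eq_prod,
    Measure.prod_prod, Real.volume_Icc, Real.volume_Icc, ← ENNReal.ofReal_mul (by linarith),
    ← ENNReal.ofReal_mul (by nlinarith)]
  congr 1; ring

instance : IsProbabilityMeasure boxM := ⟨by
  have h : volume (gbox 1) ≠ 0 := by
    rw [volume_gbox zero_le_one]; simp
  have h' : volume (gbox 1) ≠ ∞ := by
    rw [volume_gbox zero_le_one]; simp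
  rw [boxM, Measure.smul_apply, Measure.restrict_apply_univ, smul_eq_mul,
    ENNReal.inv_mul_cancel h h']⟩

lemma boxM_symm : boxM.map (fun g => -g) = boxM := by
  rw [boxM, Measure.map_smul]
  congr 1
  have h := (Measure.measurePreserving_neg (volume : Measure G1)).restrict_preimage
    (measurableSet_gbox 1)
  have e : (fun g : G1 => -g) ⁻¹' gbox 1 = gbox 1 := by
    ext z; simp [gbox]
  have h2 := h.map_eq
  rw [show (Neg.neg : G1 → G1) = fun g => -g from rfl, e] at h2
  exact h2

lemma boxM_ae : ∀ᵐ g ∂boxM, g ∈ gbox 1 := by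
  refine Measure.ae_smul_measure ?_ _
  exact ae_restrict_mem (measurableSet_gbox 1)

lemma norm_gdil_le {r : ℝ} (h0 : 0 ≤ r) (h1 : r ≤ 1) {g : G1} (hg : g ∈ gbox 1) :
    ‖gdil r g‖ ≤ r := by
  obtain ⟨a, b, c⟩ := hg
  refine norm_prod_le_iff.2 ⟨norm_prod_le_iff.2 ⟨?_, ?_⟩, ?_⟩
  · simp only [gdil, norm_mul, Real.norm_eq_abs, abs_of_nonneg h0]
    nlinarith
  · simp only [gdil, norm_mul, Real.norm_eq_abs, abs_of_nonneg h0]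
    nlinarith
  · simp only [gdil, norm_mul, Real.norm_eq_abs, abs_of_nonneg (sq_nonneg r)]
    nlinarith [abs_nonneg g.2]

lemma circM_ae : ∀ᵐ g ∂circM, g ∈ gbox 1 := by
  rw [circM, ae_map_iff (p := fun g => g ∈ gbox 1) continuous_gcirc.measurable.aemeasurable
    (measurableSet_gbox 1)]
  exact Eventually.of_forall fun θ => by
    simp [gbox, gcirc, abs_cos_le_one, abs_sin_le_one]

end

section

variable {H : Type*} [NormedAddCommGroup H] [InnerProductSpace ℝ H] [CompleteSpace H]

namespace GRep

/-- The average over the unit circle. -/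
def T (R : GRep H) : H →L[ℝ] H := R.avg circM

lemma norm_T (R : GRep H) (v : H) : ‖R.T v‖ ≤ ‖v‖ := R.norm_avg _ v

lemma T_symm (R : GRep H) (v u : H) : inner ℝ (R.T v) u = inner ℝ v (R.T u) :=
  R.inner_avg_symm circM circM_symm v u

lemma inner_T_cube (R : GRep H) (v F : H) :
    inner ℝ (R.T (R.T (R.T v))) F = ∫ p, inner ℝ (R.V (tri p) v) F ∂cm3 := by
  have hT : ∀ a u, inner ℝ (R.T a) u = ∫ θ, inner ℝ (R.V (gcirc θ) a) u ∂cm := by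
    intro a u
    rw [T, inner_avg, circM, integral_map continuous_gcirc.measurable.aemeasurable]
    exact ((R.cont a).inner continuous_const).aestronglyMeasurable
  have c : Continuous fun p => inner ℝ (R.V (tri p) v) F :=
    ((R.cont v).comp continuous_tri).inner continuous_const
  rw [integral_cm3 c, hT]
  congr 1; ext a
  rw [R.inner_V, hT]
  congr 1; ext b
  rw [R.inner_V, hT]
  congr 1; ext c
  rw [← R.inner_V, ← R.inner_V, ← R.map_mul, ← R.map_mul, tri, gmul_assoc]

lemma T_cube_smoothing : ∃ C, 0 ≤ C ∧ ∀ (R : GRep H) (w : G1) (v : H),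
    ‖R.T (R.T (R.T (R.V w v - v)))‖ ≤ C * ‖w‖ ^ (1 / 7 : ℝ) * ‖v‖ := by
  obtain ⟨C, hC, hS⟩ := smoothing
  refine ⟨C, hC, fun R w v => ?_⟩
  set x := R.T (R.T (R.T (R.V w v - v))) with hx
  rcases eq_or_lt_of_le (norm_nonneg x) with h0 | h0
  · rw [← h0]; positivity
  refine le_of_mul_le_mul_right ?_ h0
  have h := hS (fun g => inner ℝ (R.V g v) x) (‖v‖ * ‖x‖)
    ((R.cont v).inner continuous_const) (fun g => by
      refine (abs_real_inner_le_norm _ _).trans ?_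
      rw [(R.V g).norm_map]) w
  have e : ‖x‖ * ‖x‖ = ∫ p, inner ℝ (R.V (gmul (tri p) w) v) x - inner ℝ (R.V (tri p) v) x
      ∂cm3 := by
    rw [← real_inner_self_eq_norm_mul_norm]
    conv_lhs => rw [hx]
    rw [inner_T_cube]
    congr 1; ext p
    rw [_root_.map_sub, inner_sub_left, R.map_mul]
  rw [e]
  refine (le_abs_self _).trans (h.trans (le_of_eq ?_))
  ring

lemma T_smoothing : ∃ C, 0 ≤ C ∧ ∀ (R : GRep H) (w : G1) (v : H),
    ‖R.T (R.V w v) - R.T v‖ ≤ C * ‖w‖ ^ (1 / 28 : ℝ) * ‖v‖ := by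
  obtain ⟨C, hC, hS⟩ := T_cube_smoothing (H := H)
  refine ⟨(8 * C) ^ (1 / 4 : ℝ), by positivity, fun R w v => ?_⟩
  rw [← map_sub]
  set a := R.V w v - v with ha
  have ha2 : ‖a‖ ≤ 2 * ‖v‖ := by
    refine (norm_sub_le _ _).trans ?_
    rw [(R.V w).norm_map]; linarith
  have h3 := hS R w v
  rw [← ha] at h3
  have sq : ∀ b : H, ‖R.T b‖ ^ 2 ≤ ‖R.T (R.T b)‖ * ‖b‖ := by
    intro b
    rw [← real_inner_self_eq_norm_sq, ← R.T_symm]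
    exact real_inner_le_norm _ _
  have s1 := sq a
  have s2 := sq (R.T a)
  have s3 := R.norm_T a
  have h4 : ‖R.T a‖ ^ 4 ≤ 8 * C * ‖w‖ ^ (1 / 7 : ℝ) * ‖v‖ ^ 4 := by
    calc ‖R.T a‖ ^ 4 = (‖R.T a‖ ^ 2) ^ 2 := by ring
      _ ≤ (‖R.T (R.T a)‖ * ‖a‖) ^ 2 := by gcongr
      _ = ‖R.T (R.T a)‖ ^ 2 * ‖a‖ ^ 2 := by ring
      _ ≤ (‖R.T (R.T (R.T a))‖ * ‖R.T a‖) * ‖a‖ ^ 2 := by gcongr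
      _ ≤ (C * ‖w‖ ^ (1 / 7 : ℝ) * ‖v‖ * (2 * ‖v‖)) * (2 * ‖v‖) ^ 2 := by
          gcongr
          exact s3.trans ha2
      _ = _ := by ring
  refine le_of_pow_le_pow_left₀ (n := 4) (by norm_num) (by positivity) (h4.trans (le_of_eq ?_))
  rw [mul_pow, mul_pow, ← Real.rpow_natCast (_ ^ _), ← Real.rpow_mul (by positivity),
    ← Real.rpow_natCast (_ ^ (1 / 28 : ℝ)), ← Real.rpow_mul (by positivity)]
  norm_num

/-- The decay rate. -/
def _root_.rho : ℝ := (1 / 2 : ℝ) ^ (1 / 28 : ℝ)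

lemma _root_.rho_pos : 0 < rho := by unfold rho; positivity
lemma _root_.rho_lt_one : rho < 1 := Real.rpow_lt_one (by norm_num) (by norm_num) (by norm_num)
lemma _root_.rho_pow (n : ℕ) : ((1 / 2 : ℝ) ^ n) ^ (1 / 28 : ℝ) = rho ^ n := by
  rw [rho, ← Real.rpow_natCast, ← Real.rpow_natCast, ← Real.rpow_mul (by norm_num),
    ← Real.rpow_mul (by norm_num), mul_comm]

/-- The circular average at scale `2 ^ k`. -/
def Tk (R : GRep H) (k : ℤ) : H →L[ℝ] H := (R.dil (2 ^ k)).avg circM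

/-- The box average at scale `2 ^ k`. -/
def Bk (R : GRep H) (k : ℤ) : H →L[ℝ] H := (R.dil (2 ^ k)).avg boxM

lemma norm_Tk (R : GRep H) (k : ℤ) (v : H) : ‖R.Tk k v‖ ≤ ‖v‖ := norm_avg _ _ v
lemma norm_Bk (R : GRep H) (k : ℤ) (v : H) : ‖R.Bk k v‖ ≤ ‖v‖ := norm_avg _ _ v

lemma Tk_symm (R : GRep H) (k : ℤ) (v u : H) : inner ℝ (R.Tk k v) u = inner ℝ v (R.Tk k u) :=
  inner_avg_symm _ circM circM_symm v u
lemma Bk_symm (R : GRep H) (k : ℤ) (v u : H) : inner ℝ (R.Bk k v) u = inner ℝ v (R.Bk k u) :=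
  inner_avg_symm _ boxM boxM_symm v u

lemma Tk_avg_le : ∃ C, 0 ≤ C ∧ ∀ (R : GRep H) (l : ℤ) (n : ℕ) (ν : Measure G1)
    [IsProbabilityMeasure ν], (∀ᵐ g ∂ν, g ∈ gbox 1) → ∀ v : H,
    ‖R.Tk (l + n) ((R.dil (2 ^ l)).avg ν v) - R.Tk (l + n) v‖ ≤ C * rho ^ n * ‖v‖ := by
  obtain ⟨C, hC, hS⟩ := T_smoothing (H := H)
  refine ⟨C, hC, fun R l n ν _ hν v => comp_avg_sub _ _ _ _ ?_⟩
  filter_upwards [hν] with g hg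
  have e : (R.dil (2 ^ l)).V g = (R.dil (2 ^ (l + n))).V (gdil ((1 / 2) ^ n) g) := by
    simp only [dil, gdil_gdil]
    congr 2
    rw [zpow_add₀ two_ne_zero, zpow_natCast, mul_assoc, ← mul_pow]; norm_num
  rw [e]
  refine (hS (R.dil (2 ^ (l + n))) (gdil ((1 / 2) ^ n) g) v).trans ?_
  have := norm_gdil_le (r := (1 / 2) ^ n) (by positivity)
    (pow_le_one₀ (by norm_num) (by norm_num)) hg
  rw [← rho_pow]
  gcongr

/-- The smoothing operator at scale `2 ^ k`. -/
def Pk (R : GRep H) (k : ℤ) : H →L[ℝ] H := R.Bk k ∘L R.Tk k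

/-- The adjoint of `Pk`. -/
def Qk (R : GRep H) (k : ℤ) : H →L[ℝ] H := R.Tk k ∘L R.Bk k

lemma Pk_adj (R : GRep H) (k : ℤ) (v u : H) : inner ℝ (R.Pk k v) u = inner ℝ v (R.Qk k u) := by
  simp only [Pk, Qk, ContinuousLinearMap.comp_apply]
  rw [Bk_symm, Tk_symm]

lemma norm_Qk (R : GRep H) (k : ℤ) (v : H) : ‖R.Qk k v‖ ≤ ‖v‖ :=
  (R.norm_Tk _ _).trans (R.norm_Bk _ _)

lemma Tk_PQ_le : ∃ C, 0 ≤ C ∧ ∀ (R : GRep H) (l : ℤ) (n : ℕ) (v : H),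
    ‖R.Tk (l + n) (R.Pk l v) - R.Tk (l + n) v‖ ≤ C * rho ^ n * ‖v‖ ∧
    ‖R.Tk (l + n) (R.Qk l v) - R.Tk (l + n) v‖ ≤ C * rho ^ n * ‖v‖ := by
  obtain ⟨C, hC, hS⟩ := Tk_avg_le (H := H)
  refine ⟨2 * C, by positivity, fun R l n v => ?_⟩
  have hB : ∀ v, ‖R.Tk (l + n) (R.Bk l v) - R.Tk (l + n) v‖ ≤ C * rho ^ n * ‖v‖ :=
    hS R l n boxM boxM_ae
  have hT : ∀ v, ‖R.Tk (l + n) (R.Tk l v) - R.Tk (l + n) v‖ ≤ C * rho ^ n * ‖v‖ :=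
    hS R l n circM circM_ae
  have hr := rho_pos
  constructor
  · calc _ = ‖(R.Tk (l + n) (R.Bk l (R.Tk l v)) - R.Tk (l + n) (R.Tk l v))
          + (R.Tk (l + n) (R.Tk l v) - R.Tk (l + n) v)‖ := by simp [Pk]
      _ ≤ C * rho ^ n * ‖R.Tk l v‖ + C * rho ^ n * ‖v‖ :=
          (norm_add_le _ _).trans (add_le_add (hB _) (hT _))
      _ ≤ C * rho ^ n * ‖v‖ + C * rho ^ n * ‖v‖ := by
          gcongr; exact R.norm_Tk _ _
      _ = _ := by ring
  · calc _ = ‖(R.Tk (l + n) (R.Tk l (R.Bk l v)) - R.Tk (l + n) (R.Bk l v))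
          + (R.Tk (l + n) (R.Bk l v) - R.Tk (l + n) v)‖ := by simp [Qk]
      _ ≤ C * rho ^ n * ‖R.Bk l v‖ + C * rho ^ n * ‖v‖ :=
          (norm_add_le _ _).trans (add_le_add (hT _) (hB _))
      _ ≤ C * rho ^ n * ‖v‖ + C * rho ^ n * ‖v‖ := by
          gcongr; exact R.norm_Bk _ _
      _ = _ := by ring

/-- A Littlewood–Paley piece of a circular average. -/
def Sk (R : GRep H) (j : ℕ) (k : ℤ) : H →L[ℝ] H :=
  R.Tk k ∘L (R.Pk (k - j) - R.Pk (k - j - 1))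

/-- The adjoint of `Sk`. -/
def Sk' (R : GRep H) (j : ℕ) (k : ℤ) : H →L[ℝ] H :=
  (R.Qk (k - j) - R.Qk (k - j - 1)) ∘L R.Tk k

lemma Sk_adj (R : GRep H) (j : ℕ) (k : ℤ) (v u : H) :
    inner ℝ (R.Sk j k v) u = inner ℝ v (R.Sk' j k u) := by
  simp only [Sk, Sk', ContinuousLinearMap.comp_apply, sub_apply]
  rw [Tk_symm, inner_sub_left, inner_sub_right, Pk_adj, Pk_adj]

lemma norm_Sk_le : ∃ C, 0 ≤ C ∧ ∀ (R : GRep H) (j : ℕ) (k : ℤ) (v : H),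
    ‖R.Sk j k v‖ ≤ C * rho ^ j * ‖v‖ ∧ ‖R.Sk' j k v‖ ≤ C * rho ^ j * ‖v‖ := by
  obtain ⟨C, hC, hS⟩ := Tk_PQ_le (H := H)
  refine ⟨2 * C, by positivity, fun R j k v => ?_⟩
  have hr := rho_pos
  have h : ∀ v, ‖R.Sk j k v‖ ≤ 2 * C * rho ^ j * ‖v‖ := by
    intro v
    have h1 := (hS R (k - j) j v).1
    have h2 := (hS R (k - j - 1) (j + 1) v).1
    rw [show k - j + (j : ℤ) = k by ring] at h1
    rw [show k - j - 1 + ((j + 1 : ℕ) : ℤ) = k by push_cast; ring] at h2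
    have h3 : rho ^ (j + 1) ≤ rho ^ j := pow_le_pow_of_le_one hr.le rho_lt_one.le (Nat.le_succ j)
    calc _ = ‖(R.Tk k (R.Pk (k - j) v) - R.Tk k v) - (R.Tk k (R.Pk (k - j - 1) v) - R.Tk k v)‖ := by
          simp [Sk]
      _ ≤ C * rho ^ j * ‖v‖ + C * rho ^ (j + 1) * ‖v‖ :=
          (norm_sub_le _ _).trans (add_le_add h1 h2)
      _ ≤ C * rho ^ j * ‖v‖ + C * rho ^ j * ‖v‖ := by gcongr
      _ = _ := by ring
  refine ⟨h v, ?_⟩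
  rcases eq_or_lt_of_le (norm_nonneg (R.Sk' j k v)) with h0 | h0
  · rw [← h0]; positivity
  refine le_of_mul_le_mul_right ?_ h0
  rw [← real_inner_self_eq_norm_mul_norm, ← Sk_adj]
  refine (real_inner_le_norm _ _).trans ?_
  have := h (R.Sk' j k v)
  nlinarith [norm_nonneg v]

lemma inner_Delta_le : ∃ C, 0 ≤ C ∧ ∀ (R : GRep H) (k l : ℤ) (u v : H),
    |inner ℝ ((R.Qk k - R.Qk (k - 1)) u) ((R.Qk l - R.Qk (l - 1)) v)|
      ≤ C * rho ^ (k - l).natAbs * (‖u‖ * ‖v‖) := by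
  obtain ⟨C, hC, hS⟩ := Tk_PQ_le (H := H)
  have hr := rho_pos
  have hr' := rho_lt_one
  set D := 2 * C / rho + 2 with hD
  have hD0 : 0 ≤ D := by positivity
  refine ⟨2 * D, by positivity, ?_⟩
  -- the operator bound `‖T_k Δ'_l v‖`
  have key : ∀ (R : GRep H) (l : ℤ) (n : ℕ) (v : H),
      ‖R.Tk (l + n) ((R.Qk l - R.Qk (l - 1)) v)‖ ≤ 2 * C * rho ^ n * ‖v‖ := by
    intro R l n v
    have h1 := (hS R l n v).2
    have h2 := (hS R (l - 1) (n + 1) v).2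
    rw [show l - 1 + ((n + 1 : ℕ) : ℤ) = l + n by push_cast; ring] at h2
    have h3 : rho ^ (n + 1) ≤ rho ^ n := pow_le_pow_of_le_one hr.le hr'.le (Nat.le_succ n)
    calc _ = ‖(R.Tk (l + n) (R.Qk l v) - R.Tk (l + n) v)
          - (R.Tk (l + n) (R.Qk (l - 1) v) - R.Tk (l + n) v)‖ := by simp
      _ ≤ C * rho ^ n * ‖v‖ + C * rho ^ (n + 1) * ‖v‖ :=
          (norm_sub_le _ _).trans (add_le_add h1 h2)
      _ ≤ C * rho ^ n * ‖v‖ + C * rho ^ n * ‖v‖ := by gcongr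
      _ = _ := by ring
  have key2 : ∀ (R : GRep H) (l : ℤ) (n : ℕ) (v : H),
      ‖R.Tk (l + n) ((R.Qk l - R.Qk (l - 1)) v)‖ ≤ D * rho ^ n * ‖v‖ := by
    intro R l n v
    refine (key R l n v).trans ?_
    gcongr
    rw [hD]
    have : 2 * C ≤ 2 * C / rho := by rw [le_div_iff₀ hr]; nlinarith
    linarith
  have key3 : ∀ (R : GRep H) (l : ℤ) (n : ℕ) (v : H),
      ‖R.Tk (l + n - 1) ((R.Qk l - R.Qk (l - 1)) v)‖ ≤ D * rho ^ n * ‖v‖ := by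
    intro R l n v
    cases n with
    | zero =>
      refine (R.norm_Tk _ _).trans ?_
      rw [sub_apply]
      refine (norm_sub_le _ _).trans ?_
      have : 0 ≤ 2 * C / rho := by positivity
      rw [pow_zero]
      nlinarith [R.norm_Qk l v, R.norm_Qk (l - 1) v, norm_nonneg v]
    | succ n =>
      rw [show l + ((n + 1 : ℕ) : ℤ) - 1 = l + n by push_cast; ring]
      refine (key R l n v).trans ?_
      gcongr ?_ * _
      rw [hD, pow_succ]
      have e : 2 * C * rho ^ n = 2 * C / rho * (rho ^ n * rho) := by field_simp
      rw [e]
      gcongr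
      linarith
  have main : ∀ (R : GRep H) (l : ℤ) (n : ℕ) (u v : H),
      |inner ℝ ((R.Qk (l + n) - R.Qk (l + n - 1)) u) ((R.Qk l - R.Qk (l - 1)) v)|
      ≤ 2 * D * rho ^ n * (‖u‖ * ‖v‖) := by
    intro R l n u v
    set x := (R.Qk l - R.Qk (l - 1)) v with hx
    have e : inner ℝ ((R.Qk (l + n) - R.Qk (l + n - 1)) u) x
        = inner ℝ (R.Bk (l + n) u) (R.Tk (l + n) x)
          - inner ℝ (R.Bk (l + n - 1) u) (R.Tk (l + n - 1) x) := by
      rw [sub_apply, inner_sub_left]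
      simp only [Qk, ContinuousLinearMap.comp_apply, Tk_symm]
    rw [e]
    refine (abs_sub _ _).trans ?_
    have h1 := (abs_real_inner_le_norm (R.Bk (l + n) u) (R.Tk (l + n) x)).trans
      (mul_le_mul (R.norm_Bk _ u) (key2 R l n v) (norm_nonneg _) (norm_nonneg _))
    have h2 := (abs_real_inner_le_norm (R.Bk (l + n - 1) u) (R.Tk (l + n - 1) x)).trans
      (mul_le_mul (R.norm_Bk _ u) (key3 R l n v) (norm_nonneg _) (norm_nonneg _))
    linarith
  intro R k l u v
  rcases le_total l k with h | h
  · obtain ⟨n, rfl⟩ := Int.le.dest h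
    simpa using main R l n u v
  · obtain ⟨n, rfl⟩ := Int.le.dest h
    rw [real_inner_comm]
    have := main R k n v u
    rw [mul_comm ‖v‖] at this
    simpa using this

lemma inner_Sk_le : ∃ C, 0 ≤ C ∧ ∀ (R : GRep H) (j : ℕ) (k l : ℤ) (u v : H),
    |inner ℝ (R.Sk' j k u) (R.Sk' j l v)|
      ≤ C * rho ^ j * √rho ^ (k - l).natAbs * (‖u‖ * ‖v‖) := by
  obtain ⟨C1, hC1, h1⟩ := inner_Delta_le (H := H)
  obtain ⟨C2, hC2, h2⟩ := norm_Sk_le (H := H)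
  have hr := rho_pos
  refine ⟨C1 + C2 ^ 2, by positivity, fun R j k l u v => ?_⟩
  set n := (k - l).natAbs with hn
  set x := |inner ℝ (R.Sk' j k u) (R.Sk' j l v)| with hx
  have hx0 : 0 ≤ x := abs_nonneg _
  have b1 : x ≤ C1 * rho ^ n * (‖u‖ * ‖v‖) := by
    have := h1 R (k - j) (l - j) (R.Tk k u) (R.Tk l v)
    rw [show k - j - (l - j) = k - l by ring] at this
    refine this.trans ?_
    have := R.norm_Tk k u
    have := R.norm_Tk l v
    gcongr
  have b2 : x ≤ C2 ^ 2 * (rho ^ j) ^ 2 * (‖u‖ * ‖v‖) := by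
    refine (abs_real_inner_le_norm _ _).trans ?_
    refine (mul_le_mul (h2 R j k u).2 (h2 R j l v).2 (norm_nonneg _) (by positivity)).trans ?_
    exact le_of_eq (by ring)
  have sq : √rho ^ n * √rho ^ n = rho ^ n := by rw [← mul_pow, Real.mul_self_sqrt hr.le]
  have hs : 0 < √rho ^ n := by positivity
  have huv : 0 ≤ ‖u‖ * ‖v‖ := by positivity
  refine abs_le_of_sq_le_sq' ?_ (by positivity) |>.2
  have b3 : x ^ 2 ≤ (C1 * rho ^ n * (‖u‖ * ‖v‖)) * (C2 ^ 2 * (rho ^ j) ^ 2 * (‖u‖ * ‖v‖)) := by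
    rw [pow_two]; exact mul_le_mul b1 b2 hx0 (by positivity)
  refine b3.trans ?_
  rw [← sq]
  have : C1 * C2 ^ 2 ≤ (C1 + C2 ^ 2) ^ 2 := by
    nlinarith [sq_nonneg C2, mul_nonneg hC1 (sq_nonneg C2)]
  calc _ = (C1 * C2 ^ 2) * ((rho ^ j) * √rho ^ n * (‖u‖ * ‖v‖)) ^ 2 := by ring
    _ ≤ (C1 + C2 ^ 2) ^ 2 * ((rho ^ j) * √rho ^ n * (‖u‖ * ‖v‖)) ^ 2 := by gcongr
    _ = _ := by ring

end GRep

end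

section

lemma summable_pow_natAbs {s : ℝ} (h0 : 0 ≤ s) (h1 : s < 1) :
    Summable fun n : ℤ => s ^ n.natAbs := by
  refine Summable.of_nat_of_neg ?_ ?_ <;> simpa using summable_geometric_of_lt_one h0 h1

lemma sum_pow_natAbs_sub_le {s : ℝ} (h0 : 0 ≤ s) (h1 : s < 1) (F : Finset ℤ) (k : ℤ) :
    ∑ l ∈ F, s ^ (k - l).natAbs ≤ ∑' n : ℤ, s ^ n.natAbs := by
  have hs := summable_pow_natAbs h0 h1
  have e := (Equiv.subLeft k).tsum_eq fun n : ℤ => s ^ n.natAbs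
  rw [← e]
  have hs' := (Equiv.subLeft k).summable_iff.2 hs
  exact hs'.sum_le_tsum F fun l _ => pow_nonneg h0 _

namespace GRep

variable {H : Type*} [NormedAddCommGroup H] [InnerProductSpace ℝ H] [CompleteSpace H]

lemma sum_norm_Sk_le : ∃ C, 0 ≤ C ∧ ∀ (R : GRep H) (j : ℕ) (F : Finset ℤ) (v : H),
    ∑ k ∈ F, ‖R.Sk j k v‖ ^ 2 ≤ C * rho ^ j * ‖v‖ ^ 2 := by
  obtain ⟨C, hC, hS⟩ := inner_Sk_le (H := H)
  have hr := rho_pos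
  have hs1 : √rho < 1 := by
    rw [Real.sqrt_lt' one_pos]; simpa using rho_lt_one
  set K := ∑' n : ℤ, √rho ^ n.natAbs with hK
  have hKs := sum_pow_natAbs_sub_le (Real.sqrt_nonneg rho) hs1
  have hK0 : 0 ≤ K := tsum_nonneg fun _ => by positivity
  refine ⟨C * K, by positivity, fun R j F v => ?_⟩
  set u := fun k => R.Sk j k v with hu
  set Q := ∑ k ∈ F, ‖u k‖ ^ 2 with hQ
  have hQ0 : 0 ≤ Q := Finset.sum_nonneg fun _ _ => by positivity
  set w := ∑ k ∈ F, R.Sk' j k (u k) with hw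
  have h1 : Q = inner ℝ v w := by
    rw [hw, inner_sum, hQ]
    refine Finset.sum_congr rfl fun k _ => ?_
    rw [← Sk_adj, real_inner_self_eq_norm_sq]
  have h2 : ‖w‖ ^ 2 ≤ C * rho ^ j * K * Q := by
    have hrow : ∑ k ∈ F, ∑ l ∈ F, √rho ^ (k - l).natAbs * ‖u k‖ ^ 2 ≤ K * Q := by
      rw [hQ, Finset.mul_sum]
      refine Finset.sum_le_sum fun k _ => ?_
      rw [← Finset.sum_mul]
      gcongr
      exact hKs F k
    have hcol : ∑ k ∈ F, ∑ l ∈ F, √rho ^ (k - l).natAbs * ‖u l‖ ^ 2 ≤ K * Q := by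
      rw [Finset.sum_comm]
      refine le_trans (le_of_eq ?_) hrow
      refine Finset.sum_congr rfl fun l _ => Finset.sum_congr rfl fun k _ => ?_
      rw [← Int.natAbs_neg, neg_sub]
    calc ‖w‖ ^ 2 = ∑ k ∈ F, ∑ l ∈ F, inner ℝ (R.Sk' j k (u k)) (R.Sk' j l (u l)) := by
          rw [← real_inner_self_eq_norm_sq, hw, sum_inner]
          simp_rw [inner_sum]
      _ ≤ ∑ k ∈ F, ∑ l ∈ F, C * rho ^ j * √rho ^ (k - l).natAbs
            * ((‖u k‖ ^ 2 + ‖u l‖ ^ 2) / 2) := by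
          refine Finset.sum_le_sum fun k _ => Finset.sum_le_sum fun l _ => ?_
          refine (le_abs_self _).trans ((hS R j k l _ _).trans ?_)
          gcongr
          nlinarith [sq_nonneg (‖u k‖ - ‖u l‖)]
      _ = C * rho ^ j * ((∑ k ∈ F, ∑ l ∈ F, √rho ^ (k - l).natAbs * ‖u k‖ ^ 2)
          + ∑ k ∈ F, ∑ l ∈ F, √rho ^ (k - l).natAbs * ‖u l‖ ^ 2) / 2 := by
          rw [← Finset.sum_add_distrib, Finset.mul_sum, Finset.sum_div]
          refine Finset.sum_congr rfl fun k _ => ?_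
          rw [← Finset.sum_add_distrib, Finset.mul_sum, Finset.sum_div]
          refine Finset.sum_congr rfl fun l _ => ?_
          ring
      _ ≤ C * rho ^ j * (K * Q + K * Q) / 2 := by gcongr
      _ = _ := by ring
  have h3 : Q ≤ ‖v‖ * ‖w‖ := h1 ▸ real_inner_le_norm v w
  rcases eq_or_lt_of_le hQ0 with h0 | h0
  · rw [← h0]; positivity
  refine le_of_mul_le_mul_right ?_ h0
  calc Q * Q ≤ (‖v‖ * ‖w‖) * (‖v‖ * ‖w‖) := by gcongr
    _ = ‖v‖ ^ 2 * ‖w‖ ^ 2 := by ring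
    _ ≤ ‖v‖ ^ 2 * (C * rho ^ j * K * Q) := by gcongr
    _ = _ := by ring

end GRep

end

lemma measurePreserving_gmul_right (g : G1) :
    MeasurePreserving (fun z => gmul z g) (volume : Measure G1) volume := by
  have h := MeasurePreserving.skew_product (μa := (volume : Measure (ℝ × ℝ)))
    (μb := (volume : Measure (ℝ × ℝ))) (μc := (volume : Measure ℝ)) (μd := (volume : Measure ℝ))
    (f := fun x => x + g.1) (measurePreserving_add_right _ g.1)
    (g := fun x u => u + (g.2 + (x.1 * g.1.2 - x.2 * g.1.1) / 2))
    (by unfold Function.uncurry; fun_prop)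
    (Eventually.of_forall fun x => (measurePreserving_add_right volume _).map_eq)
  have e : (fun z => gmul z g) = fun p : G1 =>
      (p.1 + g.1, p.2 + (g.2 + (p.1.1 * g.1.2 - p.1.2 * g.1.1) / 2)) := by
    funext z
    exact Prod.ext rfl (add_assoc _ _ _)
  rw [e]
  exact h

lemma measurePreserving_gmul_left (g : G1) :
    MeasurePreserving (fun z => gmul g z) (volume : Measure G1) volume := by
  have h := MeasurePreserving.skew_product (μa := (volume : Measure (ℝ × ℝ)))
    (μb := (volume : Measure (ℝ × ℝ))) (μc := (volume : Measure ℝ)) (μd := (volume : Measure ℝ))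
    (f := fun x => g.1 + x) (measurePreserving_add_left _ g.1)
    (g := fun x u => (g.2 + (g.1.1 * x.2 - g.1.2 * x.1) / 2) + u)
    (by unfold Function.uncurry; fun_prop)
    (Eventually.of_forall fun x => (measurePreserving_add_left volume _).map_eq)
  have e : (fun z => gmul g z) = fun p : G1 =>
      (g.1 + p.1, g.2 + (g.1.1 * p.1.2 - g.1.2 * p.1.1) / 2 + p.2) := by
    funext z
    exact Prod.ext rfl (add_right_comm _ _ _)
  rw [e]
  exact h

/-- The right regular representation on `L²`. -/
def rreg : GRep (Lp ℝ 2 (volume : Measure G1)) where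
  V g := Lp.compMeasurePreservingₗᵢ ℝ (fun z => gmul z g) (measurePreserving_gmul_right g)
  map_zero v := by
    apply Lp.ext
    refine (Lp.coeFn_compMeasurePreserving v (measurePreserving_gmul_right 0)).trans ?_
    simp [Function.comp_def, gmul_zero]
  map_mul g h v := by
    apply Lp.ext
    refine (Lp.coeFn_compMeasurePreserving v (measurePreserving_gmul_right (gmul g h))).trans ?_
    refine EventuallyEq.symm ?_
    refine (Lp.coeFn_compMeasurePreserving (Lp.compMeasurePreserving _
      (measurePreserving_gmul_right h) v) (measurePreserving_gmul_right g)).trans ?_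
    have := (measurePreserving_gmul_right g).quasiMeasurePreserving.ae_eq_comp
      (Lp.coeFn_compMeasurePreserving v (measurePreserving_gmul_right h))
    refine this.trans (Eventually.of_forall fun z => ?_)
    simp [gmul_assoc]
  cont v := by
    have c : Continuous fun g : G1 =>
        (⟨fun z => gmul z g, continuous_gmul.comp (continuous_id.prodMk continuous_const)⟩ :
          C(G1, G1)) :=
      ContinuousMap.continuous_of_continuous_uncurry _ 
        (continuous_gmul.comp (continuous_snd.prodMk continuous_fst))
    exact continuous_const.compMeasurePreservingLp c
      (fun g => measurePreserving_gmul_right g) ENNReal.ofNat_ne_top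

lemma rreg_toLp_ae (g : G1) {f : G1 → ℝ} (hf : MemLp f 2 volume) :
    rreg.V g (hf.toLp f) =ᵐ[volume] fun z => f (gmul z g) := by
  refine (Lp.coeFn_compMeasurePreserving _ (measurePreserving_gmul_right g)).trans ?_
  exact (measurePreserving_gmul_right g).quasiMeasurePreserving.ae_eq_comp hf.coeFn_toLp

/-- The average of a function against a dilated measure. -/
def av (ν : Measure G1) (r : ℝ) (f : G1 → ℝ) (z : G1) : ℝ := ∫ g, f (gmul z (gdil r g)) ∂ν

/-- Bounded continuous square-integrable functions. -/
structure Good (f : G1 → ℝ) : Prop where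
  cont : Continuous f
  bdd : ∃ M, ∀ z, |f z| ≤ M
  memLp : MemLp f 2 (volume : Measure G1)

lemma continuous_gmul_gdil (r : ℝ) : Continuous fun p : G1 × G1 => gmul p.1 (gdil r p.2) :=
  continuous_gmul.comp (continuous_fst.prodMk ((continuous_gdil r).comp continuous_snd))

lemma continuous_av (ν : Measure G1) [IsProbabilityMeasure ν] (r : ℝ) {f : G1 → ℝ}
    (hf : Continuous f) (hb : ∃ M, ∀ z, |f z| ≤ M) : Continuous (av ν r f) := by
  obtain ⟨M, hM⟩ := hb
  have c := hf.comp (continuous_gmul_gdil r)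
  refine continuous_of_dominated (bound := fun _ => M) (fun z => ?_)
    (fun z => Eventually.of_forall fun g => hM _) (integrable_const _)
    (Eventually.of_forall fun g => ?_)
  · exact (c.comp (Continuous.prodMk_right z)).aestronglyMeasurable
  · exact c.comp (Continuous.prodMk_left g)

lemma abs_av_le (ν : Measure G1) [IsProbabilityMeasure ν] (r : ℝ) {f : G1 → ℝ} {M : ℝ}
    (hM : ∀ z, |f z| ≤ M) (z : G1) : |av ν r f z| ≤ M := by
  have := norm_integral_le_of_norm_le_const (μ := ν) (f := fun g => f (gmul z (gdil r g))) (C := M)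
    (Eventually.of_forall fun g => hM _)
  simpa [av] using this

lemma avg_toLp_ae (ν : Measure G1) [IsProbabilityMeasure ν] (r : ℝ) {f : G1 → ℝ} (hf : Good f) :
    (rreg.dil r).avg ν (hf.memLp.toLp f) =ᵐ[volume] av ν r f := by
  have hb := hf.bdd
  obtain ⟨M, hM⟩ := hb
  have cav := continuous_av ν r hf.cont hf.bdd
  refine ae_eq_of_forall_setIntegral_eq_of_sigmaFinite (fun s _ hs' => ?_) (fun s _ hs' => ?_)
    fun s hs hs' => ?_
  · have : IsFiniteMeasure (volume.restrict s) := ⟨by simpa using hs'⟩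
    exact ((Lp.memLp _).restrict s).integrable one_le_two
  · have : IsFiniteMeasure (volume.restrict s) := ⟨by simpa using hs'⟩
    exact Integrable.of_bound cav.aestronglyMeasurable M
      (Eventually.of_forall fun z => abs_av_le ν r hM z)
  · have : IsFiniteMeasure (volume.restrict s) := ⟨by simpa using hs'⟩
    rw [← L2.inner_indicatorConstLp_one hs hs'.ne, real_inner_comm, GRep.inner_avg]
    have e : ∀ g, inner ℝ ((rreg.dil r).V g (hf.memLp.toLp f))
        (indicatorConstLp 2 hs hs'.ne (1 : ℝ)) = ∫ z in s, f (gmul z (gdil r g)) := by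
      intro g
      rw [real_inner_comm, L2.inner_indicatorConstLp_one hs hs'.ne]
      exact integral_congr_ae (ae_restrict_of_ae (rreg_toLp_ae (gdil r g) hf.memLp))
    simp_rw [e, av]
    refine integral_integral_swap (f := fun g z => f (gmul z (gdil r g))) ?_
    refine Integrable.of_bound (C := M) (Continuous.aestronglyMeasurable ?_)
      (Eventually.of_forall fun z => hM _)
    exact hf.cont.comp ((continuous_gmul_gdil r).comp continuous_swap)

lemma Good.av {f : G1 → ℝ} (hf : Good f) (ν : Measure G1) [IsProbabilityMeasure ν] (r : ℝ) :
    Good (av ν r f) where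
  cont := continuous_av ν r hf.cont hf.bdd
  bdd := hf.bdd.imp fun _ hM z => abs_av_le ν r hM z
  memLp := (Lp.memLp _).ae_eq (avg_toLp_ae ν r hf)

lemma Good.sub {f g : G1 → ℝ} (hf : Good f) (hg : Good g) : Good (fun z => f z - g z) where
  cont := hf.cont.sub hg.cont
  bdd := by
    obtain ⟨M, hM⟩ := hf.bdd
    obtain ⟨N, hN⟩ := hg.bdd
    exact ⟨M + N, fun z => (abs_sub _ _).trans (add_le_add (hM z) (hN z))⟩
  memLp := hf.memLp.sub hg.memLp

lemma avg_toLp (ν : Measure G1) [IsProbabilityMeasure ν] (r : ℝ) {f : G1 → ℝ} (hf : Good f) :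
    (rreg.dil r).avg ν (hf.memLp.toLp f) = (hf.av ν r).memLp.toLp (av ν r f) :=
  Lp.ext ((avg_toLp_ae ν r hf).trans (MemLp.coeFn_toLp _).symm)

/-- The smoothing operator at scale `2 ^ k` on functions. -/
def pk (k : ℤ) (f : G1 → ℝ) : G1 → ℝ := av boxM (2 ^ k) (av circM (2 ^ k) f)

/-- The circular average at scale `2 ^ k` on functions. -/
def tk (k : ℤ) (f : G1 → ℝ) : G1 → ℝ := av circM (2 ^ k) f

/-- The Littlewood–Paley piece of the circular average on functions. -/
def sk (j : ℕ) (k : ℤ) (f : G1 → ℝ) : G1 → ℝ :=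
  tk k fun z => pk (k - j) f z - pk (k - j - 1) f z

lemma Good.tk {f : G1 → ℝ} (hf : Good f) (k : ℤ) : Good (tk k f) := hf.av _ _
lemma Good.pk {f : G1 → ℝ} (hf : Good f) (k : ℤ) : Good (pk k f) := (hf.av _ _).av _ _
lemma Good.sk {f : G1 → ℝ} (hf : Good f) (j : ℕ) (k : ℤ) : Good (sk j k f) :=
  ((hf.pk _).sub (hf.pk _)).tk _

lemma Sk_toLp {f : G1 → ℝ} (hf : Good f) (j : ℕ) (k : ℤ) :
    rreg.Sk j k (hf.memLp.toLp f) = (hf.sk j k).memLp.toLp (sk j k f) := by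
  have hP : ∀ l, rreg.Pk l (hf.memLp.toLp f) = (hf.pk l).memLp.toLp (pk l f) := by
    intro l
    rw [GRep.Pk, ContinuousLinearMap.comp_apply, GRep.Tk, avg_toLp, GRep.Bk,
      avg_toLp _ _ (hf.av circM _)]
    · rfl
    · exact hf
  rw [GRep.Sk, ContinuousLinearMap.comp_apply, sub_apply, hP, hP,
    ← MemLp.toLp_sub]
  exact avg_toLp _ _ ((hf.pk _).sub (hf.pk _))

lemma lintegral_sup_sk_sq_le : ∃ C, 0 ≤ C ∧ ∀ (j : ℕ) (f : G1 → ℝ), Good f →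
    ∫⁻ z, ⨆ k, ‖sk j k f z‖ₑ ^ 2 ≤ ENNReal.ofReal (C * rho ^ j) * ∫⁻ z, ‖f z‖ₑ ^ 2 := by
  obtain ⟨C, hC, hS⟩ := GRep.sum_norm_Sk_le (H := Lp ℝ 2 (volume : Measure G1))
  refine ⟨C, hC, fun j f hf => ?_⟩
  have hr := rho_pos
  have nrm : ∀ {g : G1 → ℝ} (hg : MemLp g 2 (volume : Measure G1)),
      ENNReal.ofReal (‖hg.toLp g‖ ^ 2) = ∫⁻ z, ‖g z‖ₑ ^ 2 := by
    intro g hg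
    rw [Lp.norm_toLp, ENNReal.ofReal_pow ENNReal.toReal_nonneg, ENNReal.ofReal_toReal hg.2.ne,
      eLpNorm_eq_lintegral_rpow_enorm_toReal two_ne_zero ENNReal.ofNat_ne_top]
    simp only [ENNReal.toReal_ofNat]
    rw [← ENNReal.rpow_natCast, ← ENNReal.rpow_mul]
    norm_num
  calc ∫⁻ z, ⨆ k, ‖sk j k f z‖ₑ ^ 2 ≤ ∫⁻ z, ∑' k, ‖sk j k f z‖ₑ ^ 2 :=
        lintegral_mono fun z => iSup_le fun k => ENNReal.le_tsum k
    _ = ∑' k, ∫⁻ z, ‖sk j k f z‖ₑ ^ 2 :=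
        lintegral_tsum fun k => ((hf.sk j k).cont.enorm.measurable.pow_const 2).aemeasurable
    _ ≤ _ := by
        rw [ENNReal.tsum_eq_iSup_sum]
        refine iSup_le fun F => ?_
        simp_rw [← nrm (hf.sk j _).memLp, ← nrm hf.memLp]
        rw [← ENNReal.ofReal_sum_of_nonneg fun _ _ => by positivity,
          ← ENNReal.ofReal_mul (by positivity)]
        refine ENNReal.ofReal_le_ofReal ?_
        simp_rw [← Sk_toLp hf]
        exact hS rreg j F _

lemma gmul_mem_gbox {r s : ℝ} (hr : 0 ≤ r) (hs : 0 ≤ s) {a b : G1} (ha : a ∈ gbox r)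
    (hb : b ∈ gbox s) : gmul a b ∈ gbox (r + s) := by
  obtain ⟨a1, a2, a3⟩ := ha
  obtain ⟨b1, b2, b3⟩ := hb
  refine ⟨(abs_add_le _ _).trans (add_le_add a1 b1), (abs_add_le _ _).trans (add_le_add a2 b2), ?_⟩
  have h1 : |a.1.1 * b.1.2| ≤ r * s := by
    rw [abs_mul]; exact mul_le_mul a1 b2 (abs_nonneg _) hr
  have h2 : |a.1.2 * b.1.1| ≤ r * s := by
    rw [abs_mul]; exact mul_le_mul a2 b1 (abs_nonneg _) hr
  simp only [gmul]
  rw [abs_le] at *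
  constructor <;> nlinarith [mul_nonneg hr hs]

lemma neg_mem_gbox {r : ℝ} {a : G1} (ha : a ∈ gbox r) : -a ∈ gbox r := by
  simpa [gbox] using ha

lemma gbox_mono {r s : ℝ} (hr : 0 ≤ r) (h : r ≤ s) : gbox r ⊆ gbox s := fun a ⟨a1, a2, a3⟩ =>
  ⟨a1.trans h, a2.trans h, a3.trans (by nlinarith)⟩

lemma gdil_mem_gbox {r s : ℝ} (hr : 0 < r) {w : G1} : gdil r w ∈ gbox (r * s) ↔ w ∈ gbox s := by
  have h2 : 0 < r ^ 2 := by positivity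
  simp only [gbox, gdil, Set.mem_ofPred_eq, abs_mul, abs_of_pos hr, abs_of_pos h2, mul_pow,
    mul_le_mul_iff_right₀ hr, mul_le_mul_iff_right₀ h2]

lemma gcirc_mem_gbox (θ : ℝ) : gcirc θ ∈ gbox 1 := by
  simp [gcirc, gbox, abs_cos_le_one, abs_sin_le_one]

lemma map_gdil {r : ℝ} (hr : 0 < r) :
    (volume : Measure G1).map (gdil r) = (ENNReal.ofReal (r ^ 4))⁻¹ • volume := by
  have h1 : (volume : Measure ℝ).map (fun x => r * x) = (ENNReal.ofReal r)⁻¹ • volume := by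
    have := Real.map_volume_mul_left hr.ne'
    rw [abs_of_pos (by positivity), ENNReal.ofReal_inv_of_pos hr] at this
    exact this
  have hr2 : 0 < r ^ 2 := by positivity
  have h2 : (volume : Measure ℝ).map (fun x => r ^ 2 * x) =
      (ENNReal.ofReal (r ^ 2))⁻¹ • volume := by
    have := Real.map_volume_mul_left hr2.ne'
    rw [abs_of_pos (by positivity), ENNReal.ofReal_inv_of_pos hr2] at this
    exact this
  have e : gdil r = Prod.map (Prod.map (fun x => r * x) fun x => r * x) fun x => r ^ 2 * x := rfl
  have m1 : Measurable fun x : ℝ => r * x := by fun_prop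
  have m2 : Measurable fun x : ℝ => r ^ 2 * x := by fun_prop
  rw [e, Measure.volume_eq_prod, ← Measure.map_prod_map _ _ (m1.prodMap m1) m2,
    Measure.volume_eq_prod, ← Measure.map_prod_map _ _ m1 m1, h1, h2]
  simp only [Measure.prod_smul_left, Measure.prod_smul_right, smul_smul]
  congr 1
  rw [show r ^ 4 = r ^ 2 * (r * r) by ring, ENNReal.ofReal_mul hr2.le, ENNReal.ofReal_mul hr.le,
    ENNReal.mul_inv, ENNReal.mul_inv] <;> simp [hr, hr.ne']

/-- The left translate of a box. -/
def lbox (a : G1) (r : ℝ) : Set G1 := {v | gmul (-a) v ∈ gbox r}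

lemma continuous_gmul_left (a : G1) : Continuous fun v => gmul a v :=
  continuous_gmul.comp (continuous_const.prodMk continuous_id)

lemma measurableSet_lbox (a : G1) (r : ℝ) : MeasurableSet (lbox a r) :=
  (continuous_gmul_left (-a)).measurable (measurableSet_gbox r)

lemma volume_lbox (a : G1) {r : ℝ} (hr : 0 ≤ r) :
    volume (lbox a r) = ENNReal.ofReal (8 * r ^ 4) := by
  rw [← volume_gbox hr]
  exact (measurePreserving_gmul_left (-a)).measure_preimage (measurableSet_gbox r).nullMeasurableSet

lemma lintegral_gbox_two (F : G1 → ℝ≥0∞) (hF : Measurable F) (a : G1) {r : ℝ} (hr : 0 < r) :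
    ∫⁻ w in gbox 2, F (gmul a (gdil r w)) =
      (ENNReal.ofReal (r ^ 4))⁻¹ * ∫⁻ v in lbox a (r * 2), F v := by
  have mL := continuous_gmul_left a
  have mS := measurableSet_lbox a (r * 2)
  rw [← lintegral_indicator mS, ← (measurePreserving_gmul_left a).lintegral_comp
    (hF.indicator mS), ← smul_eq_mul, ← lintegral_smul_measure, ← map_gdil hr, lintegral_map,
    ← lintegral_indicator (measurableSet_gbox 2)]
  · refine lintegral_congr fun w => ?_
    by_cases h : w ∈ gbox 2
    · rw [Set.indicator_of_mem h, Set.indicator_of_mem]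
      simp only [lbox, Set.mem_ofPred_eq, ← gmul_assoc, neg_gmul, zero_gmul]
      exact (gdil_mem_gbox hr).2 h
    · rw [Set.indicator_of_notMem h, Set.indicator_of_notMem]
      simp only [lbox, Set.mem_ofPred_eq, ← gmul_assoc, neg_gmul, zero_gmul]
      rwa [gdil_mem_gbox hr]
  · exact (hF.indicator mS).comp mL.measurable
  · exact (continuous_gdil r).measurable

/-- The shifted box maximal function. -/
def shiftMax (j : ℕ) (θ : ℝ) (F : G1 → ℝ≥0∞) (z : G1) : ℝ≥0∞ :=
  ⨆ k : ℤ, ∫⁻ w in gbox 2, F (gmul (gmul z (gdil (2 ^ k) (gcirc θ))) (gdil (2 ^ (k - j)) w))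

lemma mem_of_lbox_inter {a b : G1} {r s : ℝ} (hr : 0 ≤ r) (hs : 0 ≤ s)
    (h : (lbox a r ∩ lbox b s).Nonempty) : a ∈ lbox b (s + r) := by
  obtain ⟨v, hv1, hv2⟩ := h
  have := gmul_mem_gbox hs hr hv2 (neg_mem_gbox hv1)
  have e : gmul (gmul (-b) v) (-(gmul (-a) v)) = gmul (-b) a := by
    have : -(gmul (-a) v) = gmul (-v) a := by
      simp only [gmul, Prod.ext_iff, Prod.fst_neg, Prod.snd_neg]
      refine ⟨⟨by ring, by ring⟩, by ring⟩
    rw [this, gmul_assoc, ← gmul_assoc v, gmul_neg, zero_gmul]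
  rw [e] at this
  exact this

lemma volume_shift_lbox (b g : G1) {r : ℝ} (hr : 0 ≤ r) :
    volume {z | gmul z g ∈ lbox b r} = ENNReal.ofReal (8 * r ^ 4) := by
  rw [← volume_lbox b hr]
  exact (measurePreserving_gmul_right g).measure_preimage
    (measurableSet_lbox b r).nullMeasurableSet

lemma shiftMax_weak (j : ℕ) (θ : ℝ) (F : G1 → ℝ≥0∞) (hF : Measurable F) (lam : ℝ≥0∞) :
    lam * volume {z | lam < shiftMax j θ F z} ≤ 10368 * (j + 2) * ∫⁻ z, F z := by
  rcases eq_or_ne lam 0 with rfl | hl0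
  · simp
  rcases eq_or_ne (∫⁻ z, F z) ∞ with hI | hI
  · rw [hI, ENNReal.mul_top (by simp)]; exact le_top
  rcases eq_or_ne lam ∞ with rfl | hlt
  · simp
  set γ : ℤ → G1 := fun k => gdil (2 ^ k) (gcirc θ) with hγ
  set ρ : G1 × ℤ → ℝ := fun t => 2 ^ (t.2 - j) with hρ
  have hρ0 : ∀ t, 0 < ρ t := fun t => by positivity
  set B : G1 × ℤ → Set G1 := fun t => lbox (gmul t.1 (γ t.2)) (ρ t * 2) with hB
  set T : Set (G1 × ℤ) := {t | lam * ENNReal.ofReal (ρ t ^ 4) < ∫⁻ v in B t, F v} with hT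
  have hbad : ∀ z, lam < shiftMax j θ F z → ∃ k, (z, k) ∈ T := by
    intro z hz
    obtain ⟨k, hk⟩ := lt_iSup_iff.1 hz
    refine ⟨k, ?_⟩
    rw [lintegral_gbox_two F hF _ (hρ0 (z, k)), mul_comm, ← div_eq_mul_inv,
      ENNReal.lt_div_iff_mul_lt] at hk
    · exact hk
    · left; have := hρ0 (z, k); simp only [ne_eq, ENNReal.ofReal_eq_zero, not_le]; positivity
    · left; simp
  set R := ((∫⁻ z, F z) / lam).toReal with hR
  have hbound : ∀ t ∈ T, ρ t ≤ R + 1 := by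
    intro t ht
    have h1 : lam * ENNReal.ofReal (ρ t ^ 4) ≤ ∫⁻ z, F z :=
      ht.le.trans (setLIntegral_le_lintegral _ _)
    have h2 : ENNReal.ofReal (ρ t ^ 4) ≤ (∫⁻ z, F z) / lam := by
      rw [ENNReal.le_div_iff_mul_le (Or.inl hl0) (Or.inl hlt), mul_comm]; exact h1
    have h3 : ρ t ^ 4 ≤ R := by
      rw [hR, ← ENNReal.ofReal_le_iff_le_toReal]
      · exact h2
      · exact ENNReal.div_ne_top hI hl0
    by_contra! hc
    have h1' : 1 ≤ ρ t := by
      have : 0 ≤ R := ENNReal.toReal_nonneg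
      linarith
    have : ρ t ≤ ρ t ^ 4 := le_self_pow₀ h1' (by norm_num)
    linarith
  have hne : ∀ t ∈ T, (B t).Nonempty := fun t _ => ⟨gmul t.1 (γ t.2), by
    have := hρ0 t
    simp only [hB, lbox, Set.mem_ofPred_eq, neg_gmul, gbox]
    simp only [Prod.fst_zero, Prod.snd_zero, abs_zero]
    refine ⟨by positivity, by positivity, by positivity⟩⟩
  obtain ⟨u, huT, hdisj, hcov⟩ := Vitali.exists_disjoint_subfamily_covering_enlargement B T ρ 2
    one_lt_two (fun t _ => (hρ0 t).le) (R + 1) hbound hne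
  have hucount : u.Countable := by
    have h := Measure.countable_meas_pos_of_disjoint_iUnion (μ := (volume : Measure G1))
      (As := fun t : u => B t) (fun t => measurableSet_lbox _ _)
      (fun s t hst => hdisj s.2 t.2 (fun h => hst (Subtype.ext h)))
    have e : {i : u | 0 < volume (B i)} = Set.univ := by
      refine Set.eq_univ_of_forall fun t => ?_
      have := hρ0 t
      simp only [hB, Set.mem_ofPred_eq]
      rw [volume_lbox _ (by positivity)]
      simp only [ENNReal.ofReal_pos]; positivity
    rw [e, Set.countable_univ_iff] at h
    exact Set.countable_coe_iff.1 h
  set E : G1 × ℤ → ℕ → Set G1 := fun b i => {z | gmul z (if i = 0 then 0 else γ (b.2 - j + i)) ∈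
    lbox (gmul b.1 (γ b.2)) (6 * ρ b)} with hE
  have hsub : {z | lam < shiftMax j θ F z} ⊆ ⋃ b ∈ u, ⋃ i ∈ Finset.range (j + 2), E b i := by
    intro z hz
    obtain ⟨k, hk⟩ := hbad z hz
    obtain ⟨b, hb, hint, hle⟩ := hcov _ hk
    simp only [Set.mem_iUnion]
    refine ⟨b, hb, ?_⟩
    have hb0 := hρ0 b
    have hm := mem_of_lbox_inter (by have := hρ0 (z, k); positivity) (by positivity) hint
    rcases le_or_gt k (b.2 - j) with hc | hc
    · refine ⟨0, by simp, ?_⟩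
      simp only [hE, Set.mem_ofPred_eq, if_true, gmul_zero]
      have hk2 : (2 : ℝ) ^ k ≤ ρ b := zpow_le_zpow_right₀ one_le_two hc
      have hkr : ρ (z, k) ≤ ρ b := by
        refine le_trans ?_ hk2
        exact zpow_le_zpow_right₀ one_le_two (by simp)
      have h0 : 0 < (2 : ℝ) ^ k := by positivity
      have hg : -(γ k) ∈ gbox (2 ^ k) := by
        have := (gdil_mem_gbox (s := 1) h0).2 (gcirc_mem_gbox θ)
        rw [mul_one] at this
        exact neg_mem_gbox this
      have := gmul_mem_gbox (by have := hρ0 (z, k); positivity) h0.le hm hg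
      simp only [gmul_assoc, gmul_neg, gmul_zero] at this
      refine gbox_mono (by have := hρ0 (z, k); positivity) ?_ this
      linarith
    · have hkb : k ≤ b.2 + 1 := by
        have : (2 : ℝ) ^ (k - j) ≤ 2 ^ (b.2 + 1 - j) := by
          rw [show b.2 + 1 - j = 1 + (b.2 - j) by ring, zpow_add₀ two_ne_zero, zpow_one]
          exact hle
        have := (zpow_le_zpow_iff_right₀ (one_lt_two (α := ℝ))).1 this
        linarith
      obtain ⟨i, hi⟩ := Int.le.dest hc.le
      refine ⟨i, by rw [Finset.mem_range]; omega, ?_⟩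
      have hi0 : i ≠ 0 := by rintro rfl; simp at hi; omega
      simp only [hE, Set.mem_ofPred_eq, if_neg hi0, hi]
      refine gbox_mono (by have := hρ0 (z, k); positivity) ?_ hm
      linarith
  have hEv : ∀ b i, volume (E b i) = ENNReal.ofReal (8 * (6 * ρ b) ^ 4) := fun b i =>
    volume_shift_lbox _ _ (by have := hρ0 b; positivity)
  have hvol : volume {z | lam < shiftMax j θ F z} ≤
      ∑' b : u, (j + 2) * (10368 * ENNReal.ofReal (ρ b ^ 4)) := by
    refine (measure_mono hsub).trans ((measure_biUnion_le _ hucount _).trans ?_)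
    refine ENNReal.tsum_le_tsum fun b => ?_
    refine (measure_biUnion_finset_le _ _).trans ?_
    simp only [hEv, Finset.sum_const, Finset.card_range, nsmul_eq_mul]
    rw [show 8 * (6 * ρ b) ^ 4 = 10368 * ρ b ^ 4 by ring, ENNReal.ofReal_mul (by norm_num)]
    simp
  calc lam * volume {z | lam < shiftMax j θ F z}
      ≤ lam * ∑' b : u, (j + 2) * (10368 * ENNReal.ofReal (ρ b ^ 4)) := by gcongr
    _ = ∑' b : u, 10368 * (j + 2) * (lam * ENNReal.ofReal (ρ b ^ 4)) := by
        rw [← ENNReal.tsum_mul_left]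
        refine tsum_congr fun b => ?_
        ring
    _ ≤ ∑' b : u, 10368 * (j + 2) * ∫⁻ v in B b, F v := by
        refine ENNReal.tsum_le_tsum fun b => ?_
        gcongr
        exact (huT b.2).le
    _ = 10368 * (j + 2) * ∫⁻ v in ⋃ b ∈ u, B b, F v := by
        rw [ENNReal.tsum_mul_left, ← lintegral_biUnion hucount
          (fun b _ => measurableSet_lbox _ _) hdisj]
    _ ≤ _ := by
        gcongr
        exact Measure.restrict_le_self

section

lemma lintegral_Ioc_rpow {s a : ℝ} (hs : 0 < s) (ha : 0 ≤ a) :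
    ∫⁻ t in Set.Ioc 0 a, ENNReal.ofReal (t ^ (s - 1)) = ENNReal.ofReal (a ^ s / s) := by
  have hi := intervalIntegral.intervalIntegrable_rpow' (a := 0) (b := a) (r := s - 1) (by linarith)
  rw [← ofReal_integral_eq_lintegral_ofReal, ← intervalIntegral.integral_of_le ha, integral_rpow]
  · simp [Real.zero_rpow hs.ne']
  · left; linarith
  · exact (intervalIntegrable_iff_integrableOn_Ioc_of_le ha).1 hi
  · refine (ae_restrict_iff' measurableSet_Ioc).2 (Eventually.of_forall fun t ht => ?_)
    exact Real.rpow_nonneg ht.1.le _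

lemma lintegral_Ioi_rpow {s a : ℝ} (hs : 0 < s) (ha : 0 < a) :
    ∫⁻ t in Set.Ioi a, ENNReal.ofReal (t ^ (-s - 1)) = ENNReal.ofReal (a ^ (-s) / s) := by
  rw [← ofReal_integral_eq_lintegral_ofReal, integral_Ioi_rpow_of_lt (by linarith) ha]
  · congr 1
    rw [show -s - 1 + 1 = -s by ring]
    rw [div_neg, neg_div, neg_neg]
  · exact integrableOn_Ioi_rpow_of_lt (by linarith) ha
  · refine (ae_restrict_iff' measurableSet_Ioi).2 (Eventually.of_forall fun t ht => ?_)
    exact Real.rpow_nonneg (ha.le.trans (le_of_lt ht)) _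

lemma lintegral_rpow_layer {X : Type*} [MeasurableSpace X] {μ : Measure X} {G : X → ℝ≥0∞}
    (hG : Measurable G) (hG' : ∀ z, G z ≠ ∞) {p : ℝ}
    (hp : 0 < p) : ∫⁻ z, G z ^ p ∂μ =
      ENNReal.ofReal p * ∫⁻ t in Set.Ioi (0 : ℝ), μ {z | ENNReal.ofReal t < G z}
        * ENNReal.ofReal (t ^ (p - 1)) := by
  have h := lintegral_rpow_eq_lintegral_meas_lt_mul μ (f := fun z => (G z).toReal)
    (Eventually.of_forall fun z => ENNReal.toReal_nonneg) hG.ennreal_toReal.aemeasurable hp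
  have e : ∀ z, ENNReal.ofReal ((G z).toReal ^ p) = G z ^ p := by
    intro z
    rw [← ENNReal.ofReal_rpow_of_nonneg ENNReal.toReal_nonneg hp.le, ENNReal.ofReal_toReal (hG' z)]
  simp_rw [e] at h
  rw [h]
  congr 1
  refine setLIntegral_congr_fun measurableSet_Ioi fun t ht => ?_
  simp only [ENNReal.ofReal_lt_iff_lt_toReal (le_of_lt ht) (hG' _)]

section Interpolation

variable {X : Type*} [MeasurableSpace X] {μ : Measure X} [SFinite μ]

lemma layer_high {f : X → ℝ} (hf : Measurable f) (h0 : ∀ z, 0 ≤ f z) {q p c : ℝ} (hq : 0 < q)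
    (hqp : q < p) (hc : 0 < c) :
    ENNReal.ofReal p * ∫⁻ t in Set.Ioi (0 : ℝ),
      (ENNReal.ofReal (t ^ (-q)) * ∫⁻ z in {z | c * t < f z}, ENNReal.ofReal (f z ^ q) ∂μ)
        * ENNReal.ofReal (t ^ (p - 1))
      ≤ ENNReal.ofReal (p / (p - q) * c ^ (q - p)) * ∫⁻ z, ENNReal.ofReal (f z ^ p) ∂μ := by
  have hp : 0 < p := hq.trans hqp
  set Φ : ℝ → X → ℝ≥0∞ := fun t z => {w : ℝ × X | c * w.1 < f w.2}.indicator
    (fun w => ENNReal.ofReal (w.1 ^ (p - q - 1)) * ENNReal.ofReal (f w.2 ^ q)) (t, z) with hΦ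
  have hms : MeasurableSet {w : ℝ × X | c * w.1 < f w.2} :=
    measurableSet_lt (by fun_prop) (by fun_prop)
  have hΦm : Measurable (Function.uncurry Φ) := by
    refine Measurable.indicator ?_ hms
    fun_prop
  have e1 : ∀ t ∈ Set.Ioi (0 : ℝ),
      (ENNReal.ofReal (t ^ (-q)) * ∫⁻ z in {z | c * t < f z}, ENNReal.ofReal (f z ^ q) ∂μ)
        * ENNReal.ofReal (t ^ (p - 1)) = ∫⁻ z, Φ t z ∂μ := by
    intro t ht
    have ht : 0 < t := ht
    rw [mul_right_comm, ← ENNReal.ofReal_mul (by positivity), ← Real.rpow_add ht,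
      show -q + (p - 1) = p - q - 1 by ring, ← lintegral_const_mul _ (by fun_prop),
      ← lintegral_indicator (measurableSet_lt measurable_const hf)]
    rfl
  rw [setLIntegral_congr_fun measurableSet_Ioi e1, lintegral_lintegral_swap hΦm.aemeasurable,
    ← lintegral_const_mul' _ _ ENNReal.ofReal_ne_top,
    ← lintegral_const_mul' _ _ ENNReal.ofReal_ne_top]
  refine lintegral_mono fun z => ?_
  have hx := h0 z
  set x := f z with hxd
  have e2 : ∫⁻ t in Set.Ioi (0 : ℝ), Φ t z ≤
      ∫⁻ t in Set.Ioc 0 (x / c), ENNReal.ofReal (t ^ (p - q - 1)) * ENNReal.ofReal (x ^ q) := by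
    rw [← lintegral_indicator measurableSet_Ioi, ← lintegral_indicator measurableSet_Ioc]
    refine lintegral_mono fun t => ?_
    by_cases ht : t ∈ Set.Ioi (0 : ℝ)
    · rw [Set.indicator_of_mem ht]
      by_cases h : c * t < x
      · have h' : t ∈ Set.Ioc 0 (x / c) := ⟨ht, by rw [le_div_iff₀ hc]; linarith⟩
        rw [Set.indicator_of_mem h']
        exact (Set.indicator_of_mem (s := {w : ℝ × X | c * w.1 < f w.2}) h _).le
      · refine le_trans (le_of_eq ?_) zero_le
        exact Set.indicator_of_notMem (s := {w : ℝ × X | c * w.1 < f w.2}) h _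
    · rw [Set.indicator_of_notMem ht]; exact zero_le
  refine (mul_le_mul_right e2 _).trans ?_
  rw [lintegral_mul_const _ (by fun_prop), lintegral_Ioc_rpow (by linarith) (by positivity),
    ← ENNReal.ofReal_mul (by have : 0 < p - q := by linarith
                             positivity), ← ENNReal.ofReal_mul hp.le,
    ← ENNReal.ofReal_mul (by have : 0 < p - q := by linarith
                             positivity)]
  refine ENNReal.ofReal_le_ofReal (le_of_eq ?_)
  have hpq : p - q ≠ 0 := by linarith
  rw [Real.div_rpow hx hc.le, show q - p = -(p - q) by ring, Real.rpow_neg hc.le]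
  have : x ^ p = x ^ (p - q) * x ^ q := by
    rw [← Real.rpow_add_of_nonneg hx (by linarith) hq.le]; congr 1; ring
  rw [this]
  ring

lemma layer_low {f : X → ℝ} (hf : Measurable f) (h0 : ∀ z, 0 ≤ f z) {p c : ℝ} (hp : 0 < p)
    (hp2 : p < 2) (hc : 0 < c) :
    ENNReal.ofReal p * ∫⁻ t in Set.Ioi (0 : ℝ),
      (ENNReal.ofReal (t ^ (-2 : ℝ)) * ∫⁻ z, ENNReal.ofReal (min (f z) (c * t) ^ 2) ∂μ)
        * ENNReal.ofReal (t ^ (p - 1))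
      ≤ ENNReal.ofReal (2 / (2 - p) * c ^ (2 - p)) * ∫⁻ z, ENNReal.ofReal (f z ^ p) ∂μ := by
  set Φ : ℝ → X → ℝ≥0∞ := fun t z =>
    ENNReal.ofReal (t ^ (p - 2 - 1)) * ENNReal.ofReal (min (f z) (c * t) ^ 2) with hΦ
  have hΦm : Measurable (Function.uncurry Φ) := by
    unfold Φ Function.uncurry; fun_prop
  have e1 : ∀ t ∈ Set.Ioi (0 : ℝ),
      (ENNReal.ofReal (t ^ (-2 : ℝ)) * ∫⁻ z, ENNReal.ofReal (min (f z) (c * t) ^ 2) ∂μ)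
        * ENNReal.ofReal (t ^ (p - 1)) = ∫⁻ z, Φ t z ∂μ := by
    intro t ht
    have ht : 0 < t := ht
    rw [mul_right_comm, ← ENNReal.ofReal_mul (by positivity), ← Real.rpow_add ht,
      show (-2 : ℝ) + (p - 1) = p - 2 - 1 by ring, ← lintegral_const_mul _ (by fun_prop)]
  rw [setLIntegral_congr_fun measurableSet_Ioi e1, lintegral_lintegral_swap hΦm.aemeasurable,
    ← lintegral_const_mul' _ _ ENNReal.ofReal_ne_top,
    ← lintegral_const_mul' _ _ ENNReal.ofReal_ne_top]
  refine lintegral_mono fun z => ?_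
  have hx := h0 z
  simp only [hΦ]
  set x := f z with hxd
  rcases eq_or_lt_of_le hx with h | h
  · refine le_trans (le_of_eq ?_) zero_le
    rw [setLIntegral_congr_fun (g := fun _ => 0) measurableSet_Ioi]
    · simp
    · intro t ht
      have ht : 0 < t := ht
      simp only [← h, min_eq_left (mul_pos hc ht).le]; simp
  have ha : 0 < x / c := by positivity
  have hp2' : 2 - p ≠ 0 := by linarith
  have hp2'' : 0 < 2 - p := by linarith
  rw [← Set.Ioc_union_Ioi_eq_Ioi ha.le, lintegral_union measurableSet_Ioi
    (Set.disjoint_left.2 fun t h1 h2 => absurd h2 (not_lt.2 h1.2))]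
  have i1 : ∫⁻ t in Set.Ioc 0 (x / c), ENNReal.ofReal (t ^ (p - 2 - 1)) *
      ENNReal.ofReal (min x (c * t) ^ 2) ≤ ENNReal.ofReal (c ^ 2 * ((x / c) ^ p / p)) := by
    rw [ENNReal.ofReal_mul (by positivity), ← lintegral_Ioc_rpow hp ha.le,
      ← lintegral_const_mul' _ _ ENNReal.ofReal_ne_top]
    refine setLIntegral_mono (by fun_prop) fun t ht => ?_
    have ht0 : 0 < t := ht.1
    rw [← ENNReal.ofReal_mul (by positivity), ← ENNReal.ofReal_mul (by positivity)]
    refine ENNReal.ofReal_le_ofReal ?_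
    have : min x (c * t) ^ 2 ≤ (c * t) ^ 2 := by
      gcongr
      exact min_le_right _ _
    calc t ^ (p - 2 - 1) * min x (c * t) ^ 2 ≤ t ^ (p - 2 - 1) * (c * t) ^ 2 := by gcongr
      _ = c ^ 2 * (t ^ (p - 2 - 1) * t ^ (2 : ℝ)) := by rw [Real.rpow_two]; ring
      _ = _ := by rw [← Real.rpow_add ht0]; congr 2; ring
  have i2 : ∫⁻ t in Set.Ioi (x / c), ENNReal.ofReal (t ^ (p - 2 - 1)) *
      ENNReal.ofReal (min x (c * t) ^ 2) ≤
      ENNReal.ofReal (x ^ 2 * ((x / c) ^ (-(2 - p)) / (2 - p))) := by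
    rw [ENNReal.ofReal_mul (by positivity), ← lintegral_Ioi_rpow hp2'' ha,
      ← lintegral_const_mul' _ _ ENNReal.ofReal_ne_top]
    refine setLIntegral_mono (by fun_prop) fun t ht => ?_
    have ht0 : 0 < t := ha.trans ht
    rw [← ENNReal.ofReal_mul (by positivity), ← ENNReal.ofReal_mul (by positivity)]
    refine ENNReal.ofReal_le_ofReal ?_
    rw [show -(2 - p) - 1 = p - 2 - 1 by ring, mul_comm]
    gcongr
    exact min_le_left _ _
  refine (mul_le_mul_right (add_le_add i1 i2) _).trans ?_
  rw [← ENNReal.ofReal_add (by positivity) (by positivity), ← ENNReal.ofReal_mul hp.le,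
    ← ENNReal.ofReal_mul (by positivity)]
  refine ENNReal.ofReal_le_ofReal (le_of_eq ?_)
  have r1 : c ^ 2 * (x / c) ^ p = c ^ (2 - p) * x ^ p := by
    rw [Real.div_rpow hx hc.le, Real.rpow_sub hc, Real.rpow_two]; field_simp
  have r2 : x ^ 2 * (x / c) ^ (-(2 - p)) = c ^ (2 - p) * x ^ p := by
    rw [Real.div_rpow hx hc.le, Real.rpow_neg hx, Real.rpow_neg hc.le, Real.rpow_sub h,
      Real.rpow_two]; field_simp
  calc p * (c ^ 2 * ((x / c) ^ p / p) + x ^ 2 * ((x / c) ^ (-(2 - p)) / (2 - p)))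
      = c ^ 2 * (x / c) ^ p + p / (2 - p) * (x ^ 2 * (x / c) ^ (-(2 - p))) := by
        field_simp
    _ = _ := by rw [r1, r2]; field_simp; ring

/-- Interpolation between a weak type estimate and a trivial bound. -/
lemma interp_high {f : X → ℝ} (hf : Measurable f) (h0 : ∀ z, 0 ≤ f z) {G : X → ℝ≥0∞}
    (hG : Measurable G) (hG' : ∀ z, G z ≠ ∞) {q p c : ℝ} (hq : 0 < q) (hqp : q < p) (hc : 0 < c)
    {A : ℝ≥0∞} (hA : A ≠ ∞)
    (h : ∀ t : ℝ, 0 < t → μ {z | ENNReal.ofReal t < G z} ≤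
      A * (ENNReal.ofReal (t ^ (-q)) * ∫⁻ z in {z | c * t < f z}, ENNReal.ofReal (f z ^ q) ∂μ)) :
    ∫⁻ z, G z ^ p ∂μ ≤
      A * (ENNReal.ofReal (p / (p - q) * c ^ (q - p)) * ∫⁻ z, ENNReal.ofReal (f z ^ p) ∂μ) := by
  rw [lintegral_rpow_layer hG hG' (hq.trans hqp)]
  refine le_trans ?_ (mul_le_mul_right (layer_high hf h0 hq hqp hc) A)
  rw [mul_left_comm]
  refine mul_le_mul_right ?_ _
  rw [← lintegral_const_mul' _ _ hA]
  refine setLIntegral_mono' measurableSet_Ioi fun t ht => ?_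
  rw [← mul_assoc A]
  exact mul_le_mul_left (h t ht) _

/-- Interpolation between two strong type estimates. -/
lemma interp_two {f : X → ℝ} (hf : Measurable f) (h0 : ∀ z, 0 ≤ f z) {G : X → ℝ≥0∞}
    (hG : Measurable G) (hG' : ∀ z, G z ≠ ∞) {q p c : ℝ} (hq : 0 < q) (hqp : q < p) (hp2 : p < 2)
    (hc : 0 < c) {A B : ℝ≥0∞} (hA : A ≠ ∞) (hB : B ≠ ∞)
    (h : ∀ t : ℝ, 0 < t → μ {z | ENNReal.ofReal t < G z} ≤
      A * (ENNReal.ofReal (t ^ (-q)) * ∫⁻ z in {z | c * t < f z}, ENNReal.ofReal (f z ^ q) ∂μ)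
      + B * (ENNReal.ofReal (t ^ (-2 : ℝ)) * ∫⁻ z, ENNReal.ofReal (min (f z) (c * t) ^ 2) ∂μ)) :
    ∫⁻ z, G z ^ p ∂μ ≤
      (A * ENNReal.ofReal (p / (p - q) * c ^ (q - p)) +
        B * ENNReal.ofReal (2 / (2 - p) * c ^ (2 - p))) * ∫⁻ z, ENNReal.ofReal (f z ^ p) ∂μ := by
  rw [lintegral_rpow_layer hG hG' (hq.trans hqp), add_mul, mul_assoc, mul_assoc]
  refine le_trans ?_ (add_le_add (mul_le_mul_right (layer_high hf h0 hq hqp hc) A)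
    (mul_le_mul_right (layer_low hf h0 (hq.trans hqp) hp2 hc) B))
  rw [mul_left_comm A, mul_left_comm B, ← mul_add]
  refine mul_le_mul_right ?_ _
  have hm : Measurable fun t : ℝ => ∫⁻ z, ENNReal.ofReal (min (f z) (c * t) ^ 2) ∂μ := by
    refine Measurable.lintegral_prod_right' (f := fun w : ℝ × X =>
      ENNReal.ofReal (min (f w.2) (c * w.1) ^ 2)) ?_
    fun_prop
  rw [← lintegral_const_mul' _ _ hA, ← lintegral_const_mul' _ _ hB, ← lintegral_add_right]
  · refine setLIntegral_mono' measurableSet_Ioi fun t ht => ?_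
    rw [← mul_assoc A, ← mul_assoc B, ← add_mul]
    exact mul_le_mul_left (h t ht) _
  · fun_prop

end Interpolation

end

/-- Nonnegative continuous functions with compact support. -/
structure CC (f : G1 → ℝ) : Prop where
  cont : Continuous f
  supp : HasCompactSupport f
  nonneg : ∀ z, 0 ≤ f z

lemma CC.bdd {f : G1 → ℝ} (hf : CC f) : ∃ M, ∀ z, |f z| ≤ M :=
  hf.cont.bounded_above_of_compact_support hf.supp

lemma CC.good {f : G1 → ℝ} (hf : CC f) : Good f :=
  ⟨hf.cont, hf.bdd, hf.cont.memLp_of_hasCompactSupport hf.supp⟩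

lemma CC.lo {f : G1 → ℝ} (hf : CC f) {c : ℝ} (hc : 0 ≤ c) : CC fun z => min (f z) c where
  cont := hf.cont.min continuous_const
  supp := hf.supp.comp_left (g := fun x => min x c) (min_eq_left hc)
  nonneg z := le_min (hf.nonneg z) hc

lemma CC.hi {f : G1 → ℝ} (hf : CC f) {c : ℝ} (hc : 0 ≤ c) : CC fun z => f z - min (f z) c where
  cont := hf.cont.sub (hf.cont.min continuous_const)
  supp := hf.supp.comp_left (g := fun x => x - min x c) (by simp [hc])
  nonneg z := sub_nonneg.2 (min_le_left _ _)

lemma lintegral_hi_rpow_le {f : G1 → ℝ} (hf : CC f) {c q : ℝ} (hc : 0 ≤ c) (hq : 0 < q) :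
    ∫⁻ z, ENNReal.ofReal ((f z - min (f z) c) ^ q) ≤
      ∫⁻ z in {z | c < f z}, ENNReal.ofReal (f z ^ q) := by
  rw [← lintegral_indicator (measurableSet_lt measurable_const hf.cont.measurable)]
  refine lintegral_mono fun z => ?_
  by_cases h : c < f z
  · rw [Set.indicator_of_mem (show z ∈ {z | c < f z} from h)]
    refine ENNReal.ofReal_le_ofReal (Real.rpow_le_rpow ((hf.hi hc).nonneg z) ?_ hq.le)
    linarith [(hf.lo hc).nonneg z]
  · rw [min_eq_left (not_lt.1 h), sub_self, Real.zero_rpow hq.ne']; simp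

lemma rpow_lintegral_le {X : Type*} [MeasurableSpace X] {ν : Measure X} [IsProbabilityMeasure ν]
    {h : X → ℝ≥0∞} (hh : AEMeasurable h ν) {q : ℝ} (hq : 1 < q) :
    (∫⁻ x, h x ∂ν) ^ q ≤ ∫⁻ x, h x ^ q ∂ν := by
  have hpq := Real.HolderConjugate.conjExponent hq
  have := ENNReal.lintegral_mul_le_Lp_mul_Lq ν hpq hh (g := fun _ => 1) aemeasurable_const
  simp only [Pi.mul_apply, mul_one, ENNReal.one_rpow, lintegral_const, measure_univ] at this
  calc (∫⁻ x, h x ∂ν) ^ q ≤ ((∫⁻ x, h x ^ q ∂ν) ^ (1 / q)) ^ q := by gcongr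
    _ = _ := by rw [← ENNReal.rpow_mul, one_div_mul_cancel (by linarith), ENNReal.rpow_one]

lemma measurable_shiftMax (j : ℕ) {F : G1 → ℝ≥0∞} (hF : Measurable F) :
    Measurable fun w : ℝ × G1 => shiftMax j w.1 F w.2 := by
  unfold shiftMax
  refine Measurable.iSup fun k => ?_
  refine Measurable.lintegral_prod_right' (ν := volume.restrict (gbox 2))
    (f := fun w : (ℝ × G1) × G1 =>
    F (gmul (gmul w.1.2 (gdil (2 ^ k) (gcirc w.1.1))) (gdil (2 ^ (k - j)) w.2))) ?_
  refine hF.comp (Continuous.measurable ?_)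
  refine continuous_gmul.comp (Continuous.prodMk (continuous_gmul.comp (Continuous.prodMk ?_ ?_)) ?_)
  · fun_prop
  · exact (continuous_gdil _).comp (continuous_gcirc.comp (by fun_prop))
  · exact (continuous_gdil _).comp (by fun_prop)

lemma measurable_shiftMax_right (j : ℕ) (θ : ℝ) {F : G1 → ℝ≥0∞} (hF : Measurable F) :
    Measurable (shiftMax j θ F) := by
  have h : Measurable fun z : G1 => (θ, z) := by fun_prop
  have := (measurable_shiftMax j hF).comp h
  exact this

lemma shiftMax_le (j : ℕ) (θ : ℝ) {F : G1 → ℝ≥0∞} {M : ℝ≥0∞} (hM : ∀ z, F z ≤ M) (z : G1) :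
    shiftMax j θ F z ≤ 128 * M := by
  refine iSup_le fun k => ?_
  refine (lintegral_mono fun w => hM _).trans ?_
  rw [lintegral_const, Measure.restrict_apply_univ, volume_gbox (by norm_num), mul_comm]
  norm_num

lemma shiftMax_add_le (j : ℕ) (θ : ℝ) {F F' : G1 → ℝ≥0∞} (hF : Measurable F) (z : G1) :
    shiftMax j θ (fun z => F z + F' z) z ≤ shiftMax j θ F z + shiftMax j θ F' z := by
  refine iSup_le fun k => ?_
  rw [lintegral_add_left]
  · exact add_le_add (le_iSup_of_le k le_rfl) (le_iSup_of_le k le_rfl)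
  · exact hF.comp ((continuous_gmul_left _).comp (continuous_gdil _)).measurable

lemma CC.measurable_ofReal {f : G1 → ℝ} (hf : CC f) : Measurable fun z => ENNReal.ofReal (f z) :=
  hf.cont.measurable.ennreal_ofReal

lemma lt_shiftMax_hi (j : ℕ) (θ : ℝ) {f : G1 → ℝ} (hf : CC f) {t : ℝ} (ht : 0 < t) (z : G1)
    (hz : ENNReal.ofReal t < shiftMax j θ (fun z => ENNReal.ofReal (f z)) z) :
    ENNReal.ofReal (t / 2) <
      shiftMax j θ (fun z => ENNReal.ofReal (f z - min (f z) (1 / 256 * t))) z := by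
  have hc : 0 ≤ 1 / 256 * t := by positivity
  by_contra hcon
  rw [not_lt] at hcon
  have e : (fun z => ENNReal.ofReal (f z)) = fun z => ENNReal.ofReal (min (f z) (1 / 256 * t))
      + ENNReal.ofReal (f z - min (f z) (1 / 256 * t)) := by
    ext z
    rw [← ENNReal.ofReal_add ((hf.lo hc).nonneg z) ((hf.hi hc).nonneg z)]
    congr 1; ring
  rw [e] at hz
  refine absurd (hz.trans_le ((shiftMax_add_le j θ (hf.lo hc).measurable_ofReal z).trans
    (add_le_add (shiftMax_le j θ (M := ENNReal.ofReal (1 / 256 * t))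
      (fun z => ENNReal.ofReal_le_ofReal (min_le_right _ _)) z) hcon))) ?_
  rw [not_lt, show (128 : ℝ≥0∞) = ENNReal.ofReal 128 by simp,
    ← ENNReal.ofReal_mul (by norm_num), ← ENNReal.ofReal_add (by positivity) (by positivity)]
  refine ENNReal.ofReal_le_ofReal (by linarith)

lemma shiftMax_distrib (j : ℕ) (θ : ℝ) {f : G1 → ℝ} (hf : CC f) {t : ℝ} (ht : 0 < t) :
    volume {z | ENNReal.ofReal t < shiftMax j θ (fun z => ENNReal.ofReal (f z)) z} ≤
      ENNReal.ofReal (2 * 10368 * (j + 2)) * (ENNReal.ofReal (t ^ (-1 : ℝ)) *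
        ∫⁻ z in {z | 1 / 256 * t < f z}, ENNReal.ofReal (f z ^ (1 : ℝ))) := by
  have hc : 0 ≤ 1 / 256 * t := by positivity
  have hw := shiftMax_weak j θ _ (hf.hi hc).measurable_ofReal (ENNReal.ofReal (t / 2))
  have hh := lintegral_hi_rpow_le hf hc one_pos
  simp only [Real.rpow_one] at hh
  simp only [Real.rpow_one]
  have e1 : ENNReal.ofReal (t⁻¹ * 2) * ENNReal.ofReal (t / 2) = 1 := by
    rw [← ENNReal.ofReal_mul (by positivity), ← ENNReal.ofReal_one]; congr 1; field_simp
  have e2 : ENNReal.ofReal (t⁻¹ * 2) * (10368 * (j + 2)) =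
      ENNReal.ofReal (2 * 10368 * (j + 2)) * ENNReal.ofReal t⁻¹ := by
    have : (10368 * (j + 2) : ℝ≥0∞) = ENNReal.ofReal (10368 * (j + 2)) := by
      rw [ENNReal.ofReal_mul (by norm_num), ENNReal.ofReal_add (by positivity) (by norm_num)]
      simp
    rw [this, ← ENNReal.ofReal_mul (by positivity), ← ENNReal.ofReal_mul (by positivity)]
    congr 1; ring
  rw [Real.rpow_neg_one]
  calc _ ≤ volume {z | ENNReal.ofReal (t / 2) <
          shiftMax j θ (fun z => ENNReal.ofReal (f z - min (f z) (1 / 256 * t))) z} :=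
        measure_mono fun z hz => lt_shiftMax_hi j θ hf ht z hz
    _ = ENNReal.ofReal (t⁻¹ * 2) * (ENNReal.ofReal (t / 2) * volume {z | ENNReal.ofReal (t / 2) <
          shiftMax j θ (fun z => ENNReal.ofReal (f z - min (f z) (1 / 256 * t))) z}) := by
        rw [← mul_assoc, e1, one_mul]
    _ ≤ ENNReal.ofReal (t⁻¹ * 2) * (10368 * (j + 2) *
          ∫⁻ z, ENNReal.ofReal (f z - min (f z) (1 / 256 * t))) := by gcongr
    _ ≤ ENNReal.ofReal (t⁻¹ * 2) * (10368 * (j + 2) *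
          ∫⁻ z in {z | 1 / 256 * t < f z}, ENNReal.ofReal (f z)) := by gcongr
    _ = _ := by rw [← mul_assoc, e2, mul_assoc]

lemma shiftMax_strong {q : ℝ} (hq : 1 < q) : ∃ C : ℝ, 0 ≤ C ∧ ∀ (j : ℕ) (θ : ℝ) (f : G1 → ℝ), CC f →
    ∫⁻ z, shiftMax j θ (fun z => ENNReal.ofReal (f z)) z ^ q ≤
      ENNReal.ofReal (C * (j + 2)) * ∫⁻ z, ENNReal.ofReal (f z ^ q) := by
  have hq1 : 0 < q - 1 := by linarith
  have hK : 0 ≤ q / (q - 1) * (1 / 256) ^ (1 - q) := by positivity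
  refine ⟨2 * 10368 * (q / (q - 1) * (1 / 256) ^ (1 - q)), mul_nonneg (by norm_num) hK,
    fun j θ f hf => ?_⟩
  obtain ⟨M, hM⟩ := hf.bdd
  have hG : Measurable (shiftMax j θ (fun z => ENNReal.ofReal (f z))) :=
    measurable_shiftMax_right j θ hf.measurable_ofReal
  have hG' : ∀ z, shiftMax j θ (fun z => ENNReal.ofReal (f z)) z ≠ ∞ := fun z =>
    ne_top_of_le_ne_top (b := 128 * ENNReal.ofReal M)
      (ENNReal.mul_ne_top (by simp) ENNReal.ofReal_ne_top)
      (shiftMax_le j θ (fun z => ENNReal.ofReal_le_ofReal ((le_abs_self _).trans (hM z))) z)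
  have h := interp_high (μ := volume) (p := q) (q := 1) (c := 1 / 256)
    (A := ENNReal.ofReal (2 * 10368 * (j + 2))) hf.cont.measurable hf.nonneg hG hG'
    one_pos hq (by norm_num) ENNReal.ofReal_ne_top fun t ht => shiftMax_distrib j θ hf ht
  rw [← mul_assoc, ← ENNReal.ofReal_mul (by positivity)] at h
  rwa [mul_right_comm]

lemma enorm_av_le (ν : Measure G1) (r : ℝ) (f : G1 → ℝ) (z : G1) :
    ‖av ν r f z‖ₑ ≤ ∫⁻ g, ‖f (gmul z (gdil r g))‖ₑ ∂ν := enorm_integral_le_lintegral_enorm _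

lemma lintegral_boxM (F : G1 → ℝ≥0∞) : ∫⁻ b, F b ∂boxM = 8⁻¹ * ∫⁻ b in gbox 1, F b := by
  rw [boxM, lintegral_smul_measure, volume_gbox one_pos.le, smul_eq_mul]
  norm_num

lemma lintegral_boxM_shift_le {h : G1} (hh : h ∈ gbox 1) {F : G1 → ℝ≥0∞} (hF : Measurable F)
    (w : G1) (r : ℝ) :
    ∫⁻ b, F (gmul (gmul w (gdil r b)) (gdil r h)) ∂boxM ≤
      8⁻¹ * ∫⁻ b in gbox 2, F (gmul w (gdil r b)) := by
  have hm : Measurable fun b => F (gmul w (gdil r b)) :=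
    hF.comp ((continuous_gmul_left w).comp (continuous_gdil r)).measurable
  rw [lintegral_boxM]
  refine mul_le_mul_right ?_ _
  rw [← lintegral_indicator (measurableSet_gbox 2), ← lintegral_indicator (measurableSet_gbox 1),
    ← (measurePreserving_gmul_right h).lintegral_comp (hm.indicator (measurableSet_gbox 2))]
  refine lintegral_mono fun b => ?_
  by_cases hb : b ∈ gbox 1
  · have h2 : gmul b h ∈ gbox 2 := by
      have := gmul_mem_gbox one_pos.le one_pos.le hb hh
      norm_num at this
      exact this
    rw [Set.indicator_of_mem hb, Set.indicator_of_mem h2, gmul_assoc, ← gdil_gmul]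
  · rw [Set.indicator_of_notMem hb]
    exact zero_le

lemma enorm_av_box_circ_le {f : G1 → ℝ} (hf : Continuous f) (r : ℝ) (w : G1) :
    ‖av boxM r (av circM r f) w‖ₑ ≤ 8⁻¹ * ∫⁻ b in gbox 2, ‖f (gmul w (gdil r b))‖ₑ := by
  have hm : Measurable fun z => ‖f z‖ₑ := hf.measurable.enorm
  calc _ ≤ ∫⁻ b, ‖av circM r f (gmul w (gdil r b))‖ₑ ∂boxM := enorm_av_le _ _ _ _
    _ ≤ ∫⁻ b, ∫⁻ h, ‖f (gmul (gmul w (gdil r b)) (gdil r h))‖ₑ ∂circM ∂boxM :=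
      lintegral_mono fun b => enorm_av_le _ _ _ _
    _ = ∫⁻ h, ∫⁻ b, ‖f (gmul (gmul w (gdil r b)) (gdil r h))‖ₑ ∂boxM ∂circM := by
      refine lintegral_lintegral_swap (f := fun b h => ‖f (gmul (gmul w (gdil r b)) (gdil r h))‖ₑ)
        (hm.comp (Continuous.measurable ?_)).aemeasurable
      exact (continuous_gmul_gdil r).comp
        ((((continuous_gmul_left w).comp (continuous_gdil r)).comp continuous_fst).prodMk
          continuous_snd)
    _ ≤ ∫⁻ _, (8⁻¹ * ∫⁻ b in gbox 2, ‖f (gmul w (gdil r b))‖ₑ) ∂circM := by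
      refine lintegral_mono_ae ?_
      filter_upwards [circM_ae] with h hh using lintegral_boxM_shift_le hh hm w r
    _ = _ := by simp

lemma enorm_tk_pk_le {f : G1 → ℝ} (hf : CC f) (k : ℤ) (j : ℕ) (z : G1) :
    ‖tk k (pk (k - j) f) z‖ₑ ≤
      8⁻¹ * ∫⁻ θ, shiftMax j θ (fun z => ENNReal.ofReal (f z)) z ∂cm := by
  rw [← lintegral_const_mul' _ _ (by simp)]
  have hc : Continuous fun g => pk (k - j) f (gmul z (gdil (2 ^ k) g)) :=
    (hf.good.pk (k - j)).cont.comp ((continuous_gmul_left z).comp (continuous_gdil _))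
  refine (enorm_av_le _ _ _ _).trans ?_
  rw [circM, lintegral_map hc.measurable.enorm continuous_gcirc.measurable]
  refine lintegral_mono fun θ => (enorm_av_box_circ_le hf.cont _ _).trans ?_
  refine mul_le_mul_right ?_ _
  simp_rw [Real.enorm_of_nonneg (hf.nonneg _)]
  exact le_iSup (fun k : ℤ => ∫⁻ w in gbox 2, ENNReal.ofReal
    (f (gmul (gmul z (gdil (2 ^ k) (gcirc θ))) (gdil (2 ^ (k - j)) w)))) k

lemma integrable_circM {f : G1 → ℝ} (hf : Good f) (z : G1) (r : ℝ) :
    Integrable (fun g => f (gmul z (gdil r g))) circM := by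
  obtain ⟨M, hM⟩ := hf.bdd
  refine Integrable.of_bound ?_ M (Eventually.of_forall fun g => hM _)
  exact (hf.cont.comp ((continuous_gmul_left z).comp (continuous_gdil _))).aestronglyMeasurable

lemma sk_eq {f : G1 → ℝ} (hf : Good f) (j : ℕ) (k : ℤ) (z : G1) :
    sk j k f z = tk k (pk (k - j) f) z - tk k (pk (k - (j + 1 : ℕ)) f) z := by
  rw [sk, tk, av, integral_sub (integrable_circM (hf.pk _) z _) (integrable_circM (hf.pk _) z _)]
  push_cast
  rw [← sub_sub]
  rfl

/-- The maximal function of the Littlewood–Paley pieces. -/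
def smax (j : ℕ) (f : G1 → ℝ) (z : G1) : ℝ≥0∞ := ⨆ k : ℤ, ‖sk j k f z‖ₑ

lemma measurable_smax (j : ℕ) {f : G1 → ℝ} (hf : Good f) : Measurable (smax j f) :=
  Measurable.iSup fun k => (hf.sk j k).cont.measurable.enorm

lemma measurable_shiftMax_left (j : ℕ) {F : G1 → ℝ≥0∞} (hF : Measurable F) (z : G1) :
    Measurable fun θ => shiftMax j θ F z := by
  have h : Measurable fun θ : ℝ => (θ, z) := by fun_prop
  have := (measurable_shiftMax j hF).comp h
  exact this

lemma smax_le {f : G1 → ℝ} (hf : CC f) (j : ℕ) (z : G1) :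
    smax j f z ≤ ∫⁻ θ, 8⁻¹ * (shiftMax j θ (fun z => ENNReal.ofReal (f z)) z +
      shiftMax (j + 1) θ (fun z => ENNReal.ofReal (f z)) z) ∂cm := by
  refine iSup_le fun k => ?_
  have : Measurable fun θ => shiftMax j θ (fun z => ENNReal.ofReal (f z)) z :=
    measurable_shiftMax_left j hf.measurable_ofReal z
  rw [sk_eq hf.good, lintegral_const_mul' _ _ (by simp), lintegral_add_left this, mul_add]
  exact enorm_sub_le.trans (add_le_add (enorm_tk_pk_le hf k j z) (enorm_tk_pk_le hf k (j + 1) z))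

lemma rpow_add_le {a b : ℝ≥0∞} {q : ℝ} (hq : 1 < q) : (8⁻¹ * (a + b)) ^ q ≤ a ^ q + b ^ q := by
  have hq0 : 0 < q := by linarith
  rcases le_total a b with h | h
  · have : 8⁻¹ * (a + b) ≤ b := by
      calc 8⁻¹ * (a + b) ≤ 8⁻¹ * (8 * b) := by
            gcongr; calc a + b ≤ b + b := by gcongr
              _ = 2 * b := (two_mul b).symm
              _ ≤ 8 * b := by gcongr; norm_num
        _ = b := by rw [← mul_assoc, ENNReal.inv_mul_cancel (by simp) (by simp), one_mul]
    exact (ENNReal.rpow_le_rpow this hq0.le).trans le_add_self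
  · have : 8⁻¹ * (a + b) ≤ a := by
      calc 8⁻¹ * (a + b) ≤ 8⁻¹ * (8 * a) := by
            gcongr; calc a + b ≤ a + a := by gcongr
              _ = 2 * a := (two_mul a).symm
              _ ≤ 8 * a := by gcongr; norm_num
        _ = a := by rw [← mul_assoc, ENNReal.inv_mul_cancel (by simp) (by simp), one_mul]
    exact (ENNReal.rpow_le_rpow this hq0.le).trans le_self_add

lemma smax_rpow_le {f : G1 → ℝ} (hf : CC f) (j : ℕ) (z : G1) {q : ℝ} (hq : 1 < q) :
    smax j f z ^ q ≤ ∫⁻ θ, (shiftMax j θ (fun z => ENNReal.ofReal (f z)) z ^ q +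
      shiftMax (j + 1) θ (fun z => ENNReal.ofReal (f z)) z ^ q) ∂cm := by
  have h1 := measurable_shiftMax_left j hf.measurable_ofReal z
  have h2 := measurable_shiftMax_left (j + 1) hf.measurable_ofReal z
  have h3 := (h1.add h2).const_mul 8⁻¹
  calc _ ≤ (∫⁻ θ, 8⁻¹ * (shiftMax j θ (fun z => ENNReal.ofReal (f z)) z +
      shiftMax (j + 1) θ (fun z => ENNReal.ofReal (f z)) z) ∂cm) ^ q :=
        ENNReal.rpow_le_rpow (smax_le hf j z) (by linarith)
    _ ≤ ∫⁻ θ, (8⁻¹ * (shiftMax j θ (fun z => ENNReal.ofReal (f z)) z +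
      shiftMax (j + 1) θ (fun z => ENNReal.ofReal (f z)) z)) ^ q ∂cm :=
        rpow_lintegral_le h3.aemeasurable hq
    _ ≤ _ := lintegral_mono fun θ => rpow_add_le hq

lemma lintegral_smax_rpow_le {q : ℝ} (hq : 1 < q) : ∃ C : ℝ, 0 ≤ C ∧ ∀ (j : ℕ) (f : G1 → ℝ), CC f →
    ∫⁻ z, smax j f z ^ q ≤ ENNReal.ofReal (C * (j + 3)) * ∫⁻ z, ENNReal.ofReal (f z ^ q) := by
  obtain ⟨C, hC, h⟩ := shiftMax_strong hq
  refine ⟨2 * C, by positivity, fun j f hf => ?_⟩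
  have hm : ∀ j, Measurable fun w : ℝ × G1 =>
      shiftMax j w.1 (fun z => ENNReal.ofReal (f z)) w.2 ^ q := fun j =>
    (measurable_shiftMax j hf.measurable_ofReal).pow_const q
  have hm' : ∀ j θ, Measurable fun z : G1 =>
      shiftMax j θ (fun z => ENNReal.ofReal (f z)) z ^ q := fun j θ =>
    (measurable_shiftMax_right j θ hf.measurable_ofReal).pow_const q
  calc ∫⁻ z, smax j f z ^ q ≤ ∫⁻ z, ∫⁻ θ, (shiftMax j θ (fun z => ENNReal.ofReal (f z)) z ^ q +
      shiftMax (j + 1) θ (fun z => ENNReal.ofReal (f z)) z ^ q) ∂cm :=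
        lintegral_mono fun z => smax_rpow_le hf j z hq
    _ = ∫⁻ θ, ∫⁻ z, (shiftMax j θ (fun z => ENNReal.ofReal (f z)) z ^ q +
      shiftMax (j + 1) θ (fun z => ENNReal.ofReal (f z)) z ^ q) ∂volume ∂cm := by
        refine (lintegral_lintegral_swap (μ := cm) (ν := volume) ?_).symm
        exact ((hm j).add (hm (j + 1))).aemeasurable
    _ ≤ ∫⁻ _, (ENNReal.ofReal (2 * C * (j + 3)) * ∫⁻ z, ENNReal.ofReal (f z ^ q)) ∂cm := by
        refine lintegral_mono fun θ => ?_
        simp only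
        rw [lintegral_add_left (hm' j θ)]
        refine (add_le_add (h j θ f hf) (h (j + 1) θ f hf)).trans ?_
        rw [← add_mul, ← ENNReal.ofReal_add (by positivity) (by positivity)]
        refine mul_le_mul_left (ENNReal.ofReal_le_ofReal ?_) _
        push_cast
        nlinarith
    _ = _ := by simp

lemma av_add_of_good {f g : G1 → ℝ} (hf : Good f) (hg : Good g) (ν : Measure G1)
    [IsProbabilityMeasure ν] (r : ℝ) :
    av ν r (fun z => f z + g z) = fun z => av ν r f z + av ν r g z := by
  have h : ∀ {f}, Good f → ∀ z, Integrable (fun y => f (gmul z (gdil r y))) ν := by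
    intro f hf z
    obtain ⟨M, hM⟩ := hf.bdd
    refine Integrable.of_bound ?_ M (Eventually.of_forall fun g => hM _)
    exact (hf.cont.comp ((continuous_gmul_left z).comp (continuous_gdil _))).aestronglyMeasurable
  exact funext fun z => integral_add (h hf z) (h hg z)

lemma tk_pk_add {f g : G1 → ℝ} (hf : Good f) (hg : Good g) (k l : ℤ) (z : G1) :
    tk k (pk l fun z => f z + g z) z = tk k (pk l f) z + tk k (pk l g) z := by
  have h : (pk l fun z => f z + g z) = fun z => pk l f z + pk l g z := by
    rw [pk, av_add_of_good hf hg, av_add_of_good (hf.av circM _) (hg.av circM _)]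
    rfl
  rw [h, tk, av_add_of_good (hf.pk l) (hg.pk l)]
  rfl

lemma smax_add_le {f g : G1 → ℝ} (hf : Good f) (hg : Good g) (hfg : Good fun z => f z + g z)
    (j : ℕ) (z : G1) : smax j (fun z => f z + g z) z ≤ smax j f z + smax j g z := by
  refine iSup_le fun k => ?_
  have e : sk j k (fun z => f z + g z) z = sk j k f z + sk j k g z := by
    rw [sk_eq hfg, sk_eq hf, sk_eq hg, tk_pk_add hf hg, tk_pk_add hf hg]
    ring
  rw [e]
  exact (enorm_add_le _ _).trans (add_le_add (le_iSup (fun k => ‖sk j k f z‖ₑ) k)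
    (le_iSup (fun k => ‖sk j k g z‖ₑ) k))

lemma smax_le_of_bdd {f : G1 → ℝ} (hf : Good f) {M : ℝ} (hM : ∀ z, |f z| ≤ M) (j : ℕ) (z : G1) :
    smax j f z ≤ ENNReal.ofReal (M + M) := by
  refine iSup_le fun k => ?_
  have hp : ∀ l z, |pk l f z| ≤ M := fun l z => abs_av_le _ _ (abs_av_le _ _ hM) z
  rw [sk_eq hf, Real.enorm_eq_ofReal_abs]
  refine ENNReal.ofReal_le_ofReal ((abs_sub _ _).trans (add_le_add ?_ ?_))
  · exact abs_av_le _ _ (hp _) z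
  · exact abs_av_le _ _ (hp _) z

lemma lintegral_smax_sq_le : ∃ C : ℝ, 0 ≤ C ∧ ∀ (j : ℕ) (f : G1 → ℝ), CC f →
    ∫⁻ z, smax j f z ^ (2 : ℝ) ≤ ENNReal.ofReal (C * rho ^ j) * ∫⁻ z, ENNReal.ofReal (f z ^ 2) := by
  obtain ⟨C, hC, h⟩ := lintegral_sup_sk_sq_le
  refine ⟨C, hC, fun j f hf => le_trans ?_ ((h j f hf.good).trans (le_of_eq ?_))⟩
  · refine lintegral_mono fun z => ?_
    rw [ENNReal.rpow_ofNat, smax, ENNReal.iSup_pow]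
  · congr 1
    refine lintegral_congr fun z => ?_
    rw [Real.enorm_of_nonneg (hf.nonneg z), ENNReal.ofReal_pow (hf.nonneg z)]

lemma meas_lt_le {G : G1 → ℝ≥0∞} (hG : Measurable G) {t q : ℝ} (ht : 0 < t) (hq : 0 < q) :
    volume {z | ENNReal.ofReal (t / 2) < G z} ≤
      ENNReal.ofReal (2 ^ q * t ^ (-q)) * ∫⁻ z, G z ^ q := by
  have h := mul_meas_ge_le_lintegral (μ := volume) (hG.pow_const q) (ENNReal.ofReal (t / 2) ^ q)
  have e : ENNReal.ofReal (2 ^ q * t ^ (-q)) * ENNReal.ofReal (t / 2) ^ q = 1 := by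
    rw [ENNReal.ofReal_rpow_of_pos (by positivity), ← ENNReal.ofReal_mul (by positivity),
      Real.div_rpow ht.le (by norm_num), Real.rpow_neg ht.le, ← ENNReal.ofReal_one]
    congr 1
    have := Real.rpow_pos_of_pos ht q
    field_simp
  calc _ ≤ volume {z | ENNReal.ofReal (t / 2) ^ q ≤ G z ^ q} :=
        measure_mono fun z hz => ENNReal.rpow_le_rpow (le_of_lt hz) hq.le
    _ = ENNReal.ofReal (2 ^ q * t ^ (-q)) * (ENNReal.ofReal (t / 2) ^ q *
          volume {z | ENNReal.ofReal (t / 2) ^ q ≤ G z ^ q}) := by rw [← mul_assoc, e, one_mul]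
    _ ≤ _ := by gcongr

lemma smax_distrib {q C₁ C₂ : ℝ} (hq : 1 < q) {j : ℕ} {f : G1 → ℝ} (hf : CC f) {c t : ℝ}
    (hC₁ : 0 ≤ C₁) (hC₂ : 0 ≤ C₂)
    (h₁ : ∀ f, CC f → ∫⁻ z, smax j f z ^ q ≤ ENNReal.ofReal C₁ * ∫⁻ z, ENNReal.ofReal (f z ^ q))
    (h₂ : ∀ f, CC f → ∫⁻ z, smax j f z ^ (2 : ℝ) ≤
      ENNReal.ofReal C₂ * ∫⁻ z, ENNReal.ofReal (f z ^ 2)) (hc : 0 < c) (ht : 0 < t) :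
    volume {z | ENNReal.ofReal t < smax j f z} ≤
      ENNReal.ofReal (2 ^ q * C₁) * (ENNReal.ofReal (t ^ (-q)) *
        ∫⁻ z in {z | c * t < f z}, ENNReal.ofReal (f z ^ q))
      + ENNReal.ofReal (4 * C₂) * (ENNReal.ofReal (t ^ (-2 : ℝ)) *
        ∫⁻ z, ENNReal.ofReal (min (f z) (c * t) ^ 2)) := by
  have hct : 0 ≤ c * t := by positivity
  have hq0 : 0 < q := by linarith
  have hsub : {z | ENNReal.ofReal t < smax j f z} ⊆
      {z | ENNReal.ofReal (t / 2) < smax j (fun z => f z - min (f z) (c * t)) z} ∪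
      {z | ENNReal.ofReal (t / 2) < smax j (fun z => min (f z) (c * t)) z} := by
    intro z hz
    by_contra hcon
    simp only [Set.mem_union, Set.mem_ofPred_eq, not_or, not_lt] at hcon hz
    have e : (fun z => (f z - min (f z) (c * t)) + min (f z) (c * t)) = f := by
      ext z; ring
    have hs := smax_add_le (hf.hi hct).good (hf.lo hct).good (by rw [e]; exact hf.good) j z
    rw [e] at hs
    refine absurd (hz.trans_le (hs.trans (add_le_add hcon.1 hcon.2))) ?_
    rw [← ENNReal.ofReal_add (by positivity) (by positivity), add_halves]
    exact lt_irrefl _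
  refine (measure_mono hsub).trans ((measure_union_le _ _).trans (add_le_add ?_ ?_))
  · calc _ ≤ ENNReal.ofReal (2 ^ q * t ^ (-q)) *
          ∫⁻ z, smax j (fun z => f z - min (f z) (c * t)) z ^ q :=
          meas_lt_le (measurable_smax j (hf.hi hct).good) ht hq0
      _ ≤ ENNReal.ofReal (2 ^ q * t ^ (-q)) * (ENNReal.ofReal C₁ *
          ∫⁻ z in {z | c * t < f z}, ENNReal.ofReal (f z ^ q)) := by
          refine mul_le_mul_right ((h₁ _ (hf.hi hct)).trans ?_) _
          exact mul_le_mul_right (lintegral_hi_rpow_le hf hct hq0) _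
      _ = _ := by
          rw [← mul_assoc, ← mul_assoc, ← ENNReal.ofReal_mul (by positivity),
            ← ENNReal.ofReal_mul (by positivity)]
          congr 2; ring
  · calc _ ≤ ENNReal.ofReal (2 ^ (2 : ℝ) * t ^ (-2 : ℝ)) *
          ∫⁻ z, smax j (fun z => min (f z) (c * t)) z ^ (2 : ℝ) :=
          meas_lt_le (measurable_smax j (hf.lo hct).good) ht two_pos
      _ ≤ ENNReal.ofReal (2 ^ (2 : ℝ) * t ^ (-2 : ℝ)) * (ENNReal.ofReal C₂ *
          ∫⁻ z, ENNReal.ofReal (min (f z) (c * t) ^ 2)) :=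
          mul_le_mul_right (h₂ _ (hf.lo hct)) _
      _ = _ := by
          rw [← mul_assoc, ← mul_assoc, ← ENNReal.ofReal_mul (by positivity),
            ← ENNReal.ofReal_mul (by positivity)]
          congr 2; norm_num; ring

lemma lintegral_smax_decay {p : ℝ} (hp : 1 < p) (hp2 : p < 2) : ∃ K σ : ℝ, 0 ≤ K ∧ 0 < σ ∧ σ < 1 ∧
    ∀ (j : ℕ) (f : G1 → ℝ), CC f →
      ∫⁻ z, smax j f z ^ p ≤ ENNReal.ofReal (K * (j + 3) * σ ^ j) *
        ∫⁻ z, ENNReal.ofReal (f z ^ p) := by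
  obtain ⟨q, hq, hqp⟩ := exists_between hp
  obtain ⟨C₁, hC₁, h₁⟩ := lintegral_smax_rpow_le hq
  obtain ⟨C₂, hC₂, h₂⟩ := lintegral_smax_sq_le
  have hr := rho_pos
  have hr1 := rho_lt_one
  have hpq : 0 < p - q := by linarith
  have h2p : 0 < 2 - p := by linarith
  set σ := rho ^ ((p - q) / 2) with hσ
  have hσ0 : 0 < σ := Real.rpow_pos_of_pos hr _
  refine ⟨2 ^ q * C₁ * (p / (p - q)) + 4 * C₂ * (2 / (2 - p)), σ, by positivity, hσ0,
    Real.rpow_lt_one hr.le hr1 (by linarith), fun j f hf => ?_⟩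
  obtain ⟨M, hM⟩ := hf.bdd
  set b : ℝ := rho ^ (-(1 / 2) : ℝ) with hb
  have hb0 : 0 < b := Real.rpow_pos_of_pos hr _
  have hbj : 0 < b ^ j := by positivity
  have h := interp_two (μ := volume) (p := p) (q := q) (c := b ^ j)
    (A := ENNReal.ofReal (2 ^ q * (C₁ * (j + 3)))) (B := ENNReal.ofReal (4 * (C₂ * rho ^ j)))
    hf.cont.measurable hf.nonneg
    (measurable_smax j hf.good) (fun z => ne_top_of_le_ne_top ENNReal.ofReal_ne_top
      (smax_le_of_bdd hf.good hM j z)) (by linarith) hqp hp2 hbj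
    ENNReal.ofReal_ne_top ENNReal.ofReal_ne_top fun t ht =>
      smax_distrib hq hf (by positivity) (by positivity) (h₁ j) (h₂ j) hbj ht
  refine h.trans (mul_le_mul_left ?_ _)
  have e1 : (b ^ j) ^ (q - p) = σ ^ j := by
    rw [← Real.rpow_natCast, ← Real.rpow_mul hb0.le, mul_comm, Real.rpow_mul hb0.le,
      Real.rpow_natCast, hb, ← Real.rpow_mul hr.le, hσ]
    congr 2; ring
  have e2 : rho ^ j * (b ^ j) ^ (2 - p) = (rho ^ (p / 2)) ^ j := by
    rw [← Real.rpow_natCast b, ← Real.rpow_mul hb0.le, mul_comm (j : ℝ), Real.rpow_mul hb0.le,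
      Real.rpow_natCast, ← mul_pow, hb, ← Real.rpow_mul hr.le]
    congr 1
    nth_rw 1 [← Real.rpow_one rho]
    rw [← Real.rpow_add hr]
    congr 1; ring
  have e3 : (rho ^ (p / 2)) ^ j ≤ σ ^ j := by
    refine pow_le_pow_left₀ (Real.rpow_pos_of_pos hr _).le ?_ j
    exact Real.rpow_le_rpow_of_exponent_ge hr hr1.le (by linarith)
  rw [← ENNReal.ofReal_mul (by positivity), ← ENNReal.ofReal_mul (by positivity),
    ← ENNReal.ofReal_add (by positivity) (by positivity)]
  refine ENNReal.ofReal_le_ofReal ?_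
  calc _ = 2 ^ q * C₁ * (p / (p - q)) * (j + 3) * σ ^ j +
        4 * C₂ * (2 / (2 - p)) * (rho ^ j * (b ^ j) ^ (2 - p)) := by rw [e1]; ring
    _ ≤ 2 ^ q * C₁ * (p / (p - q)) * (j + 3) * σ ^ j +
        4 * C₂ * (2 / (2 - p)) * (1 * σ ^ j) := by rw [e2, one_mul]; gcongr
    _ ≤ 2 ^ q * C₁ * (p / (p - q)) * (j + 3) * σ ^ j +
        4 * C₂ * (2 / (2 - p)) * ((j + 3) * σ ^ j) := by
        gcongr; linarith [(Nat.cast_nonneg j : (0 : ℝ) ≤ j)]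
    _ = _ := by ring

lemma tendsto_av (ν : Measure G1) [IsProbabilityMeasure ν] {M : ℝ} {r : ℕ → ℝ}
    {F : ℕ → G1 → ℝ} {z : G1} {L : G1 → ℝ} (hF : ∀ n, Continuous (F n)) (hM : ∀ n z, |F n z| ≤ M)
    (h : ∀ g, Tendsto (fun n => F n (gmul z (gdil (r n) g))) atTop (𝓝 (L g))) :
    Tendsto (fun n => av ν (r n) (F n) z) atTop (𝓝 (∫ g, L g ∂ν)) := by
  refine tendsto_integral_of_dominated_convergence (fun _ => M) (fun n => ?_) (integrable_const _)
    (fun n => Eventually.of_forall fun g => hM n _) (Eventually.of_forall h)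
  exact ((hF n).comp ((continuous_gmul_left z).comp (continuous_gdil _))).aestronglyMeasurable

lemma continuous_gdil_left (g : G1) : Continuous fun r => gdil r g := by
  unfold gdil; fun_prop

lemma tendsto_tk_pk {f : G1 → ℝ} (hf : Good f) (k : ℤ) (z : G1) :
    Tendsto (fun J : ℕ => tk k (pk (k - J) f) z) atTop (𝓝 (tk k f z)) := by
  obtain ⟨M, hM⟩ := hf.bdd
  have hr : Tendsto (fun J : ℕ => (2 : ℝ) ^ (k - (J : ℤ))) atTop (𝓝 0) := by
    have : (fun J : ℕ => (2 : ℝ) ^ (k - (J : ℤ))) = fun J => 2 ^ k * (1 / 2) ^ J := by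
      ext J
      rw [zpow_sub₀ (by norm_num), zpow_natCast, one_div, inv_pow, div_eq_mul_inv]
    rw [this]
    simpa using (tendsto_pow_atTop_nhds_zero_of_lt_one (by norm_num : (0 : ℝ) ≤ 1 / 2)
      (by norm_num)).const_mul ((2 : ℝ) ^ k)
  have hd : ∀ g, Tendsto (fun J : ℕ => gdil ((2 : ℝ) ^ (k - (J : ℤ))) g) atTop (𝓝 0) := by
    intro g
    have h := ((continuous_gdil_left g).tendsto 0).comp hr
    rwa [show gdil 0 g = 0 by simp [gdil]] at h
  refine tendsto_av circM (r := fun _ => 2 ^ k) (F := fun J : ℕ => pk (k - J) f) (M := M)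
    (fun J => (hf.pk _).cont) (fun J z => abs_av_le _ _ (abs_av_le _ _ hM) z) fun c => ?_
  set w := gmul z (gdil (2 ^ k) c)
  have h2 := tendsto_av boxM (r := fun J : ℕ => (2 : ℝ) ^ (k - (J : ℤ))) (M := M) (z := w)
    (F := fun J : ℕ => av circM (2 ^ (k - (J : ℤ))) f) (L := fun _ => f w)
    (fun J => (hf.av _ _).cont) (fun J z => abs_av_le _ _ hM z) fun b => by
      have h3 : Tendsto (fun J : ℕ => ∫ h, f (gmul (gmul w (gdil (2 ^ (k - (J : ℤ))) b))
          (gdil (2 ^ (k - (J : ℤ))) h)) ∂circM) atTop (𝓝 (∫ _, f w ∂circM)) := by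
        refine tendsto_integral_of_dominated_convergence (fun _ => M) (fun n => ?_)
          (integrable_const _) (fun n => Eventually.of_forall fun g => hM _)
          (Eventually.of_forall fun h => ?_)
        · exact (hf.cont.comp ((continuous_gmul_left _).comp
            (continuous_gdil _))).aestronglyMeasurable
        · have h4 : Tendsto (fun J : ℕ => gmul (gmul w (gdil (2 ^ (k - (J : ℤ))) b))
              (gdil (2 ^ (k - (J : ℤ))) h)) atTop (𝓝 (gmul (gmul w 0) 0)) :=
            (continuous_gmul.tendsto (gmul w 0, 0)).comp
              ((((continuous_gmul_left w).tendsto 0).comp (hd b)).prodMk_nhds (hd h))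
          rw [gmul_zero, gmul_zero] at h4
          exact (hf.cont.tendsto w).comp h4
      simp only [integral_const, probReal_univ, one_smul] at h3
      exact h3
  simp only [integral_const, probReal_univ, one_smul] at h2
  exact h2

lemma tk_pk_telescope {f : G1 → ℝ} (hf : Good f) (k : ℤ) (z : G1) (J : ℕ) :
    tk k (pk (k - J) f) z = tk k (pk (k - (0 : ℕ)) f) z - ∑ j ∈ Finset.range J, sk j k f z := by
  induction J with
  | zero => simp
  | succ J ih => rw [Finset.sum_range_succ, sk_eq hf, ← sub_sub, ← ih]; ring

/-- The lacunary circular maximal function. -/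
def tmax (f : G1 → ℝ) (z : G1) : ℝ≥0∞ := ⨆ k : ℤ, ‖tk k f z‖ₑ

/-- The average over the circle of the translated maximal functions. -/
def bmax (f : G1 → ℝ) (z : G1) : ℝ≥0∞ :=
  8⁻¹ * ∫⁻ θ, shiftMax 0 θ (fun z => ENNReal.ofReal (f z)) z ∂cm

lemma tmax_le {f : G1 → ℝ} (hf : CC f) (z : G1) : tmax f z ≤ bmax f z + ∑' j, smax j f z := by
  refine iSup_le fun k => ?_
  refine le_of_tendsto (tendsto_tk_pk hf.good k z).enorm (Eventually.of_forall fun J => ?_)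
  rw [tk_pk_telescope hf.good]
  refine enorm_sub_le.trans (add_le_add (enorm_tk_pk_le hf k 0 z) ?_)
  refine (enorm_sum_le _ _).trans ((Finset.sum_le_sum fun j _ => ?_).trans
    (ENNReal.sum_le_tsum (f := fun j => smax j f z) (Finset.range J)))
  exact le_iSup (fun k => ‖sk j k f z‖ₑ) k

lemma lintegral_bmax_rpow_le {p : ℝ} (hp : 1 < p) : ∃ C : ℝ, 0 ≤ C ∧ ∀ f : G1 → ℝ, CC f →
    ∫⁻ z, bmax f z ^ p ≤ ENNReal.ofReal C * ∫⁻ z, ENNReal.ofReal (f z ^ p) := by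
  obtain ⟨C, hC, h⟩ := shiftMax_strong hp
  refine ⟨C * 2, by positivity, fun f hf => ?_⟩
  have hm := fun z => measurable_shiftMax_left 0 hf.measurable_ofReal z
  calc ∫⁻ z, bmax f z ^ p
      ≤ ∫⁻ z, ∫⁻ θ, shiftMax 0 θ (fun z => ENNReal.ofReal (f z)) z ^ p ∂cm := by
        refine lintegral_mono fun z => ?_
        refine le_trans ?_ (rpow_lintegral_le (hm z).aemeasurable hp)
        refine ENNReal.rpow_le_rpow ?_ (by linarith)
        exact mul_le_of_le_one_left' (by norm_num)
    _ = ∫⁻ θ, ∫⁻ z, shiftMax 0 θ (fun z => ENNReal.ofReal (f z)) z ^ p ∂volume ∂cm := by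
        refine (lintegral_lintegral_swap (μ := cm) (ν := volume) ?_).symm
        exact ((measurable_shiftMax 0 hf.measurable_ofReal).pow_const p).aemeasurable
    _ ≤ ∫⁻ _, (ENNReal.ofReal (C * 2) * ∫⁻ z, ENNReal.ofReal (f z ^ p)) ∂cm := by
        refine lintegral_mono fun θ => ?_
        simpa using h 0 θ f hf
    _ = _ := by simp

lemma tsum_rpow_le {h : ℕ → ℝ≥0∞} {s p : ℝ} (hs : 0 < s) (hp : 1 < p) :
    (∑' j, h j) ^ p ≤ ((1 - ENNReal.ofReal (s ^ (1 / p)))⁻¹) ^ p *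
      ∑' j, ENNReal.ofReal (s⁻¹ ^ j) * h j ^ p := by
  have hp0 : 0 < p := by linarith
  set u := ENNReal.ofReal (s ^ (1 / p)) with hu
  set W := ∑' j, ENNReal.ofReal (s⁻¹ ^ j) * h j ^ p with hW
  have hj : ∀ j, h j ≤ u ^ j * W ^ (1 / p) := by
    intro j
    have h1 : h j ^ p ≤ ENNReal.ofReal (s ^ j) * W := by
      calc h j ^ p = ENNReal.ofReal (s ^ j) * (ENNReal.ofReal (s⁻¹ ^ j) * h j ^ p) := by
            rw [← mul_assoc, ← ENNReal.ofReal_mul (by positivity), ← mul_pow,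
              mul_inv_cancel₀ hs.ne']
            simp
        _ ≤ _ := mul_le_mul_right (ENNReal.le_tsum (f := fun j =>
            ENNReal.ofReal (s⁻¹ ^ j) * h j ^ p) j) _
    calc h j = (h j ^ p) ^ (1 / p) := by
          rw [← ENNReal.rpow_mul, mul_one_div_cancel hp0.ne', ENNReal.rpow_one]
      _ ≤ (ENNReal.ofReal (s ^ j) * W) ^ (1 / p) := ENNReal.rpow_le_rpow h1 (by positivity)
      _ = _ := by
          rw [ENNReal.mul_rpow_of_nonneg _ _ (by positivity),
            ENNReal.ofReal_rpow_of_pos (by positivity), hu, ← ENNReal.ofReal_pow (by positivity)]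
          congr 2
          rw [← Real.rpow_natCast, ← Real.rpow_natCast, ← Real.rpow_mul hs.le,
            ← Real.rpow_mul hs.le, mul_comm]
  calc (∑' j, h j) ^ p ≤ (∑' j, u ^ j * W ^ (1 / p)) ^ p :=
        ENNReal.rpow_le_rpow (ENNReal.tsum_le_tsum hj) hp0.le
    _ = _ := by
        rw [ENNReal.tsum_mul_right, ENNReal.tsum_geometric, ENNReal.mul_rpow_of_nonneg _ _ hp0.le,
          ← ENNReal.rpow_mul, one_div_mul_cancel hp0.ne', ENNReal.rpow_one]

lemma lintegral_tmax_rpow_le_of_lt_two {p : ℝ} (hp : 1 < p) (hp2 : p < 2) :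
    ∃ C : ℝ≥0∞, C ≠ ∞ ∧ ∀ f : G1 → ℝ, CC f →
      ∫⁻ z, tmax f z ^ p ≤ C * ∫⁻ z, ENNReal.ofReal (f z ^ p) := by
  have hp0 : 0 < p := by linarith
  obtain ⟨C, hC, hb⟩ := lintegral_bmax_rpow_le hp
  obtain ⟨K, σ, hK, hσ, hσ1, hs⟩ := lintegral_smax_decay hp hp2
  set s := √σ with hsdef
  have hs0 : 0 < s := Real.sqrt_pos.2 hσ
  have hs1 : s < 1 := by rw [hsdef, Real.sqrt_lt' one_pos]; simpa using hσ1
  have hsσ : ∀ j : ℕ, s⁻¹ ^ j * σ ^ j = s ^ j := by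
    intro j
    rw [← mul_pow]
    congr 1
    rw [inv_mul_eq_iff_eq_mul₀ hs0.ne', hsdef, Real.mul_self_sqrt hσ.le]
  have hsum : Summable fun j : ℕ => K * (j + 3) * s ^ j := by
    have h1 := summable_pow_mul_geometric_of_norm_lt_one 1 (r := s)
      (by rw [Real.norm_of_nonneg hs0.le]; exact hs1)
    have h2 := summable_geometric_of_lt_one hs0.le hs1
    refine ((h1.mul_left K).add (h2.mul_left (3 * K))).congr fun j => ?_
    ring
  set U : ℝ≥0∞ := ((1 - ENNReal.ofReal (s ^ (1 / p)))⁻¹) ^ p with hU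
  have hUt : U ≠ ∞ := by
    refine ENNReal.rpow_ne_top_of_nonneg hp0.le (ENNReal.inv_ne_top.2 ?_)
    refine (tsub_pos_of_lt ?_).ne'
    rw [ENNReal.ofReal_lt_one]
    exact Real.rpow_lt_one hs0.le hs1 (by positivity)
  refine ⟨2 ^ (p - 1) * (ENNReal.ofReal C + U * ENNReal.ofReal (∑' j : ℕ, K * (j + 3) * s ^ j)),
    ?_, fun f hf => ?_⟩
  · exact ENNReal.mul_ne_top (ENNReal.rpow_ne_top_of_nonneg (by linarith) (by simp))
      (ENNReal.add_ne_top.2 ⟨ENNReal.ofReal_ne_top, ENNReal.mul_ne_top hUt ENNReal.ofReal_ne_top⟩)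
  have hm : ∀ j, Measurable fun z => ENNReal.ofReal (s⁻¹ ^ j) * smax j f z ^ p := fun j =>
    ((measurable_smax j hf.good).pow_const p).const_mul _
  set I := ∫⁻ z, ENNReal.ofReal (f z ^ p) with hI
  have hS : ∫⁻ z, ∑' j, ENNReal.ofReal (s⁻¹ ^ j) * smax j f z ^ p ≤
      ENNReal.ofReal (∑' j : ℕ, K * (j + 3) * s ^ j) * I := by
    rw [lintegral_tsum fun j => (hm j).aemeasurable,
      ENNReal.ofReal_tsum_of_nonneg (fun j => by positivity) hsum, ← ENNReal.tsum_mul_right]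
    refine ENNReal.tsum_le_tsum fun j => ?_
    rw [lintegral_const_mul' _ _ ENNReal.ofReal_ne_top]
    refine (mul_le_mul_right (hs j f hf) _).trans (le_of_eq ?_)
    rw [← mul_assoc, ← ENNReal.ofReal_mul (by positivity), ← hsσ j]
    congr 2; ring
  calc ∫⁻ z, tmax f z ^ p ≤ ∫⁻ z, 2 ^ (p - 1) * (bmax f z ^ p +
        U * ∑' j, ENNReal.ofReal (s⁻¹ ^ j) * smax j f z ^ p) := by
        refine lintegral_mono fun z => ?_
        refine (ENNReal.rpow_le_rpow (tmax_le hf z) hp0.le).trans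
          ((ENNReal.rpow_add_le_mul_rpow_add_rpow _ _ hp.le).trans ?_)
        gcongr
        exact tsum_rpow_le hs0 hp
    _ = 2 ^ (p - 1) * ((∫⁻ z, bmax f z ^ p) +
        U * ∫⁻ z, ∑' j, ENNReal.ofReal (s⁻¹ ^ j) * smax j f z ^ p) := by
        rw [lintegral_const_mul' _ _ (ENNReal.rpow_ne_top_of_nonneg (by linarith) (by simp)),
          lintegral_add_right, lintegral_const_mul' _ _ hUt]
        exact (Measurable.tsum hm).const_mul U
    _ ≤ 2 ^ (p - 1) * (ENNReal.ofReal C * I +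
        U * (ENNReal.ofReal (∑' j : ℕ, K * (j + 3) * s ^ j) * I)) := by
        gcongr
        exact hb f hf
    _ = _ := by ring

lemma measurable_tmax {f : G1 → ℝ} (hf : Good f) : Measurable (tmax f) :=
  Measurable.iSup fun k => (hf.tk k).cont.measurable.enorm

lemma tmax_le_of_bdd {f : G1 → ℝ} {M : ℝ} (hM : ∀ z, |f z| ≤ M) (z : G1) :
    tmax f z ≤ ENNReal.ofReal M := by
  refine iSup_le fun k => ?_
  rw [Real.enorm_eq_ofReal_abs]
  exact ENNReal.ofReal_le_ofReal (abs_av_le _ _ hM z)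

lemma lt_tmax_hi {f : G1 → ℝ} (hf : CC f) {t : ℝ} (ht : 0 < t) (z : G1)
    (hz : ENNReal.ofReal t < tmax f z) :
    ENNReal.ofReal (t / 2) < tmax (fun z => f z - min (f z) (1 / 2 * t)) z := by
  have hc : 0 ≤ 1 / 2 * t := by positivity
  by_contra hcon
  rw [not_lt] at hcon
  have hle : tmax f z ≤ tmax (fun z => f z - min (f z) (1 / 2 * t)) z + ENNReal.ofReal (t / 2) := by
    refine iSup_le fun k => ?_
    have e : (fun z => (f z - min (f z) (1 / 2 * t)) + min (f z) (1 / 2 * t)) = f := by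
      ext z; ring
    have e2 : tk k f z = tk k (fun z => f z - min (f z) (1 / 2 * t)) z +
        tk k (fun z => min (f z) (1 / 2 * t)) z := by
      conv_lhs => rw [← e, tk, av_add_of_good (hf.hi hc).good (hf.lo hc).good]
      rfl
    rw [e2]
    refine (enorm_add_le _ _).trans (add_le_add
      (le_iSup (fun k => ‖tk k (fun z => f z - min (f z) (1 / 2 * t)) z‖ₑ) k) ?_)
    rw [Real.enorm_eq_ofReal_abs]
    refine ENNReal.ofReal_le_ofReal (abs_av_le _ _ (fun z => ?_) z)
    rw [abs_of_nonneg ((hf.lo hc).nonneg z)]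
    exact (min_le_right _ _).trans (by linarith)
  refine absurd (hz.trans_le (hle.trans (add_le_add hcon le_rfl))) ?_
  rw [← ENNReal.ofReal_add (by positivity) (by positivity), add_halves]
  exact lt_irrefl _

lemma lintegral_tmax_rpow_le {p : ℝ} (hp : 1 < p) :
    ∃ C : ℝ≥0∞, C ≠ ∞ ∧ ∀ f : G1 → ℝ, CC f →
      ∫⁻ z, tmax f z ^ p ≤ C * ∫⁻ z, ENNReal.ofReal (f z ^ p) := by
  rcases lt_or_ge p 2 with hp2 | hp2
  · exact lintegral_tmax_rpow_le_of_lt_two hp hp2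
  obtain ⟨C, hC, h⟩ := lintegral_tmax_rpow_le_of_lt_two (p := 3 / 2) (by norm_num) (by norm_num)
  have hA : ENNReal.ofReal (2 ^ (3 / 2 : ℝ)) * C ≠ ∞ := ENNReal.mul_ne_top ENNReal.ofReal_ne_top hC
  refine ⟨ENNReal.ofReal (2 ^ (3 / 2 : ℝ)) * C *
    ENNReal.ofReal (p / (p - 3 / 2) * (1 / 2) ^ (3 / 2 - p)),
    ENNReal.mul_ne_top hA ENNReal.ofReal_ne_top, fun f hf => ?_⟩
  obtain ⟨M, hM⟩ := hf.bdd
  rw [mul_assoc]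
  refine interp_high (μ := volume) (p := p) (q := 3 / 2) (c := 1 / 2) hf.cont.measurable hf.nonneg
    (measurable_tmax hf.good)
    (fun z => ne_top_of_le_ne_top ENNReal.ofReal_ne_top (tmax_le_of_bdd hM z))
    (by norm_num) (by linarith) (by norm_num) hA fun t ht => ?_
  have hc : 0 ≤ 1 / 2 * t := by positivity
  calc _ ≤ volume {z | ENNReal.ofReal (t / 2) < tmax (fun z => f z - min (f z) (1 / 2 * t)) z} :=
        measure_mono fun z hz => lt_tmax_hi hf ht z hz
    _ ≤ ENNReal.ofReal (2 ^ (3 / 2 : ℝ) * t ^ (-(3 / 2) : ℝ)) *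
          ∫⁻ z, tmax (fun z => f z - min (f z) (1 / 2 * t)) z ^ (3 / 2 : ℝ) :=
        meas_lt_le (measurable_tmax (hf.hi hc).good) ht (by norm_num)
    _ ≤ ENNReal.ofReal (2 ^ (3 / 2 : ℝ) * t ^ (-(3 / 2) : ℝ)) * (C *
          ∫⁻ z in {z | 1 / 2 * t < f z}, ENNReal.ofReal (f z ^ (3 / 2 : ℝ))) := by
        refine mul_le_mul_right ((h _ (hf.hi hc)).trans ?_) _
        exact mul_le_mul_right (lintegral_hi_rpow_le hf hc (by norm_num)) _
    _ = _ := by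
        rw [ENNReal.ofReal_mul (by positivity)]
        ring

lemma hausdorffMeasure_hemisphere_lt_top {E : Type*} [NormedAddCommGroup E]
    [InnerProductSpace ℝ E] [FiniteDimensional ℝ E] [MeasurableSpace E] [BorelSpace E] {v : E}
    (hv : ‖v‖ = 1) :
    Measure.hausdorffMeasure (Module.finrank ℝ (Submodule.span ℝ {v})ᗮ : ℝ)
      {y : E | ‖y‖ = 1 ∧ inner ℝ v y ≤ 0} < ∞ := by
  set g : (Submodule.span ℝ {v})ᗮ → E := fun w => stereoInvFunAux v (w : E) with hg
  have hc : ContDiff ℝ 1 g := contDiff_stereoInvFunAux.comp (Submodule.span ℝ {v})ᗮ.subtypeL.contDiff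
  obtain ⟨K, hK⟩ := (hc.locallyLipschitz.locallyLipschitzOn
    (s := Metric.closedBall 0 2)).exists_lipschitzOnWith_of_compact (isCompact_closedBall 0 2)
  have hsub : {y : E | ‖y‖ = 1 ∧ inner ℝ v y ≤ 0} ⊆ g '' Metric.closedBall 0 2 := by
    rintro y ⟨hy1, hy2⟩
    have hys : y ∈ Metric.sphere (0 : E) 1 := by simpa using hy1
    have hyv : y ≠ v := by
      rintro rfl
      rw [real_inner_self_eq_norm_sq, hv] at hy2
      norm_num at hy2
    refine ⟨stereoToFun v y, ?_, ?_⟩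
    · rw [mem_closedBall_zero_iff, stereoToFun_apply, norm_smul, innerSL_apply_apply,
        Real.norm_of_nonneg (by apply div_nonneg <;> linarith)]
      have h1 : 2 / (1 - inner ℝ v y) ≤ 2 := by
        rw [div_le_iff₀ (by linarith)]; linarith
      have h2 : ‖(Submodule.span ℝ {v})ᗮ.orthogonalProjectionOnto y‖ ≤ 1 := by
        refine (Submodule.norm_orthogonalProjectionOnto_apply_le _ y).trans hy1.le
      calc _ ≤ (2 : ℝ) * 1 := mul_le_mul h1 h2 (norm_nonneg _) (by norm_num)
        _ = 2 := by norm_num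
    · exact congrArg Subtype.val (stereo_left_inv hv (x := ⟨y, hys⟩) hyv)
  refine (measure_mono hsub).trans_lt ((hK.hausdorffMeasure_image_le (Nat.cast_nonneg _)).trans_lt ?_)
  exact ENNReal.mul_lt_top (ENNReal.rpow_lt_top_of_nonneg (Nat.cast_nonneg _) (by simp))
    (isCompact_closedBall 0 2).measure_lt_top

lemma isFiniteMeasure_sphMeas {m : ℕ} (hm : 1 ≤ m) : IsFiniteMeasure (sphMeas m) := by
  refine ⟨?_⟩
  rw [sphMeas, Measure.restrict_apply_univ]
  have : Fact (Module.finrank ℝ (Vm m) = (2 * m - 1) + 1) := ⟨by simp; omega⟩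
  have : Nontrivial (Vm m) := Module.nontrivial_of_finrank_pos (R := ℝ) (by simp; omega)
  obtain ⟨v, hv⟩ := exists_norm_eq (Vm m) zero_le_one
  have hd : ∀ v : Vm m, ‖v‖ = 1 →
      (Module.finrank ℝ (Submodule.span ℝ {v})ᗮ : ℝ) = 2 * (m : ℝ) - 1 := by
    intro v hv
    rw [Submodule.finrank_orthogonal_span_singleton (n := 2 * m - 1)
      (norm_ne_zero_iff.1 (by rw [hv]; norm_num)), Nat.cast_sub (by omega)]
    push_cast; ring
  have h1 := hausdorffMeasure_hemisphere_lt_top hv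
  have h2 := hausdorffMeasure_hemisphere_lt_top (v := -v) (by rwa [norm_neg])
  rw [hd _ hv] at h1
  rw [hd _ (by rwa [norm_neg])] at h2
  refine (measure_mono ?_).trans_lt ((measure_union_le _ _).trans_lt (ENNReal.add_lt_top.2 ⟨h1, h2⟩))
  intro y hy
  have hy : ‖y‖ = 1 := by simpa using hy
  rcases le_total (inner ℝ v y) 0 with h | h
  · exact Or.inl ⟨hy, h⟩
  · exact Or.inr ⟨hy, by rw [inner_neg_left]; linarith⟩

lemma measurePreserving_sphMeas {m : ℕ} (e : Vm m ≃ₗᵢ[ℝ] Vm m) :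
    MeasurePreserving e (sphMeas m) (sphMeas m) := by
  have h := (e.toIsometryEquiv.measurePreserving_hausdorffMeasure (2 * (m : ℝ) - 1)).restrict_preimage
    (s := Metric.sphere (0 : Vm m) 1) Metric.isClosed_sphere.measurableSet
  have hs : e.toIsometryEquiv ⁻¹' Metric.sphere (0 : Vm m) 1 = Metric.sphere (0 : Vm m) 1 := by
    ext y; simp
  rwa [hs] at h

lemma sum_fin_two_mul {m : ℕ} (F : Fin (2 * m) → ℝ) :
    ∑ i, F i = ∑ j : Fin m, (F ⟨(j : ℕ), by omega⟩ + F ⟨m + (j : ℕ), by omega⟩) := by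
  rw [← (finCongr (two_mul m)).symm.sum_comp, Fin.sum_univ_add, ← Finset.sum_add_distrib]
  rfl

/-- The complex structure on the horizontal layer. -/
def jV (m : ℕ) : Vm m →ₗ[ℝ] Vm m where
  toFun y := WithLp.toLp 2 fun i : Fin (2 * m) =>
    if h : (i : ℕ) < m then -y ⟨m + i, by omega⟩ else y ⟨i - m, by omega⟩
  map_add' x y := by
    ext i
    by_cases h : (i : ℕ) < m <;> simp [h]; ring
  map_smul' c y := by
    ext i
    by_cases h : (i : ℕ) < m <;> simp [h]

lemma jV_fst {m : ℕ} (y : Vm m) (j : Fin m) :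
    jV m y ⟨(j : ℕ), by omega⟩ = -y ⟨m + (j : ℕ), by omega⟩ := by
  simp [jV]

lemma jV_snd {m : ℕ} (y : Vm m) (j : Fin m) :
    jV m y ⟨m + (j : ℕ), by omega⟩ = y ⟨(j : ℕ), by omega⟩ := by
  simp [jV]

lemma inner_eq_sum {m : ℕ} (x y : Vm m) : inner ℝ x y = ∑ j : Fin m,
    (x ⟨(j : ℕ), by omega⟩ * y ⟨(j : ℕ), by omega⟩ +
      x ⟨m + (j : ℕ), by omega⟩ * y ⟨m + (j : ℕ), by omega⟩) := by
  rw [PiLp.inner_apply, sum_fin_two_mul]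
  simp [mul_comm]

lemma sympV_eq {m : ℕ} (x y : Vm m) : sympV m x y = -(1 / 2) * inner ℝ x (jV m y) := by
  rw [sympV, inner_eq_sum, Finset.mul_sum, Finset.mul_sum]
  refine Finset.sum_congr rfl fun j _ => ?_
  rw [jV_fst, jV_snd]; ring

lemma inner_jV_jV {m : ℕ} (x y : Vm m) : inner ℝ (jV m x) (jV m y) = inner ℝ x y := by
  rw [inner_eq_sum, inner_eq_sum]
  refine Finset.sum_congr rfl fun j _ => ?_
  rw [jV_fst, jV_snd, jV_fst, jV_snd]; ring

lemma inner_jV_right {m : ℕ} (x y : Vm m) : inner ℝ x (jV m y) = -inner ℝ (jV m x) y := by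
  rw [inner_eq_sum, inner_eq_sum, ← Finset.sum_neg_distrib]
  refine Finset.sum_congr rfl fun j _ => ?_
  rw [jV_fst, jV_snd, jV_fst, jV_snd]; ring

lemma inner_self_jV {m : ℕ} (y : Vm m) : inner ℝ y (jV m y) = 0 := by
  have h := inner_jV_right y y
  rw [real_inner_comm] at h
  rw [real_inner_comm]
  linarith

lemma inner_jV_jV_right {m : ℕ} (x y : Vm m) : inner ℝ x (jV m (jV m y)) = -inner ℝ x y := by
  rw [inner_jV_right, inner_jV_jV]

lemma norm_jV {m : ℕ} (y : Vm m) : ‖jV m y‖ = ‖y‖ := by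
  rw [norm_eq_sqrt_real_inner, norm_eq_sqrt_real_inner y, inner_jV_jV]

/-- The rotations generated by the complex structure, composed with the antipodal map. -/
def rotV (m : ℕ) (θ : ℝ) : Vm m →ₗᵢ[ℝ] Vm m where
  toLinearMap := -(Real.cos θ • LinearMap.id + Real.sin θ • jV m)
  norm_map' y := by
    simp only [LinearMap.neg_apply, LinearMap.add_apply, LinearMap.smul_apply, LinearMap.id_apply,
      norm_neg]
    rw [← sq_eq_sq₀ (norm_nonneg _) (norm_nonneg _), norm_add_sq_real, norm_smul, norm_smul,
      real_inner_smul_left, real_inner_smul_right, inner_self_jV, norm_jV, mul_pow, mul_pow,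
      Real.norm_eq_abs, Real.norm_eq_abs, sq_abs, sq_abs]
    linear_combination ‖y‖ ^ 2 * Real.cos_sq_add_sin_sq θ

lemma rotV_apply {m : ℕ} (θ : ℝ) (y : Vm m) :
    rotV m θ y = -(Real.cos θ • y + Real.sin θ • jV m y) := rfl

lemma continuous_rotV (m : ℕ) : Continuous fun w : ℝ × Vm m => rotV m w.1 w.2 := by
  have h : Continuous (jV m) := (jV m).continuous_of_finiteDimensional
  simp only [rotV_apply]
  fun_prop

lemma measurePreserving_rotV (m : ℕ) (θ : ℝ) :
    MeasurePreserving (rotV m θ) (sphMeas m) (sphMeas m) :=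
  measurePreserving_sphMeas ((rotV m θ).toLinearIsometryEquiv rfl)

lemma continuous_sympV (m : ℕ) : Continuous fun w : Vm m × Vm m => sympV m w.1 w.2 := by
  have h : Continuous (jV m) := (jV m).continuous_of_finiteDimensional
  simp only [sympV_eq]
  fun_prop

lemma sympV_rotV {m : ℕ} (x y : Vm m) (θ : ℝ) : sympV m x (rotV m θ y) =
    (1 / 2) * (Real.cos θ * inner ℝ x (jV m y) - Real.sin θ * inner ℝ x y) := by
  rw [sympV_eq, rotV_apply, map_neg, map_add, map_smul, map_smul, inner_neg_right, inner_add_right,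
    real_inner_smul_right, real_inner_smul_right, inner_jV_jV_right]
  ring

/-- The orthogonal complement of the complex line through `y`. -/
def orthV {m : ℕ} (y : Vm m) : Submodule ℝ (Vm m) :=
  LinearMap.ker (innerₛₗ ℝ y) ⊓ LinearMap.ker (innerₛₗ ℝ (jV m y))

lemma mem_orthV {m : ℕ} {y x : Vm m} :
    x ∈ orthV y ↔ inner ℝ y x = 0 ∧ inner ℝ (jV m y) x = 0 := by
  simp [orthV]

/-- The fibration of the Heisenberg group by translates of three-dimensional subgroups. -/
def fibL {m : ℕ} (y : Vm m) : (orthV y × G1) →ₗ[ℝ] HP m where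
  toFun w := ((w.1 : Vm m) + w.2.1.1 • y + w.2.1.2 • jV m y, w.2.2)
  map_add' a b := by
    simp only [Prod.fst_add, Prod.snd_add, Submodule.coe_add, add_smul, Prod.mk_add_mk,
      Prod.mk.injEq, and_true]
    abel
  map_smul' c a := by
    simp [mul_smul, smul_add]

lemma fibL_apply {m : ℕ} (y : Vm m) (w : orthV y) (g : G1) :
    fibL y (w, g) = ((w : Vm m) + g.1.1 • y + g.1.2 • jV m y, g.2) := rfl

lemma inner_fibL {m : ℕ} {y : Vm m} (hy : ‖y‖ = 1) (w : orthV y) (g : G1) :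
    inner ℝ (fibL y (w, g)).1 y = g.1.1 ∧ inner ℝ (fibL y (w, g)).1 (jV m y) = g.1.2 := by
  obtain ⟨h1, h2⟩ := mem_orthV.1 w.2
  have h3 := inner_self_jV y
  have h4 : inner ℝ (jV m y) y = 0 := by rw [real_inner_comm]; exact h3
  have h5 : inner ℝ y y = (1 : ℝ) := by rw [real_inner_self_eq_norm_sq, hy]; norm_num
  rw [real_inner_comm] at h1 h2
  constructor
  · simp only [fibL_apply, inner_add_left, real_inner_smul_left, h1, h4, h5]; ring
  · simp only [fibL_apply, inner_add_left, real_inner_smul_left, h2, h3, inner_jV_jV, h5]; ring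

lemma fibL_gmul {m : ℕ} {y : Vm m} (hy : ‖y‖ = 1) (w : orthV y) (g : G1) (r θ : ℝ) :
    fibL y (w, gmul g (gdil r (gcirc θ))) =
      ((fibL y (w, g)).1 - r • rotV m θ y, (fibL y (w, g)).2 -
        r * sympV m (fibL y (w, g)).1 (rotV m θ y)) := by
  obtain ⟨h1, h2⟩ := inner_fibL hy w g
  rw [sympV_rotV, h1, h2, rotV_apply]
  refine Prod.ext ?_ ?_
  · simp only [fibL_apply, gmul, gdil, gcirc, smul_neg, smul_add, add_smul, mul_smul]
    abel
  · simp only [fibL_apply, gmul, gdil, gcirc]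
    ring

lemma bijective_fibL {m : ℕ} {y : Vm m} (hy : ‖y‖ = 1) : Function.Bijective (fibL y) := by
  constructor
  · rintro ⟨w, g⟩ ⟨w', g'⟩ h
    obtain ⟨h1, h2⟩ := inner_fibL hy w g
    obtain ⟨h1', h2'⟩ := inner_fibL hy w' g'
    rw [h] at h1 h2
    have h0 : g.2 = g'.2 := congrArg (fun x : HP m => x.2) h
    have e : g = g' := Prod.ext (Prod.ext (h1.symm.trans h1') (h2.symm.trans h2')) h0
    subst e
    have h3 : (fibL y (w, g)).1 = (fibL y (w', g)).1 := congrArg (fun x : HP m => x.1) h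
    simp only [fibL_apply, _root_.add_left_inj] at h3
    have h4 : w = w' := Subtype.ext h3
    rw [h4]
  · rintro ⟨x, u⟩
    have h3 := inner_self_jV y
    have h4 : inner ℝ (jV m y) y = 0 := by rw [real_inner_comm]; exact h3
    have h5 : inner ℝ y y = (1 : ℝ) := by rw [real_inner_self_eq_norm_sq, hy]; norm_num
    refine ⟨(⟨x - (inner ℝ y x) • y - (inner ℝ (jV m y) x) • jV m y, mem_orthV.2 ⟨?_, ?_⟩⟩,
      ((inner ℝ y x, inner ℝ (jV m y) x), u)), ?_⟩
    · simp only [inner_sub_right, real_inner_smul_right, h3, h5]; ring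
    · simp only [inner_sub_right, real_inner_smul_right, h4, inner_jV_jV, h5]; ring
    · rw [fibL_apply]
      refine Prod.ext ?_ rfl
      simp only
      abel

/-- The fibration as a linear homeomorphism. -/
def fibE {m : ℕ} {y : Vm m} (hy : ‖y‖ = 1) : (orthV y × G1) ≃L[ℝ] HP m :=
  (LinearEquiv.ofBijective (fibL y) (bijective_fibL hy)).toContinuousLinearEquiv

lemma exists_map_fibE {m : ℕ} {y : Vm m} (hy : ‖y‖ = 1) : ∃ c : ℝ≥0∞, c ≠ 0 ∧ c ≠ ∞ ∧
    (volume : Measure (HP m)) = c • Measure.map (fibE hy)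
      ((volume : Measure (orthV y)).prod (volume : Measure G1)) := by
  have h1 : ((volume : Measure (orthV y)).prod (volume : Measure G1)).IsAddHaarMeasure :=
    Measure.prod.instIsAddHaarMeasure _ _
  have h2 := (fibE hy).isAddHaarMeasure_map
    ((volume : Measure (orthV y)).prod (volume : Measure G1))
  have h3 : (volume : Measure (HP m)).IsAddHaarMeasure :=
    inferInstanceAs ((volume : Measure (Vm m)).prod (volume : Measure ℝ)).IsAddHaarMeasure
  have h4 := Measure.isAddLeftInvariant_eq_smul (volume : Measure (HP m)) (Measure.map (fibE hy)
    ((volume : Measure (orthV y)).prod (volume : Measure G1)))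
  refine ⟨_, ?_, ?_, h4⟩
  · exact_mod_cast (Measure.addHaarScalarFactor_pos_of_isAddHaarMeasure _ _).ne'
  · exact ENNReal.coe_ne_top

/-- Right translation by the inverse of a dilated horizontal element. -/
def hsh {m : ℕ} (r : ℝ) (z : HP m) (y : Vm m) : HP m := (z.1 - r • y, z.2 - r * sympV m z.1 y)

lemma continuous_hsh {m : ℕ} (r : ℝ) : Continuous fun w : HP m × Vm m => hsh r w.1 w.2 := by
  have h : Continuous fun w : HP m × Vm m => sympV m w.1.1 w.2 :=
    (continuous_sympV m).comp (f := fun w : HP m × Vm m => (w.1.1, w.2)) (by fun_prop)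
  unfold hsh
  fun_prop

/-- The maximal average over dilates of the circle through `y` in its complex line. -/
def cmax {m : ℕ} (g : HP m → ℝ) (y : Vm m) (z : HP m) : ℝ≥0∞ :=
  ⨆ k : ℤ, ∫⁻ θ, ENNReal.ofReal (g (hsh ((2 : ℝ) ^ k) z (rotV m θ y))) ∂cm

lemma continuous_hsh_rotV {m : ℕ} (r : ℝ) :
    Continuous fun w : (Vm m × HP m) × ℝ => hsh r w.1.2 (rotV m w.2 w.1.1) := by
  have h1 : Continuous fun w : (Vm m × HP m) × ℝ => rotV m w.2 w.1.1 :=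
    (continuous_rotV m).comp (f := fun w : (Vm m × HP m) × ℝ => (w.2, w.1.1)) (by fun_prop)
  exact (continuous_hsh r).comp
    (f := fun w : (Vm m × HP m) × ℝ => (w.1.2, rotV m w.2 w.1.1)) (by fun_prop)

lemma measurable_cmax {m : ℕ} {g : HP m → ℝ} (hg : Continuous g) :
    Measurable fun w : Vm m × HP m => cmax g w.1 w.2 := by
  refine Measurable.iSup fun k => ?_
  refine Measurable.lintegral_prod_right' (f := fun w : (Vm m × HP m) × ℝ =>
    ENNReal.ofReal (g (hsh ((2 : ℝ) ^ k) w.1.2 (rotV m w.2 w.1.1)))) ?_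
  exact (hg.comp (continuous_hsh_rotV _)).measurable.ennreal_ofReal

lemma cc_fibL {m : ℕ} {g : HP m → ℝ} (hg : Continuous g) (hs : HasCompactSupport g)
    (h0 : ∀ z, 0 ≤ g z) {y : Vm m} (hy : ‖y‖ = 1) (w : orthV y) :
    CC fun z => g (fibL y (w, z)) := by
  have hc : Continuous fun z : G1 => fibL y (w, z) :=
    (fibE hy).continuous.comp (f := fun z : G1 => (w, z)) (by fun_prop)
  refine ⟨hg.comp hc, ?_, fun z => h0 _⟩
  have he : Topology.IsClosedEmbedding fun z : G1 => fibL y (w, z) :=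
    (fibE hy).toHomeomorph.isClosedEmbedding.comp ⟨isEmbedding_prodMkRight w, by
      have h : Set.range (Prod.mk w : G1 → orthV y × G1) = {w} ×ˢ Set.univ := by
        ext ⟨a, b⟩
        simp [eq_comm]
      rw [h]
      exact isClosed_singleton.prod isClosed_univ⟩
  exact hs.comp_isClosedEmbedding he

lemma tmax_fibL {m : ℕ} {g : HP m → ℝ} (hg : Continuous g) (hs : HasCompactSupport g)
    (h0 : ∀ z, 0 ≤ g z) {y : Vm m} (hy : ‖y‖ = 1) (w : orthV y) (z : G1) :
    tmax (fun z => g (fibL y (w, z))) z = cmax g y (fibL y (w, z)) := by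
  have hcc := cc_fibL hg hs h0 hy w
  obtain ⟨M, hM⟩ := hcc.bdd
  unfold tmax cmax
  congr 1
  ext1 k
  have hc : Continuous fun θ : ℝ => gmul z (gdil ((2 : ℝ) ^ k) (gcirc θ)) := by
    unfold gmul gdil gcirc
    fun_prop
  have hc' : Continuous fun a : G1 => gmul z (gdil ((2 : ℝ) ^ k) a) := by
    unfold gmul gdil
    fun_prop
  have hF : Continuous fun θ : ℝ => g (fibL y (w, gmul z (gdil ((2 : ℝ) ^ k) (gcirc θ)))) :=
    hcc.cont.comp hc
  have e : tk k (fun z => g (fibL y (w, z))) z =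
      ∫ θ, g (fibL y (w, gmul z (gdil ((2 : ℝ) ^ k) (gcirc θ)))) ∂cm := by
    unfold tk av circM
    rw [integral_map continuous_gcirc.measurable.aemeasurable]
    exact (hcc.cont.comp hc').aestronglyMeasurable
  rw [e, Real.enorm_of_nonneg (integral_nonneg fun θ => h0 _),
    ofReal_integral_eq_lintegral_ofReal _ (Eventually.of_forall fun θ => h0 _)]
  · simp only [fibL_gmul hy]
    rfl
  · exact Integrable.of_bound hF.aestronglyMeasurable M (Eventually.of_forall fun θ => hM _)

lemma lintegral_cmax_rpow_le {p : ℝ} (hp : 1 < p) : ∃ C : ℝ≥0∞, C ≠ ∞ ∧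
    ∀ {m : ℕ} {g : HP m → ℝ} (_ : Continuous g) (_ : HasCompactSupport g) (_ : ∀ z, 0 ≤ g z)
      {y : Vm m} (_ : ‖y‖ = 1),
      ∫⁻ z, cmax g y z ^ p ≤ C * ∫⁻ z, ENNReal.ofReal (g z ^ p) := by
  obtain ⟨C, hC, hT⟩ := lintegral_tmax_rpow_le hp
  refine ⟨C, hC, fun {m g} hg hs h0 y hy => ?_⟩
  obtain ⟨c, hc0, hc, hv⟩ := exists_map_fibE hy
  have key : ∀ F : HP m → ℝ≥0∞, Measurable F →
      ∫⁻ z, F z = c * ∫⁻ w : orthV y, ∫⁻ z : G1, F (fibL y (w, z)) := by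
    intro F hF
    have h1 := lintegral_prod (μ := (volume : Measure (orthV y))) (ν := (volume : Measure G1))
      (fun w => F (fibE hy w)) (hF.comp (fibE hy).continuous.measurable).aemeasurable
    rw [hv, lintegral_smul_measure, lintegral_map hF (fibE hy).continuous.measurable, h1]
    rfl
  have hm1 : Measurable fun z => cmax g y z ^ p :=
    ((measurable_cmax hg).comp measurable_prodMk_left).pow_const p
  have hm2 : Measurable fun z => ENNReal.ofReal (g z ^ p) :=
    (hg.measurable.pow_const p).ennreal_ofReal
  rw [key _ hm1, key _ hm2, ← mul_assoc, mul_comm C c, mul_assoc]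
  gcongr
  rw [← lintegral_const_mul' _ _ hC]
  refine lintegral_mono fun w => ?_
  have := hT _ (cc_fibL hg hs h0 hy w)
  simpa only [tmax_fibL hg hs h0 hy w] using this

lemma rpow_lintegral_le_of_isFiniteMeasure {X : Type*} [MeasurableSpace X] (ν : Measure X)
    [IsFiniteMeasure ν] {q : ℝ} (hq : 1 < q) : ∃ K : ℝ≥0∞, K ≠ ∞ ∧
    ∀ {h : X → ℝ≥0∞} (_ : AEMeasurable h ν), (∫⁻ x, h x ∂ν) ^ q ≤ K * ∫⁻ x, h x ^ q ∂ν := by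
  have hpq := Real.HolderConjugate.conjExponent hq
  have hq0 : 0 < q := by linarith
  refine ⟨((ν Set.univ) ^ (1 / q.conjExponent)) ^ q, ?_, fun {h} hh => ?_⟩
  · exact ENNReal.rpow_ne_top_of_nonneg hq0.le
      (ENNReal.rpow_ne_top_of_nonneg (one_div_nonneg.2 hpq.symm.nonneg) (measure_ne_top ν _))
  have := ENNReal.lintegral_mul_le_Lp_mul_Lq ν hpq hh (g := fun _ => 1) aemeasurable_const
  simp only [Pi.mul_apply, mul_one, ENNReal.one_rpow, lintegral_const, one_mul] at this
  calc (∫⁻ x, h x ∂ν) ^ q ≤ _ := ENNReal.rpow_le_rpow this hq0.le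
    _ = _ := by
      rw [ENNReal.mul_rpow_of_nonneg _ _ hq0.le, ← ENNReal.rpow_mul, one_div_mul_cancel hq0.ne',
        ENNReal.rpow_one, mul_comm]

lemma lintegral_lintegral_cmax_rpow_le {m : ℕ} (hm : 1 ≤ m) {p : ℝ} (hp : 1 < p) :
    ∃ C : ℝ≥0∞, C ≠ ∞ ∧ ∀ {g : HP m → ℝ} (_ : Continuous g) (_ : HasCompactSupport g)
      (_ : ∀ z, 0 ≤ g z), ∫⁻ z, (∫⁻ y, cmax g y z ∂sphMeas m) ^ p ≤
        C * ∫⁻ z, ENNReal.ofReal (g z ^ p) := by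
  have := isFiniteMeasure_sphMeas hm
  obtain ⟨C, hC, hT⟩ := lintegral_cmax_rpow_le hp
  obtain ⟨K, hK, hH⟩ := rpow_lintegral_le_of_isFiniteMeasure (sphMeas m) hp
  refine ⟨K * (C * sphMeas m Set.univ), ENNReal.mul_ne_top hK
    (ENNReal.mul_ne_top hC (measure_ne_top _ _)), fun {g} hg hs h0 => ?_⟩
  have hmeas := measurable_cmax hg
  calc ∫⁻ z, (∫⁻ y, cmax g y z ∂sphMeas m) ^ p
      ≤ ∫⁻ z, K * ∫⁻ y, cmax g y z ^ p ∂sphMeas m :=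
        lintegral_mono fun z => hH (hmeas.comp measurable_prodMk_right).aemeasurable
    _ = K * ∫⁻ y, (∫⁻ z, cmax g y z ^ p) ∂sphMeas m := by
        rw [lintegral_const_mul' _ _ hK, lintegral_lintegral_swap]
        exact ((hmeas.pow_const p).comp measurable_swap).aemeasurable
    _ ≤ K * ∫⁻ y, (C * ∫⁻ z, ENNReal.ofReal (g z ^ p)) ∂sphMeas m := by
        gcongr K * ?_
        refine lintegral_mono_ae ?_
        unfold sphMeas
        filter_upwards [ae_restrict_mem Metric.isClosed_sphere.measurableSet] with y hy
        exact hT hg hs h0 (by simpa using hy)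
    _ = _ := by rw [lintegral_const]; ring

lemma lintegral_hsh_le {m : ℕ} (hm : 1 ≤ m) {g : HP m → ℝ} (hg : Continuous g) (k : ℤ)
    (z : HP m) : ∫⁻ y, ENNReal.ofReal (g (hsh ((2 : ℝ) ^ k) z y)) ∂sphMeas m ≤
      ∫⁻ y, cmax g y z ∂sphMeas m := by
  have := isFiniteMeasure_sphMeas hm
  have h1 : ∀ θ : ℝ, ∫⁻ y, ENNReal.ofReal (g (hsh ((2 : ℝ) ^ k) z y)) ∂sphMeas m =
      ∫⁻ y, ENNReal.ofReal (g (hsh ((2 : ℝ) ^ k) z (rotV m θ y))) ∂sphMeas m := fun θ => by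
    refine ((measurePreserving_rotV m θ).lintegral_comp
      (f := fun y => ENNReal.ofReal (g (hsh ((2 : ℝ) ^ k) z y))) ?_).symm
    exact (hg.comp ((continuous_hsh _).comp
      (f := fun y : Vm m => (z, y)) (by fun_prop))).measurable.ennreal_ofReal
  calc ∫⁻ y, ENNReal.ofReal (g (hsh ((2 : ℝ) ^ k) z y)) ∂sphMeas m
      = ∫⁻ _, (∫⁻ y, ENNReal.ofReal (g (hsh ((2 : ℝ) ^ k) z y)) ∂sphMeas m) ∂cm := by simp
    _ = ∫⁻ θ, ∫⁻ y, ENNReal.ofReal (g (hsh ((2 : ℝ) ^ k) z (rotV m θ y))) ∂sphMeas m ∂cm :=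
        lintegral_congr h1
    _ = ∫⁻ y, ∫⁻ θ, ENNReal.ofReal (g (hsh ((2 : ℝ) ^ k) z (rotV m θ y))) ∂cm ∂sphMeas m := by
        refine lintegral_lintegral_swap ?_
        exact (hg.comp ((continuous_hsh_rotV _).comp
          (f := fun w : ℝ × Vm m => ((w.2, z), w.1)) 
            (by fun_prop))).measurable.ennreal_ofReal.aemeasurable
    _ ≤ _ := lintegral_mono fun y =>
        le_iSup (fun k : ℤ => ∫⁻ θ, ENNReal.ofReal (g (hsh ((2 : ℝ) ^ k) z (rotV m θ y))) ∂cm) k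

lemma enorm_iSup_abs_le {ι : Type*} [Nonempty ι] {a : ι → ℝ} {L : ℝ≥0∞} (h : ∀ i, ‖a i‖ₑ ≤ L) :
    ‖⨆ i, |a i|‖ₑ ≤ L := by
  rcases eq_or_ne L ∞ with rfl | hL
  · exact le_top
  rw [Real.enorm_of_nonneg (Real.iSup_nonneg fun i => abs_nonneg _)]
  refine ENNReal.ofReal_le_of_le_toReal (ciSup_le fun i => ?_)
  rw [← Real.norm_eq_abs, ← toReal_enorm]
  exact ENNReal.toReal_mono hL (h i)

/-- **Lacunary horizontal (Nevo–Thangavelu type) spherical maximal theorem on `ℍ^m`:**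
the maximal operator `f ↦ sup_k |∫_{S^{2m-1}} f(x - 2^k y, u - 2^k x^⊤Jy) dμ(y)|` is
bounded on `L^p(ℝ^{2m+1})` for all `1 < p ≤ ∞`. -/
theorem lacunary_horizontal_spherical_maximal (m : ℕ) (hm : 1 ≤ m) :
    ∀ p : ℝ≥0∞, 1 < p → ∃ C : ℝ, 0 < C ∧
      ∀ f : HP m → ℝ, Continuous f → HasCompactSupport f →
        eLpNorm (fun z : HP m =>
            ⨆ k : ℤ,
              |∫ y, f (z.1 - (2:ℝ) ^ k • y, z.2 - (2:ℝ) ^ k * sympV m z.1 y)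
                ∂(sphMeas m)|) p volume ≤
          ENNReal.ofReal C * eLpNorm f p volume := by
  intro p hp
  have := isFiniteMeasure_sphMeas hm
  have hv : (volume : Measure (HP m)).IsAddHaarMeasure :=
    inferInstanceAs ((volume : Measure (Vm m)).prod (volume : Measure ℝ)).IsAddHaarMeasure
  have of_const : ∀ {K a b : ℝ≥0∞}, K ≠ ∞ → a ≤ K * b →
      a ≤ ENNReal.ofReal (K.toReal + 1) * b := by
    intro K a b hK hab
    refine hab.trans (mul_le_mul_left
      ((ENNReal.le_ofReal_iff_toReal_le hK (by positivity)).2 ?_) b)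
    linarith
  rcases eq_or_ne p ∞ with rfl | hpt
  · refine ⟨(sphMeas m Set.univ).toReal + 1, by positivity, fun f hf hs => ?_⟩
    refine of_const (measure_ne_top _ _) ?_
    rw [eLpNorm_exponent_top, eLpNorm_exponent_top]
    have hL : ∀ z, ‖f z‖ₑ ≤ eLpNormEssSup f volume := by
      have h1 : ∀ᵐ z, ‖f z‖ₑ ≤ eLpNormEssSup f volume := ae_le_eLpNormEssSup
      have h2 : Dense {z | ‖f z‖ₑ ≤ eLpNormEssSup f volume} := Measure.dense_of_ae h1
      have h3 : IsClosed {z | ‖f z‖ₑ ≤ eLpNormEssSup f volume} :=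
        isClosed_le hf.enorm continuous_const
      intro z
      have := h2 z
      rwa [h3.closure_eq] at this
    refine eLpNormEssSup_le_of_ae_enorm_bound (Eventually.of_forall fun z => ?_)
    refine enorm_iSup_abs_le fun k => ?_
    refine (enorm_integral_le_lintegral_enorm _).trans ?_
    refine (lintegral_mono fun y => hL _).trans ?_
    rw [lintegral_const, mul_comm]
  · have hq : 1 < p.toReal := by
      rw [← ENNReal.toReal_one]
      exact (ENNReal.toReal_lt_toReal ENNReal.one_ne_top hpt).2 hp
    have hq0 : 0 < p.toReal := by linarith
    have hp0 : p ≠ 0 := (zero_lt_one.trans hp).ne'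
    obtain ⟨C, hC, hT⟩ := lintegral_lintegral_cmax_rpow_le hm hq
    refine ⟨(C ^ (1 / p.toReal)).toReal + 1, by positivity, fun f hf hs => ?_⟩
    refine of_const (ENNReal.rpow_ne_top_of_nonneg (one_div_nonneg.2 hq0.le) hC) ?_
    rw [eLpNorm_eq_lintegral_rpow_enorm_toReal hp0 hpt,
      eLpNorm_eq_lintegral_rpow_enorm_toReal hp0 hpt,
      ← ENNReal.mul_rpow_of_nonneg _ _ (one_div_nonneg.2 hq0.le)]
    refine ENNReal.rpow_le_rpow ?_ (one_div_nonneg.2 hq0.le)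
    have h1 := hT (g := fun z => |f z|) hf.abs (hs.comp_left (g := fun x : ℝ => |x|) abs_zero)
      fun z => abs_nonneg _
    have h2 : ∀ z, ENNReal.ofReal (|f z| ^ p.toReal) = ‖f z‖ₑ ^ p.toReal := fun z => by
      rw [← ENNReal.ofReal_rpow_of_nonneg (abs_nonneg _) hq0.le, ← Real.enorm_eq_ofReal_abs]
    simp only [h2] at h1
    refine (lintegral_mono fun z => ENNReal.rpow_le_rpow ?_ hq0.le).trans h1
    refine enorm_iSup_abs_le fun k => ?_
    refine (enorm_integral_le_lintegral_enorm _).trans ?_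
    simp only [Real.enorm_eq_ofReal_abs]
    exact lintegral_hsh_le hm hf.abs k z
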